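/- Let Δ be a simplicial complex and let R = 𝕜[Δ] be its Stanley–Reisner ring over a field 𝕜, and assume R is Cohen–Macaulay. Then tr(ω_R) = 𝔐_R^2 (equivalently, R is Gorenstein on the punctured spectrum but not nearly Gorenstein) if and only if Δ is a non-𝕜-orientable 𝕜-homology manifold. -/

import Mathlib

/-! # Preliminaries

Self-contained definitions: simplicial complexes, simplicial homology, Stanley–Reisner rings,
canonical modules, canonical traces, and the various Gorenstein-type conditions. -/

open CategoryTheory

/-- An abstract simplicial complex on the vertex set `Fin n` (the empty set is a face). -/
structure SC (n : ℕ) where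
  faces : Finset (Finset (Fin n))
  empty_mem : ∅ ∈ faces
  down_closed : ∀ {σ τ : Finset (Fin n)}, σ ∈ faces → τ ⊆ σ → τ ∈ faces

namespace SC

variable {n : ℕ} (Δ : SC n)

/-- The dimension of a simplicial complex, as an integer (the complex `{∅}` has
dimension `-1`). -/
def dim : ℤ := ((Δ.faces.sup Finset.card : ℕ) : ℤ) - 1

/-- `v` is a vertex of `Δ`. -/
def IsVertex (v : Fin n) : Prop := {v} ∈ Δ.faces

/-- A facet is a face which is maximal by inclusion. -/
def IsFacet (σ : Finset (Fin n)) : Prop :=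
  σ ∈ Δ.faces ∧ ∀ τ ∈ Δ.faces, σ ⊆ τ → σ = τ

/-- A cone point is a vertex contained in every facet. -/
def IsConePoint (v : Fin n) : Prop :=
  Δ.IsVertex v ∧ ∀ σ, Δ.IsFacet σ → v ∈ σ

/-- A simplicial complex is connected if it has a vertex and any two vertices are joined
by a path of edges. -/
def Connected : Prop :=
  (∃ v, Δ.IsVertex v) ∧ ∀ u v, Δ.IsVertex u → Δ.IsVertex v →
    Relation.ReflTransGen (fun a b => ({a, b} : Finset (Fin n)) ∈ Δ.faces) u v

/-- A simplicial complex is strongly connected if any two facets are joined by a chain of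
facets in which consecutive facets intersect in a face of dimension `dim Δ - 1`. -/
def StronglyConnected : Prop :=
  ∀ σ τ, Δ.IsFacet σ → Δ.IsFacet τ →
    Relation.ReflTransGen
      (fun α β => Δ.IsFacet α ∧ Δ.IsFacet β ∧ ((α ∩ β).card : ℤ) - 1 = Δ.dim - 1) σ τ

/-- A pseudomanifold: strongly connected, and every face of dimension `dim Δ - 1` is
contained in exactly two facets. -/
def IsPseudomanifold : Prop :=
  Δ.StronglyConnected ∧
    ∀ τ ∈ Δ.faces, (τ.card : ℤ) - 1 = Δ.dim - 1 →
      {σ : Finset (Fin n) | Δ.IsFacet σ ∧ τ ⊆ σ}.ncard = 2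

/-- The link of a face `σ` of `Δ`. -/
def link (σ : Finset (Fin n)) (hσ : σ ∈ Δ.faces) : SC n where
  faces := Δ.faces.filter fun τ => τ ∩ σ = ∅ ∧ τ ∪ σ ∈ Δ.faces
  empty_mem := by
    simp only [Finset.mem_filter]
    exact ⟨Δ.empty_mem, by simp, by simpa using hσ⟩
  down_closed := by
    intro σ' τ' h hsub
    simp only [Finset.mem_filter] at h ⊢
    refine ⟨Δ.down_closed h.1 hsub, ?_, ?_⟩
    · have := h.2.1
      rw [Finset.eq_empty_iff_forall_notMem] at this ⊢
      intro x hx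
      exact this x (Finset.mem_inter.mpr
        ⟨hsub (Finset.mem_inter.mp hx).1, (Finset.mem_inter.mp hx).2⟩)
    · exact Δ.down_closed h.2.2 (Finset.union_subset_union hsub (le_refl σ))

/-- A complex is normal if the link of every face of dimension `≤ dim Δ - 2` is connected. -/
def Normal : Prop :=
  ∀ σ (hσ : σ ∈ Δ.faces), (σ.card : ℤ) - 1 ≤ Δ.dim - 2 → (Δ.link σ hσ).Connected

/-! ## Simplicial homology -/

/-- Faces of `Δ` of cardinality `c` containing the face `σ`.  These index a basis of the
`c`-th chain group of the pair `(Δ, cost_Δ σ)` (for `σ = ∅` this is the augmented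
(reduced) chain complex of `Δ`, since the empty face is included in chain degree `0`). -/
def RFace (σ : Finset (Fin n)) (c : ℕ) : Type :=
  {τ : Finset (Fin n) // τ ∈ Δ.faces ∧ σ ⊆ τ ∧ τ.card = c}

instance (σ : Finset (Fin n)) (c : ℕ) : Fintype (Δ.RFace σ c) :=
  inferInstanceAs (Fintype {τ : Finset (Fin n) // τ ∈ Δ.faces ∧ σ ⊆ τ ∧ τ.card = c})

instance (σ : Finset (Fin n)) (c : ℕ) : DecidableEq (Δ.RFace σ c) :=
  inferInstanceAs (DecidableEq {τ : Finset (Fin n) // τ ∈ Δ.faces ∧ σ ⊆ τ ∧ τ.card = c})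

variable (R : Type) [CommRing R]

/-- Chains of the pair `(Δ, cost_Δ σ)` with coefficients in `R`. -/
abbrev relChain (σ : Finset (Fin n)) (c : ℕ) : Type := Δ.RFace σ c → R

/-- The matrix of the simplicial boundary map of the pair `(Δ, cost_Δ σ)`: the coefficient of
`ρ` in `∂ τ` is `(-1)^j` if `ρ` is obtained from `τ` by deleting its `(j+1)`-st vertex (the
deleted vertex not belonging to `σ`), and `0` otherwise. -/
def relBMat (σ : Finset (Fin n)) (i : ℕ) :
    Matrix (Δ.RFace σ i) (Δ.RFace σ (i + 1)) R :=
  fun ρ τ => ∑ v ∈ τ.1, if v ∉ σ ∧ τ.1.erase v = ρ.1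
    then (-1 : R) ^ ((τ.1.filter (fun w => w < v)).card) else 0

/-- The boundary map of the chain complex of the pair `(Δ, cost_Δ σ)`. -/
noncomputable def relBoundary (σ : Finset (Fin n)) (i : ℕ) :
    Δ.relChain R σ (i + 1) →ₗ[R] Δ.relChain R σ i :=
  (Δ.relBMat R σ i).mulVecLin

/-- The relative simplicial homology `H_d(Δ, cost_Δ σ; R)` (`d ≥ 0`). -/
noncomputable def relHomology (σ : Finset (Fin n)) (d : ℕ) : Type :=
  LinearMap.ker (Δ.relBoundary R σ d) ⧸
    Submodule.comap (LinearMap.ker (Δ.relBoundary R σ d)).subtype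
      (LinearMap.range (Δ.relBoundary R σ (d + 1)))

noncomputable instance (σ : Finset (Fin n)) (d : ℕ) : AddCommGroup (Δ.relHomology R σ d) :=
  inferInstanceAs (AddCommGroup (LinearMap.ker (Δ.relBoundary R σ d) ⧸
    Submodule.comap (LinearMap.ker (Δ.relBoundary R σ d)).subtype
      (LinearMap.range (Δ.relBoundary R σ (d + 1)))))

noncomputable instance (σ : Finset (Fin n)) (d : ℕ) : Module R (Δ.relHomology R σ d) :=
  inferInstanceAs (Module R (LinearMap.ker (Δ.relBoundary R σ d) ⧸
    Submodule.comap (LinearMap.ker (Δ.relBoundary R σ d)).subtype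
      (LinearMap.range (Δ.relBoundary R σ (d + 1)))))

/-- Reduced simplicial homology `H̃_d(Δ; R)` for `d ≥ 0`: the homology of the augmented chain
complex, i.e. of the pair `(Δ, cost_Δ ∅)`. -/
noncomputable abbrev reducedHomology (d : ℕ) : Type := Δ.relHomology R ∅ d

/-- Reduced simplicial homology in degree `-1`. -/
noncomputable def reducedHomologyNeg : Type :=
  (⊤ : Submodule R (Δ.relChain R ∅ 0)) ⧸
    Submodule.comap (⊤ : Submodule R (Δ.relChain R ∅ 0)).subtype
      (LinearMap.range (Δ.relBoundary R ∅ 0))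

noncomputable instance : AddCommGroup (Δ.reducedHomologyNeg R) :=
  inferInstanceAs (AddCommGroup ((⊤ : Submodule R (Δ.relChain R ∅ 0)) ⧸
    Submodule.comap (⊤ : Submodule R (Δ.relChain R ∅ 0)).subtype
      (LinearMap.range (Δ.relBoundary R ∅ 0))))

noncomputable instance : Module R (Δ.reducedHomologyNeg R) :=
  inferInstanceAs (Module R ((⊤ : Submodule R (Δ.relChain R ∅ 0)) ⧸
    Submodule.comap (⊤ : Submodule R (Δ.relChain R ∅ 0)).subtype
      (LinearMap.range (Δ.relBoundary R ∅ 0))))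

/-- Cycles of the non-augmented chain complex of `Δ` in dimension `d` (for `d = 0` every
`0`-chain is a cycle). -/
noncomputable def cyclesUnred (d : ℕ) : Submodule R (Δ.relChain R ∅ (d + 1)) :=
  if d = 0 then ⊤ else LinearMap.ker (Δ.relBoundary R ∅ d)

/-- (Unreduced) simplicial homology `H_d(Δ; R)`. -/
noncomputable def homologyUnred (d : ℕ) : Type :=
  Δ.cyclesUnred R d ⧸
    Submodule.comap (Δ.cyclesUnred R d).subtype (LinearMap.range (Δ.relBoundary R ∅ (d + 1)))

noncomputable instance (d : ℕ) : AddCommGroup (Δ.homologyUnred R d) :=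
  inferInstanceAs (AddCommGroup (Δ.cyclesUnred R d ⧸
    Submodule.comap (Δ.cyclesUnred R d).subtype (LinearMap.range (Δ.relBoundary R ∅ (d + 1)))))

noncomputable instance (d : ℕ) : Module R (Δ.homologyUnred R d) :=
  inferInstanceAs (Module R (Δ.cyclesUnred R d ⧸
    Submodule.comap (Δ.cyclesUnred R d).subtype (LinearMap.range (Δ.relBoundary R ∅ (d + 1)))))

/-- `Δ` is `R`-orientable if `H_d(Δ; R) ≠ 0`, where `d = dim Δ`. -/
def Orientable : Prop :=
  ∃ d : ℕ, Δ.dim = (d : ℤ) ∧ Nontrivial (Δ.homologyUnred R d)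

/-- A `k`-homology sphere condition for a single complex `Γ`:
`H̃_i(Γ; k) = k` for `i = dim Γ` and `0` otherwise. -/
def HomologySphereCond (Γ : SC n) : Prop :=
  (∀ i : ℕ, ((i : ℤ) = Γ.dim → Nonempty ((Γ.reducedHomology R i) ≃ₗ[R] R)) ∧
    ((i : ℤ) ≠ Γ.dim → Subsingleton (Γ.reducedHomology R i))) ∧
  ((-1 : ℤ) = Γ.dim → Nonempty ((Γ.reducedHomologyNeg R) ≃ₗ[R] R)) ∧
  ((-1 : ℤ) ≠ Γ.dim → Subsingleton (Γ.reducedHomologyNeg R))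

/-- `Δ` is a `k`-homology manifold: it is connected and the link of every nonempty face has
the reduced homology of a sphere of its dimension. -/
def IsHomologyManifold : Prop :=
  Δ.Connected ∧ ∀ σ (hσ : σ ∈ Δ.faces), σ ≠ ∅ → HomologySphereCond R (Δ.link σ hσ)

/-- `Δ` is isomorphic to the disjoint union of `m` vertices. -/
def IsDisjointVertices (m : ℕ) : Prop :=
  ∃ v : Fin m → Fin n, Function.Injective v ∧
    ∀ σ : Finset (Fin n), σ ∈ Δ.faces ↔ (σ = ∅ ∨ ∃ i, σ = {v i})

/-- `Δ` is isomorphic to a path of length `m` (with `m` edges and `m+1` vertices). -/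
def IsPathComplex (m : ℕ) : Prop :=
  ∃ v : Fin (m + 1) → Fin n, Function.Injective v ∧
    ∀ σ : Finset (Fin n), σ ∈ Δ.faces ↔
      (σ = ∅ ∨ (∃ i, σ = {v i}) ∨ ∃ i : Fin m, σ = {v i.castSucc, v i.succ})

end SC

/-! ## Commutative algebra -/

/-- The `i`-th Ext module `Ext^i_R(M, N)` of two `R`-modules, as an object of `ModuleCat R`. -/
noncomputable def extMod (R : Type) [CommRing R] (M N : Type) [AddCommGroup M] [Module R M]
    [AddCommGroup N] [Module R N] (i : ℕ) : ModuleCat R :=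
  ((Ext R (ModuleCat R) i).obj (Opposite.op (ModuleCat.of R M))).obj (ModuleCat.of R N)

/-- The trace ideal of an `R`-module `M`: the sum of the images of all `R`-linear maps
`M → R`. -/
noncomputable def traceIdeal (R : Type) [CommRing R] (M : Type) [AddCommGroup M] [Module R M] :
    Ideal R :=
  ⨆ f : M →ₗ[R] R, LinearMap.range f

/-- A Noetherian ring `R` with a distinguished maximal ideal `𝔪` (a local ring, or a graded
ring with its graded maximal ideal) is Cohen--Macaulay when `depth = dim`, i.e. (by the
Ext-characterisation of depth) `Ext^i_R(R/𝔪, R) = 0` for all `i < dim R`. -/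
def IsCohenMacaulayAt (R : Type) [CommRing R] (𝔪 : Ideal R) : Prop :=
  IsNoetherianRing R ∧
    ∀ i : ℕ, (i : WithBot (WithTop ℕ)) < ringKrullDim R → Subsingleton (extMod R (R ⧸ 𝔪) R i)

/-- A Noetherian ring `R` with a distinguished maximal ideal `𝔪` (a local ring, or a graded
ring with its graded maximal ideal) is Gorenstein when `Ext^i_R(R/𝔪, R)` vanishes for
`i ≠ dim R` and is isomorphic to `R/𝔪` for `i = dim R`. -/
def IsGorensteinAt (R : Type) [CommRing R] (𝔪 : Ideal R) : Prop :=
  IsNoetherianRing R ∧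
    ∀ i : ℕ, ((i : WithBot (WithTop ℕ)) = ringKrullDim R →
        Nonempty ((extMod R (R ⧸ 𝔪) R i) ≃ₗ[R] (R ⧸ 𝔪))) ∧
      ((i : WithBot (WithTop ℕ)) ≠ ringKrullDim R → Subsingleton (extMod R (R ⧸ 𝔪) R i))

/-- A Noetherian local ring is Gorenstein. -/
def IsGorensteinLocalRing (A : Type) [CommRing A] [IsLocalRing A] : Prop :=
  IsGorensteinAt A (IsLocalRing.maximalIdeal A)

section Graded

variable (k : Type) [Field k] {n : ℕ}

/-- An ideal of a polynomial ring is homogeneous (graded) if it contains all homogeneous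
components of its elements. -/
def IsHomogIdeal (I : Ideal (MvPolynomial (Fin n) k)) : Prop :=
  ∀ p ∈ I, ∀ d : ℕ, MvPolynomial.homogeneousComponent d p ∈ I

/-- The graded (irrelevant) maximal ideal of `k[x_1,…,x_n]/I`, generated by the images of the
variables. -/
noncomputable def quotMax (I : Ideal (MvPolynomial (Fin n) k)) :
    Ideal (MvPolynomial (Fin n) k ⧸ I) :=
  Ideal.span (Set.range fun i : Fin n => Ideal.Quotient.mk I (MvPolynomial.X i))

/-- The degree `j` component of the standard graded ring `k[x_1,…,x_n]/I`, as a
`k`-subspace. -/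
noncomputable def quotGrade (I : Ideal (MvPolynomial (Fin n) k)) (j : ℕ) :
    Submodule k (MvPolynomial (Fin n) k ⧸ I) :=
  (MvPolynomial.homogeneousSubmodule (Fin n) k j).map (Ideal.Quotient.mkₐ k I).toLinearMap

/-- The `ℤ^n`-graded component of `k[x_1,…,x_n]/I` of multidegree `a`: the `k`-line spanned by
the image of the monomial `x^a`. -/
noncomputable def quotMonomialGrade (I : Ideal (MvPolynomial (Fin n) k)) (a : Fin n → ℕ) :
    Submodule k (MvPolynomial (Fin n) k ⧸ I) :=
  Submodule.span k
    {Ideal.Quotient.mk I (MvPolynomial.monomial (Finsupp.equivFunOnFinite.symm a) (1 : k))}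

/-- The standard graded ring `R = k[x_1,…,x_n]/I` is Gorenstein on the punctured spectrum if
`R_𝔭` is Gorenstein for every graded prime `𝔭` other than the graded maximal ideal. -/
def GorensteinPunctured (I : Ideal (MvPolynomial (Fin n) k)) : Prop :=
  ∀ (𝔭 : Ideal (MvPolynomial (Fin n) k ⧸ I)) [𝔭.IsPrime],
    IsHomogIdeal k (𝔭.comap (Ideal.Quotient.mk I)) → 𝔭 ≠ quotMax k I →
      IsGorensteinLocalRing (Localization.AtPrime 𝔭)

/-- `ω` is a canonical module of the standard graded ring `R = k[x_1,…,x_n]/I`, `d = dim R`,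
when `ω ≅ Ext^{n-d}_S(R, S)` for `S = k[x_1,…,x_n]` (by graded local duality this is, up to
shift, the Matlis dual of the top local cohomology module `H^d_𝔪(R)`). -/
def IsCanonicalModuleQ (I : Ideal (MvPolynomial (Fin n) k)) (ω : Type) [AddCommGroup ω]
    [Module (MvPolynomial (Fin n) k ⧸ I) ω] : Prop :=
  Module.Finite (MvPolynomial (Fin n) k ⧸ I) ω ∧
    ∃ d : ℕ, ringKrullDim (MvPolynomial (Fin n) k ⧸ I) = (d : WithBot (WithTop ℕ)) ∧
      letI : Module (MvPolynomial (Fin n) k) ω := Module.compHom ω (Ideal.Quotient.mk I)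
      Nonempty (ω ≃ₗ[MvPolynomial (Fin n) k]
        (extMod (MvPolynomial (Fin n) k) (MvPolynomial (Fin n) k ⧸ I)
          (MvPolynomial (Fin n) k) (n - d)))

/-- A `ℤ`-grading on a module `ω` over `R = k[x_1,…,x_n]/I` compatible with the standard
grading of `R`. -/
def IsCompatibleGrading (I : Ideal (MvPolynomial (Fin n) k)) (ω : Type) [AddCommGroup ω]
    [Module (MvPolynomial (Fin n) k ⧸ I) ω] [Module k ω] (gr : ℤ → Submodule k ω) : Prop :=
  DirectSum.IsInternal gr ∧
    ∀ (i : ℕ) (j : ℤ) (r : MvPolynomial (Fin n) k ⧸ I) (m : ω),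
      r ∈ quotGrade k I i → m ∈ gr j → r • m ∈ gr ((i : ℤ) + j)

/-- The minimal number of generators of a module `M` over `R = k[…]/I` with graded maximal
ideal `𝔪`: the `k`-dimension of `M/𝔪M`. -/
noncomputable def muGen (R : Type) [CommRing R] [Algebra k R] (𝔪 : Ideal R) (M : Type)
    [AddCommGroup M] [Module R M] : ℕ :=
  letI : Module k (M ⧸ (𝔪 • (⊤ : Submodule R M))) :=
    Module.compHom (M ⧸ (𝔪 • (⊤ : Submodule R M))) (algebraMap k R)
  Module.finrank k (M ⧸ (𝔪 • (⊤ : Submodule R M)))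

/-- The Hilbert--Samuel function `j ↦ dim_k M/𝔪^j M` of a module. -/
noncomputable def hilbSam (R : Type) [CommRing R] [Algebra k R] (𝔪 : Ideal R) (M : Type)
    [AddCommGroup M] [Module R M] (j : ℕ) : ℕ :=
  letI : Module k (M ⧸ ((𝔪 ^ j) • (⊤ : Submodule R M))) :=
    Module.compHom (M ⧸ ((𝔪 ^ j) • (⊤ : Submodule R M))) (algebraMap k R)
  Module.finrank k (M ⧸ ((𝔪 ^ j) • (⊤ : Submodule R M)))

/-- `M` is an Ulrich module with respect to `𝔪`: its minimal number of generators `μ(M)`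
equals its multiplicity `e(𝔪; M) = lim_j t!·dim_k(M/𝔪^j M)/j^t`, where `t = dim M`. -/
def IsUlrich (R : Type) [CommRing R] [Algebra k R] (𝔪 : Ideal R) (M : Type) [AddCommGroup M]
    [Module R M] : Prop :=
  ∃ t : ℕ, ringKrullDim (R ⧸ Module.annihilator R M) = (t : WithBot (WithTop ℕ)) ∧
    Filter.Tendsto
      (fun j : ℕ => ((t.factorial : ℝ) * (hilbSam k R 𝔪 M j : ℝ)) / (j : ℝ) ^ t)
      Filter.atTop (nhds ((muGen k R 𝔪 M : ℝ)))

end Graded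

section SR

variable (k : Type) [Field k] {n : ℕ}

/-- The Stanley--Reisner ideal of `Δ`: generated by the squarefree monomials supported on
non-faces of `Δ`. -/
noncomputable def srIdeal (Δ : SC n) : Ideal (MvPolynomial (Fin n) k) :=
  Ideal.span {m | ∃ σ : Finset (Fin n), σ ∉ Δ.faces ∧ m = ∏ i ∈ σ, MvPolynomial.X i}

/-- The Stanley--Reisner ring `k[Δ]`. -/
abbrev SRRing (Δ : SC n) : Type := MvPolynomial (Fin n) k ⧸ srIdeal k Δ

/-- The graded maximal ideal of `k[Δ]`. -/
noncomputable abbrev srMax (Δ : SC n) : Ideal (SRRing k Δ) := quotMax k (srIdeal k Δ)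

/-- The value at `j` of the Hilbert function of the (canonically graded) canonical module of
`k[Δ]`, as computed by Gräbe's theorem:
`dim_k [ω]_j = Σ_{a ∈ ℕ^n, |a| = j} dim_k H_{dim Δ}(Δ, cost_Δ(supp a); k)`. -/
noncomputable def canonicalHilbert (Δ : SC n) (j : ℕ) : ℕ :=
  ∑ a ∈ (Fintype.piFinset fun _ : Fin n => Finset.range (j + 1)).filter
      (fun a => ∑ i, a i = j),
    Module.finrank k
      (Δ.relHomology k (Finset.univ.filter fun i => a i ≠ 0) (Δ.faces.sup Finset.card - 1))

/-- A `ℤ`-grading `gr` on a module `ω` over `k[Δ]` is the canonical grading of the canonical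
module if it is a compatible grading, is supported in nonnegative degrees, and its Hilbert
function is the one given by Gräbe's theorem. -/
def IsCanonicallyGraded (Δ : SC n) (ω : Type) [AddCommGroup ω] [Module (SRRing k Δ) ω]
    [Module k ω] (gr : ℤ → Submodule k ω) : Prop :=
  IsCompatibleGrading k (srIdeal k Δ) ω gr ∧ (∀ j : ℤ, j < 0 → gr j = ⊥) ∧
    ∀ j : ℕ, Module.finrank k (gr (j : ℤ)) = canonicalHilbert k Δ j

/-- A `ℤ^n`-grading `grN` on a module `ω` over `k[Δ]` (supported in `ℕ^n`) is the canonical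
multigrading of the canonical module if it is an internal direct sum, is compatible with the
`ℤ^n`-grading of `k[Δ]`, and its multigraded Hilbert function is the one given by Gräbe's
theorem: `dim_k [ω]_a = dim_k H_{dim Δ}(Δ, cost_Δ(supp a); k)`. -/
def IsCanonicallyMultiGraded (Δ : SC n) (ω : Type) [AddCommGroup ω] [Module (SRRing k Δ) ω]
    [Module k ω] (grN : (Fin n → ℕ) → Submodule k ω) : Prop :=
  DirectSum.IsInternal grN ∧
    (∀ (a b : Fin n → ℕ) (r : SRRing k Δ) (m : ω),
      r ∈ quotMonomialGrade k (srIdeal k Δ) a → m ∈ grN b → r • m ∈ grN (a + b)) ∧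
    ∀ a : Fin n → ℕ, Module.finrank k (grN a) =
      Module.finrank k
        (Δ.relHomology k (Finset.univ.filter fun i => a i ≠ 0) (Δ.faces.sup Finset.card - 1))

end SR

/-- The chain map `C_•(Δ, cost_Δ τ) → C_•(Δ, cost_Δ σ)` (for `τ ⊆ σ`) induced by the
inclusion `cost_Δ τ ⊆ cost_Δ σ`: basis faces not containing `σ` are sent to `0`. -/
def SC.relChainMap {n : ℕ} (Δ : SC n) (R : Type) [CommRing R] (τ σ : Finset (Fin n)) (c : ℕ) :
    Δ.relChain R τ c →ₗ[R] Δ.relChain R σ c :=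
  Matrix.mulVecLin (fun (β : Δ.RFace σ c) (α : Δ.RFace τ c) => if α.1 = β.1 then (1 : R) else 0)

set_option synthInstance.maxHeartbeats 1000000 in
/-- `R = k[x_1,…,x_n]/I` is almost Gorenstein with respect to a canonical module `ω` with
(canonical) grading `gr`: writing `a = a_R` for the `a`-invariant (so `-a` is the least degree
of `ω`), there is an injective degree-zero `R`-linear map `φ : R → ω(-a)` whose cokernel is
zero or an Ulrich module. -/
def IsAlmostGorenstein (k : Type) [Field k] {n : ℕ} (I : Ideal (MvPolynomial (Fin n) k))
    (ω : Type) [AddCommGroup ω] [Module (MvPolynomial (Fin n) k ⧸ I) ω] [Module k ω]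
    (gr : ℤ → Submodule k ω) : Prop :=
  ∃ a : ℤ, (gr (-a) ≠ ⊥ ∧ ∀ j : ℤ, j < -a → gr j = ⊥) ∧
    ∃ φ : (MvPolynomial (Fin n) k ⧸ I) →ₗ[MvPolynomial (Fin n) k ⧸ I] ω,
      Function.Injective φ ∧
      (∀ (i : ℕ) (r : MvPolynomial (Fin n) k ⧸ I),
        r ∈ quotGrade k I i → φ r ∈ gr ((i : ℤ) - a)) ∧
      (Subsingleton (ω ⧸ LinearMap.range φ) ∨
        IsUlrich k (MvPolynomial (Fin n) k ⧸ I) (quotMax k I) (ω ⧸ LinearMap.range φ))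


section PieceP1

open MvPolynomial

/-- indicator exponent -/
noncomputable def ind {n : ℕ} (σ : Finset (Fin n)) : Fin n →₀ ℕ :=
  Finsupp.equivFunOnFinite.symm (fun i => if i ∈ σ then 1 else 0)

@[simp] lemma ind_apply {n : ℕ} (σ : Finset (Fin n)) (i : Fin n) :
    ind σ i = if i ∈ σ then 1 else 0 := rfl

@[simp] lemma ind_support {n : ℕ} (σ : Finset (Fin n)) : (ind σ).support = σ := by
  ext i; simp

lemma ind_singleton {n : ℕ} (v : Fin n) : ind {v} = Finsupp.single v 1 := by
  ext i; simp [Finsupp.single_apply, eq_comm]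

lemma prod_X_eq {k : Type} [Field k] {n : ℕ} (σ : Finset (Fin n)) :
    (∏ i ∈ σ, (X i : MvPolynomial (Fin n) k)) = monomial (ind σ) 1 := by
  have : ind σ = ∑ i ∈ σ, Finsupp.single i 1 := by
    ext i; simp [Finsupp.finsetSum_apply, Finsupp.single_apply]
  rw [this, monomial_sum_one]
  rfl

section Mon

variable (k : Type) [Field k] {n : ℕ}

/-- The squarefree monomial ideal of a lower set of finsets. -/
noncomputable def mI (Γ : LowerSet (Finset (Fin n))) : Ideal (MvPolynomial (Fin n) k) where
  carrier := {p | ∀ a : Fin n →₀ ℕ, a.support ∈ Γ → p.coeff a = 0}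
  zero_mem' := by intro a _; simp
  add_mem' := by intro p q hp hq a ha; simp [hp a ha, hq a ha]
  smul_mem' := by
    classical
    intro c p hp a ha
    rw [smul_eq_mul, coeff_mul]
    apply Finset.sum_eq_zero
    rintro ⟨b, b'⟩ hb
    rw [Finset.HasAntidiagonal.mem_antidiagonal] at hb
    simp only at hb ⊢
    rw [hp b', mul_zero]
    apply Γ.lower _ ha
    subst hb
    intro i hi
    simp only [Finsupp.mem_support_iff, Finsupp.add_apply] at hi ⊢
    omega

lemma mem_mI {Γ : LowerSet (Finset (Fin n))} {p : MvPolynomial (Fin n) k} :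
    p ∈ mI k Γ ↔ ∀ a : Fin n →₀ ℕ, a.support ∈ Γ → p.coeff a = 0 := Iff.rfl

lemma mI_anti {Γ Γ' : LowerSet (Finset (Fin n))} (h : Γ' ≤ Γ) : mI k Γ ≤ mI k Γ' :=
  fun _ hp a ha => hp a (h ha)

/-- The quotient ring. -/
abbrev Qr (Γ : LowerSet (Finset (Fin n))) : Type := MvPolynomial (Fin n) k ⧸ mI k Γ

/-- faces as a lower set -/
def SC.low (Δ : SC n) : LowerSet (Finset (Fin n)) where
  carrier := Δ.faces
  lower' := fun _ _ h hs => Δ.down_closed hs h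

lemma SC.mem_low {Δ : SC n} {σ : Finset (Fin n)} : σ ∈ Δ.low ↔ σ ∈ Δ.faces := Iff.rfl

lemma monomial_mem_mI {Γ : LowerSet (Finset (Fin n))} {a : Fin n →₀ ℕ} (r : k)
    (h : a.support ∉ Γ) : monomial a r ∈ mI k Γ := by
  classical
  intro b hb
  rw [coeff_monomial, if_neg]
  rintro rfl
  exact h hb

lemma srIdeal_eq (Δ : SC n) : srIdeal k Δ = mI k Δ.low := by
  classical
  apply le_antisymm
  · rw [srIdeal, Ideal.span_le]
    rintro m ⟨σ, hσ, rfl⟩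
    rw [prod_X_eq]
    apply monomial_mem_mI
    rw [SC.mem_low, ind_support]
    exact hσ
  · intro p hp
    rw [← p.support_sum_monomial_coeff]
    apply Ideal.sum_mem
    intro a ha
    have h1 : a.support ∉ Δ.faces := fun h => (mem_support_iff.mp ha) (hp a h)
    have h2 : monomial a (coeff a p) = monomial (a - ind a.support) (coeff a p)
        * ∏ i ∈ a.support, (X i : MvPolynomial (Fin n) k) := by
      rw [prod_X_eq, monomial_mul, mul_one, tsub_add_cancel_of_le]
      intro i
      simp only [ind_apply, Finsupp.mem_support_iff]
      split_ifs <;> omega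
    rw [h2]
    exact Ideal.mul_mem_left _ _ (Ideal.subset_span ⟨_, h1, rfl⟩)

open Classical in
/-- Coefficients on the quotient. -/
noncomputable def qc (Γ : LowerSet (Finset (Fin n))) (a : Fin n →₀ ℕ) : Qr k Γ →ₗ[k] k where
  toFun q := if a.support ∈ Γ then coeff a (Quotient.out q) else 0
  map_add' x y := by
    split_ifs with h
    · have : (Quotient.out (x + y) - Quotient.out x - Quotient.out y : MvPolynomial (Fin n) k)
          ∈ mI k Γ := by
        rw [← Ideal.Quotient.eq_zero_iff_mem, map_sub, map_sub]
        simp only [Ideal.Quotient.mk_out]; abel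
      have := this a h
      simp only [coeff_sub] at this
      linear_combination this
    · simp
  map_smul' r x := by
    split_ifs with h
    · have : (Quotient.out (r • x) - C r * Quotient.out x : MvPolynomial (Fin n) k)
          ∈ mI k Γ := by
        rw [← Ideal.Quotient.eq_zero_iff_mem, map_sub, map_mul]
        simp only [Ideal.Quotient.mk_out]
        rw [sub_eq_zero]
        obtain ⟨p, rfl⟩ := Ideal.Quotient.mk_surjective x
        rw [← map_mul, ← MvPolynomial.smul_eq_C_mul]; rfl
      have := this a h
      simp only [coeff_sub, coeff_C_mul] at this
      simp only [smul_eq_mul, RingHom.id_apply]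
      linear_combination this
    · simp

variable {k}
variable {Γ : LowerSet (Finset (Fin n))}

open Classical in
lemma qc_mk (a : Fin n →₀ ℕ) (p : MvPolynomial (Fin n) k) :
    qc k Γ a (Ideal.Quotient.mk _ p) = if a.support ∈ Γ then coeff a p else 0 := by
  change (if a.support ∈ Γ then coeff a (Quotient.out (Ideal.Quotient.mk (mI k Γ) p)) else 0) = _
  split_ifs with h
  · have : (Quotient.out (Ideal.Quotient.mk (mI k Γ) p) - p : MvPolynomial (Fin n) k)
          ∈ mI k Γ := by
        rw [← Ideal.Quotient.eq_zero_iff_mem, map_sub]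
        simp only [Ideal.Quotient.mk_out]; abel
    have := this a h
    simp only [coeff_sub] at this
    linear_combination this
  · rfl

lemma qc_of_not_mem {a : Fin n →₀ ℕ} (h : a.support ∉ Γ) (q : Qr k Γ) : qc k Γ a q = 0 := by
  obtain ⟨p, rfl⟩ := Ideal.Quotient.mk_surjective q
  rw [qc_mk, if_neg h]

lemma qc_ext {q q' : Qr k Γ} (h : ∀ a, a.support ∈ Γ → qc k Γ a q = qc k Γ a q') : q = q' := by
  obtain ⟨p, rfl⟩ := Ideal.Quotient.mk_surjective q
  obtain ⟨p', rfl⟩ := Ideal.Quotient.mk_surjective q'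
  rw [Ideal.Quotient.eq]
  intro a ha
  have := h a ha
  rw [qc_mk, qc_mk, if_pos ha, if_pos ha] at this
  rw [coeff_sub, this, sub_self]

/-- class of a monomial -/
noncomputable abbrev xm (Γ : LowerSet (Finset (Fin n))) (b : Fin n →₀ ℕ) : Qr k Γ :=
  Ideal.Quotient.mk (mI k Γ) (monomial b 1)

open Classical in
lemma qc_xm (a b : Fin n →₀ ℕ) : qc k Γ a (xm Γ b) = if a.support ∈ Γ ∧ b = a then 1 else 0 := by
  rw [qc_mk, coeff_monomial]
  split_ifs <;> simp_all

lemma xm_eq_zero {b : Fin n →₀ ℕ} (h : b.support ∉ Γ) : (xm Γ b : Qr k Γ) = 0 :=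
  Ideal.Quotient.eq_zero_iff_mem.mpr (monomial_mem_mI k 1 h)

lemma xm_mul (a b : Fin n →₀ ℕ) : (xm Γ a * xm Γ b : Qr k Γ) = xm Γ (a + b) := by
  rw [xm, xm, ← map_mul, monomial_mul, mul_one]

open Classical in
lemma qc_monomial_smul (b c : Fin n →₀ ℕ) (r : k) (q : Qr k Γ) :
    qc k Γ c ((monomial b r : MvPolynomial (Fin n) k) • q) =
      if b ≤ c ∧ c.support ∈ Γ then r * qc k Γ (c - b) q else 0 := by
  obtain ⟨p, rfl⟩ := Ideal.Quotient.mk_surjective q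
  have : (monomial b r : MvPolynomial (Fin n) k) • (Ideal.Quotient.mk (mI k Γ) p)
    = Ideal.Quotient.mk (mI k Γ) (monomial b r * p) := rfl
  rw [this, qc_mk, coeff_monomial_mul', qc_mk]
  by_cases h : c.support ∈ Γ
  · have : (c - b).support ∈ Γ := Γ.lower (by
      intro i; simp only [Finsupp.mem_support_iff, Finsupp.coe_tsub, Pi.sub_apply]; omega) h
    simp [h, this]
  · simp [h]

lemma qc_monomial_smul_add {b c : Fin n →₀ ℕ} (r : k) (q : Qr k Γ) (h : (c + b).support ∈ Γ) :
    qc k Γ (c + b) ((monomial b r : MvPolynomial (Fin n) k) • q) = r * qc k Γ c q := by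
  classical
  rw [qc_monomial_smul, if_pos ⟨le_add_self, h⟩, add_tsub_cancel_right]

lemma smul_eq_mk_mul (p : MvPolynomial (Fin n) k) (q : Qr k Γ) :
    p • q = Ideal.Quotient.mk _ p * q := by
  obtain ⟨p', rfl⟩ := Ideal.Quotient.mk_surjective q
  rw [← map_mul]; rfl

/-- projection -/
noncomputable def pr {Γ Γ' : LowerSet (Finset (Fin n))} (h : Γ' ≤ Γ) :
    Qr k Γ →ₗ[MvPolynomial (Fin n) k] Qr k Γ' :=
  (Ideal.Quotient.factorₐ (MvPolynomial (Fin n) k) (mI_anti k h)).toLinearMap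

@[simp] lemma pr_mk {Γ Γ' : LowerSet (Finset (Fin n))} (h : Γ' ≤ Γ) (p : MvPolynomial (Fin n) k) :
    pr h (Ideal.Quotient.mk _ p) = Ideal.Quotient.mk _ p := rfl

lemma pr_surj {Γ Γ' : LowerSet (Finset (Fin n))} (h : Γ' ≤ Γ) :
    Function.Surjective (pr (k := k) h) := by
  intro q
  obtain ⟨p, rfl⟩ := Ideal.Quotient.mk_surjective q
  exact ⟨Ideal.Quotient.mk _ p, rfl⟩

open Classical in
lemma qc_pr {Γ Γ' : LowerSet (Finset (Fin n))} (h : Γ' ≤ Γ) (a : Fin n →₀ ℕ) (q : Qr k Γ) :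
    qc k Γ' a (pr h q) = if a.support ∈ Γ' then qc k Γ a q else 0 := by
  obtain ⟨p, rfl⟩ := Ideal.Quotient.mk_surjective q
  rw [pr_mk, qc_mk, qc_mk]
  split_ifs with h1 h2 h2
  · rfl
  · exact absurd (h h1) h2
  · rfl

lemma pr_eq_zero_iff {Γ Γ' : LowerSet (Finset (Fin n))} (h : Γ' ≤ Γ) (q : Qr k Γ) :
    pr h q = 0 ↔ ∀ a, a.support ∈ Γ' → qc k Γ a q = 0 := by
  classical
  constructor
  · intro hq a ha
    have := qc_pr h a q
    rw [hq, if_pos ha, map_zero] at this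
    exact this.symm
  · intro hq
    apply qc_ext
    intro a ha
    rw [qc_pr, if_pos ha, hq a ha, map_zero]

/-- finite expansion -/
lemma Qr_expand (q : Qr k Γ) : ∃ s : Finset (Fin n →₀ ℕ), (∀ a ∈ s, a.support ∈ Γ) ∧
    q = ∑ a ∈ s, (C (qc k Γ a q) : MvPolynomial (Fin n) k) • xm Γ a ∧
      ∀ a, a ∉ s → qc k Γ a q = 0 := by
  classical
  obtain ⟨p, rfl⟩ := Ideal.Quotient.mk_surjective q
  refine ⟨p.support.filter (fun a => a.support ∈ Γ), by simp, ?_, ?_⟩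
  · apply qc_ext
    intro a ha
    rw [map_sum, qc_mk, if_pos ha]
    have : ∀ b ∈ p.support.filter (fun a => a.support ∈ Γ),
        qc k Γ a ((C (qc k Γ b (Ideal.Quotient.mk _ p)) : MvPolynomial (Fin n) k) • xm Γ b)
        = if b = a then coeff a p else 0 := by
      intro b hb
      rw [Finset.mem_filter] at hb
      rw [C_apply, qc_monomial_smul, if_pos ⟨zero_le, ha⟩, tsub_zero, qc_xm, qc_mk, if_pos hb.2]
      by_cases h : b = a
      · subst h; simp [ha]
      · simp [h]
    rw [Finset.sum_congr rfl this, Finset.sum_ite_eq']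
    simp only [Finset.mem_filter, mem_support_iff, ha, and_true]
    split_ifs with h <;> simp_all
  · intro a ha
    rw [qc_mk]
    split_ifs with h
    · simpa [h] using ha
    · rfl

end Mon

section Sign

variable (k : Type) [Field k] {n : ℕ}

/-- sign -/
def eps (v : Fin n) (τ : Finset (Fin n)) : k := (-1) ^ (τ.filter (fun w => w < v)).card

lemma eps_sq (v : Fin n) (τ : Finset (Fin n)) : eps k v τ * eps k v τ = 1 := by
  rw [eps, ← pow_add, ← two_mul, pow_mul]; simp

lemma eps_ne_zero (v : Fin n) (τ : Finset (Fin n)) : eps k v τ ≠ 0 := by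
  intro h; have := eps_sq k v τ; rw [h] at this; simp at this

lemma eps_insert_self (v : Fin n) (τ : Finset (Fin n)) : eps k v (insert v τ) = eps k v τ := by
  rw [eps, eps, Finset.filter_insert, if_neg (lt_irrefl v)]

lemma eps_erase_self (v : Fin n) (τ : Finset (Fin n)) : eps k v (τ.erase v) = eps k v τ := by
  by_cases h : v ∈ τ
  · conv_rhs => rw [← Finset.insert_erase h]
    rw [eps_insert_self]
  · rw [Finset.erase_eq_of_notMem h]

lemma eps_insert {v w : Fin n} {τ : Finset (Fin n)} (hw : w ∉ τ) :
    eps k v (insert w τ) = (if w < v then -1 else 1) * eps k v τ := by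
  rw [eps, eps, Finset.filter_insert]
  split_ifs with h
  · rw [Finset.card_insert_of_notMem (by simp [hw]), pow_succ]; ring
  · rw [one_mul]

lemma eps_comm {v w : Fin n} (hvw : v ≠ w) {τ : Finset (Fin n)} (hv : v ∉ τ) (hw : w ∉ τ) :
    eps k v (insert w τ) * eps k w τ = - (eps k w (insert v τ) * eps k v τ) := by
  rw [eps_insert k hw, eps_insert k hv]
  rcases lt_or_gt_of_ne hvw with h | h
  · rw [if_neg (not_lt.mpr h.le), if_pos h]; ring
  · rw [if_pos h, if_neg (not_lt.mpr h.le)]; ring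

end Sign

end PieceP1

section PieceP2

open CategoryTheory Abelian

section ExtComparison

variable {R : Type} [CommRing R] {X Y : ModuleCat.{0} R}

lemma extMk_zero_eq_zero_iff (P : ProjectiveResolution X) (f : P.complex.X 0 ⟶ Y) (m : ℕ)
    (hm : 0 + 1 = m) (hf : P.complex.d m 0 ≫ f = 0) :
    P.extMk f m hm hf = 0 ↔ f = 0 := by
  simp only [← P.extEquivCohomologyClass.apply_eq_iff_eq,
    ProjectiveResolution.extEquivCohomologyClass_extMk,
    ProjectiveResolution.extEquivCohomologyClass_zero,
    CochainComplex.HomComplex.CohomologyClass.mk_eq_zero_iff]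
  rw [CochainComplex.HomComplex.Cocycle.toSingleMk_mem_coboundaries_iff _ _ _ _ _ 1 (by lia)]
  have hz : P.cochainComplex.d (-((0:ℕ):ℤ)) 1 = 0 := by
    apply Limits.IsZero.eq_of_tgt
    exact P.cochainComplex.isZero_of_isStrictlyLE 0 1
  rw [hz]
  constructor
  · rintro ⟨g, hg⟩
    rw [← cancel_epi (P.cochainComplexXIso (-((0:ℕ):ℤ)) 0 rfl).hom]
    simpa using hg.symm
  · rintro rfl
    exact ⟨0, by simp⟩

noncomputable def cocycMap (P : ProjectiveResolution X) (Y : ModuleCat.{0} R) (i : ℕ) :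
    LinearMap.ker (((P.complex.linearYonedaObj R Y).d i (i+1)).hom) →ₗ[R] Abelian.Ext X Y i where
  toFun z := P.extMk (show P.complex.X i ⟶ Y from z.1) (i+1) rfl z.2
  map_add' a b := by
    exact (P.add_extMk (n := i) (Y := Y) a.1 b.1 (i+1) rfl a.2 b.2).symm
  map_smul' r a := by
    refine Eq.symm ((Abelian.Ext.smul_eq_comp_mk₀ _ _).trans
      ((P.extMk_comp_mk₀ (n := i) (Y := Y) a.1 (i+1) rfl a.2 (r • 𝟙 Y)).trans ?_))
    have : ∀ (f g : P.complex.X i ⟶ Y) (hf) (hg), f = g →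
        P.extMk f (i+1) rfl hf = P.extMk g (i+1) rfl hg := by
      rintro f g hf hg rfl; rfl
    apply this
    erw [Linear.comp_smul, Category.comp_id]
    rfl

lemma cocycMap_surj (P : ProjectiveResolution X) (Y : ModuleCat.{0} R) (i : ℕ) :
    Function.Surjective (cocycMap P Y i) := by
  intro a
  obtain ⟨f, hf, h⟩ := P.extMk_surjective a (i+1) rfl
  exact ⟨⟨f, hf⟩, h⟩

noncomputable def extModEquiv (X Y : ModuleCat.{0} R) (i : ℕ) :
    (((Ext R (ModuleCat R) i).obj (Opposite.op X)).obj Y) ≃ₗ[R] Abelian.Ext X Y i := by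
  let P := projectiveResolution X
  let K := P.complex.linearYonedaObj R Y
  refine (P.isoExt i Y).toLinearEquiv ≪≫ₗ ?_
  match i with
  | 0 =>
    let e : K.homology 0 ≅ (K.sc' 0 0 1).homology :=
      ShortComplex.homologyMapIso (K.isoSc' 0 0 1 (by simp) (by simp))
    refine (e ≪≫ (K.sc' 0 0 1).moduleCatHomologyIso).toLinearEquiv ≪≫ₗ ?_
    refine Submodule.quotEquivOfEq _ (LinearMap.ker (cocycMap P Y 0)) ?_ ≪≫ₗ
      LinearMap.quotKerEquivOfSurjective _ (cocycMap_surj P Y 0)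
    ext z
    refine Iff.trans ?_ (extMk_zero_eq_zero_iff P (Y := Y) z.1 1 rfl z.2).symm
    have : K.d 0 0 = 0 := K.shape _ _ (by simp)
    constructor
    · rintro ⟨y, rfl⟩
      change (K.d 0 0).hom y = 0
      rw [this]; rfl
    · intro h
      refine ⟨0, ?_⟩
      rw [map_zero]
      exact Subtype.ext h.symm
  | p+1 =>
    let e : K.homology (p+1) ≅ (K.sc' p (p+1) (p+2)).homology :=
      ShortComplex.homologyMapIso (K.isoSc' p (p+1) (p+2) (by simp) (by simp))
    refine (e ≪≫ (K.sc' p (p+1) (p+2)).moduleCatHomologyIso).toLinearEquiv ≪≫ₗ ?_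
    refine Submodule.quotEquivOfEq _ (LinearMap.ker (cocycMap P Y (p+1))) ?_ ≪≫ₗ
      LinearMap.quotKerEquivOfSurjective _ (cocycMap_surj P Y (p+1))
    ext z
    refine Iff.trans ?_ (P.extMk_eq_zero_iff (n := p+1) (Y := Y) z.1 _ rfl z.2 p rfl).symm
    constructor
    · rintro ⟨y, rfl⟩
      exact ⟨y, rfl⟩
    · rintro ⟨y, h⟩
      exact ⟨y, Subtype.ext h⟩

end ExtComparison

end PieceP2

section PieceP3a

open CategoryTheory Abelian

section ExtAPI

variable {R : Type} [CommRing R]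
variable {M M' M'' Z A B C A' B' C' : Type} [AddCommGroup M] [Module R M] [AddCommGroup M'] [Module R M']
  [AddCommGroup M''] [Module R M'']
  [AddCommGroup Z] [Module R Z] [AddCommGroup A] [Module R A] [AddCommGroup B] [Module R B]
  [AddCommGroup C] [Module R C] [AddCommGroup A'] [Module R A'] [AddCommGroup B'] [Module R B']
  [AddCommGroup C'] [Module R C']

variable (R) in
/-- Ext of unbundled modules -/
abbrev EX (M N : Type) [AddCommGroup M] [Module R M] [AddCommGroup N] [Module R N] (i : ℕ) : Type :=
  Abelian.Ext (ModuleCat.of R M) (ModuleCat.of R N) i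

/-- contravariant functoriality -/
noncomputable def pull (f : M →ₗ[R] M') (Z : Type) [AddCommGroup Z] [Module R Z] (i : ℕ) :
    EX R M' Z i →ₗ[R] EX R M Z i where
  toFun α := (Abelian.Ext.mk₀ (ModuleCat.ofHom f)).comp α (zero_add i)
  map_add' a b := by simp
  map_smul' r a := by simp

lemma pull_id (i : ℕ) (α : EX R M Z i) : pull (LinearMap.id : M →ₗ[R] M) Z i α = α :=
  Abelian.Ext.mk₀_id_comp α

lemma pull_pull (f : M →ₗ[R] M') (g : M' →ₗ[R] M'') (i : ℕ) (α : EX R M'' Z i) :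
    pull f Z i (pull g Z i α) = pull (g ∘ₗ f) Z i α :=
  Abelian.Ext.mk₀_comp_mk₀_assoc _ _ _

lemma pull_zero (i : ℕ) (α : EX R M' Z i) : pull (0 : M →ₗ[R] M') Z i α = 0 := by
  change (Abelian.Ext.mk₀ (0 : ModuleCat.of R M ⟶ ModuleCat.of R M')).comp α (zero_add i) = 0
  simp

lemma pull_add (f g : M →ₗ[R] M') (i : ℕ) (α : EX R M' Z i) :
    pull (f + g) Z i α = pull f Z i α + pull g Z i α := by
  change (Abelian.Ext.mk₀ (ModuleCat.ofHom f + ModuleCat.ofHom g)).comp α (zero_add i) = _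
  rw [Abelian.Ext.mk₀_add, Abelian.Ext.add_comp]; rfl

lemma pull_sum {ι : Type} (s : Finset ι) (f : ι → (M →ₗ[R] M')) (i : ℕ) (α : EX R M' Z i) :
    pull (∑ j ∈ s, f j) Z i α = ∑ j ∈ s, pull (f j) Z i α := by
  classical
  induction s using Finset.induction_on with
  | empty => simp [pull_zero]
  | insert a s ha ih => rw [Finset.sum_insert ha, pull_add, ih, Finset.sum_insert ha]

lemma pull_smul (r : R) (f : M →ₗ[R] M') (i : ℕ) (α : EX R M' Z i) :
    pull (r • f) Z i α = r • pull f Z i α := by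
  change (Abelian.Ext.mk₀ (r • ModuleCat.ofHom f)).comp α (zero_add i) = _
  rw [Abelian.Ext.mk₀_smul, Abelian.Ext.smul_comp]; rfl

/-- short exact sequence data -/
structure SES (f : A →ₗ[R] B) (g : B →ₗ[R] C) : Prop where
  inj : Function.Injective f
  exact : Function.Exact f g
  surj : Function.Surjective g

lemma SES.zero {f : A →ₗ[R] B} {g : B →ₗ[R] C} (h : SES f g) : g ∘ₗ f = 0 := by
  ext x; exact h.exact.apply_apply_eq_zero x

/-- the short complex -/
abbrev SES.sc {f : A →ₗ[R] B} {g : B →ₗ[R] C} (h : SES f g) : ShortComplex (ModuleCat.{0} R) :=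
  ShortComplex.mk (ModuleCat.ofHom f) (ModuleCat.ofHom g) (by
    rw [← ModuleCat.ofHom_comp, h.zero]; rfl)

lemma SES.shortExact {f : A →ₗ[R] B} {g : B →ₗ[R] C} (h : SES f g) : h.sc.ShortExact :=
  ModuleCat.shortComplex_shortExact _ h.exact h.inj h.surj

/-- connecting map -/
noncomputable def SES.del {f : A →ₗ[R] B} {g : B →ₗ[R] C} (h : SES f g)
    (Z : Type) [AddCommGroup Z] [Module R Z] (i : ℕ) :
    EX R A Z i →ₗ[R] EX R C Z (i+1) where
  toFun α := Abelian.Ext.comp (X := ModuleCat.of R C) (Y := ModuleCat.of R A)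
    h.shortExact.extClass α (add_comm 1 i)
  map_add' a b := by simp
  map_smul' r a := by simp

variable {f : A →ₗ[R] B} {g : B →ₗ[R] C} (h : SES f g)
variable {f' : A' →ₗ[R] B'} {g' : B' →ₗ[R] C'} (h' : SES f' g')

lemma SES.del_pull (i : ℕ) (β : EX R B Z i) : h.del Z i (pull f Z i β) = 0 :=
  h.shortExact.extClass_comp_assoc β (h := add_comm 1 i)

lemma SES.pull_del (i : ℕ) (α : EX R A Z i) : pull g Z (i+1) (h.del Z i α) = 0 :=
  h.shortExact.comp_extClass_assoc α (add_comm 1 i)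

lemma SES.les1 (i : ℕ) (α : EX R A Z i) (hα : h.del Z i α = 0) : ∃ β, pull f Z i β = α :=
  Abelian.Ext.contravariant_sequence_exact₁ h.shortExact _ α (add_comm 1 i) hα

include h in
lemma SES.les2 (i : ℕ) (β : EX R B Z i) (hβ : pull f Z i β = 0) : ∃ γ, pull g Z i γ = β :=
  Abelian.Ext.contravariant_sequence_exact₂ h.shortExact _ β hβ

lemma SES.les3 (i : ℕ) (γ : EX R C Z (i+1)) (hγ : pull g Z (i+1) γ = 0) : ∃ α, h.del Z i α = γ :=
  Abelian.Ext.contravariant_sequence_exact₃ h.shortExact _ γ hγ (add_comm 1 i)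

include h in
lemma SES.les0 (γ : EX R C Z 0) (hγ : pull g Z 0 γ = 0) : γ = 0 := by
  have : Epi (ModuleCat.ofHom g) := (ModuleCat.epi_iff_surjective _).mpr h.surj
  have := Abelian.Ext.precomp_mk₀_injective_of_epi (ModuleCat.of R Z) (ModuleCat.ofHom g)
  apply this
  rw [map_zero]
  exact hγ

lemma SES.natural (a : A →ₗ[R] A') (b : B →ₗ[R] B') (c : C →ₗ[R] C')
    (h1 : f' ∘ₗ a = b ∘ₗ f) (h2 : g' ∘ₗ b = c ∘ₗ g) (i : ℕ) (α : EX R A' Z i) :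
    pull c Z (i+1) (h'.del Z i α) = h.del Z i (pull a Z i α) := by
  let φ : h.sc ⟶ h'.sc :=
    { τ₁ := ModuleCat.ofHom a
      τ₂ := ModuleCat.ofHom b
      τ₃ := ModuleCat.ofHom c
      comm₁₂ := by
        change ModuleCat.ofHom a ≫ ModuleCat.ofHom f' = ModuleCat.ofHom f ≫ ModuleCat.ofHom b
        rw [← ModuleCat.ofHom_comp, ← ModuleCat.ofHom_comp, h1]
      comm₂₃ := by
        change ModuleCat.ofHom b ≫ ModuleCat.ofHom g' = ModuleCat.ofHom g ≫ ModuleCat.ofHom c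
        rw [← ModuleCat.ofHom_comp, ← ModuleCat.ofHom_comp, h2] }
  have := ShortComplex.ShortExact.extClass_naturality h.shortExact h'.shortExact φ
  change (Abelian.Ext.mk₀ φ.τ₃).comp (h'.shortExact.extClass.comp α (add_comm 1 i)) (zero_add _) =
    h.shortExact.extClass.comp ((Abelian.Ext.mk₀ φ.τ₁).comp α (zero_add i)) (add_comm 1 i)
  rw [← Abelian.Ext.comp_assoc (a₁₂ := 1) _ _ _ (by lia) (by lia) (by lia), ← this]
  exact Abelian.Ext.comp_assoc_of_second_deg_zero _ _ _ _

/-- covariant vanishing -/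
lemma SES.cov_vanish (h : SES f g) (i : ℕ) (hB : Subsingleton (EX R M B i))
    (hA : Subsingleton (EX R M A (i+1))) : Subsingleton (EX R M C i) := by
  refine subsingleton_of_forall_eq 0 fun x => ?_
  obtain ⟨y, hy⟩ := Abelian.Ext.covariant_sequence_exact₃ (X := ModuleCat.of R M) h.shortExact x rfl
    (Subsingleton.elim (α := EX R M A (i+1)) _ _)
  rw [← hy, Subsingleton.elim (α := EX R M B i) y 0]
  simp

lemma EX_pi_subsingleton {ι : Type} [Fintype ι] (i : ℕ) (hA : Subsingleton (EX R M A i)) :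
    Subsingleton (EX R M (ι → A) i) := by
  classical
  refine subsingleton_of_forall_eq 0 fun x => ?_
  have key : (𝟙 (ModuleCat.of R (ι → A))) = ∑ j, ModuleCat.ofHom (LinearMap.proj (R := R) (φ := fun _ : ι => A) j) ≫
      ModuleCat.ofHom (LinearMap.single R (fun _ : ι => A) j) := by
    ext x
    simp only [ModuleCat.hom_id, LinearMap.id_coe, id_eq, ModuleCat.hom_sum, LinearMap.sum_apply]
    simp
  rw [← Abelian.Ext.comp_mk₀_id x, key, Abelian.Ext.mk₀_sum, Abelian.Ext.comp_sum]
  apply Finset.sum_eq_zero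
  intro j _
  rw [← Abelian.Ext.mk₀_comp_mk₀, ← Abelian.Ext.comp_assoc_of_third_deg_zero]
  have : x.comp (Abelian.Ext.mk₀ (ModuleCat.ofHom (LinearMap.proj (R := R) (φ := fun _ : ι => A) j)))
    (add_zero i) = 0 := Subsingleton.elim (α := EX R M A i) _ _
  rw [this]; simp

lemma EX_zero_subsingleton (h : Subsingleton (EX R M A 0)) (f : M →ₗ[R] A) : f = 0 := by
  have h1 : (Abelian.Ext.mk₀ (ModuleCat.ofHom f)) = Abelian.Ext.mk₀ (ModuleCat.ofHom (0 : M →ₗ[R] A)) :=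
    Subsingleton.elim (α := EX R M A 0) _ _
  have := (Abelian.Ext.mk₀_bijective _ _).1 h1
  exact congrArg ModuleCat.Hom.hom this

lemma EX_proj_subsingleton [Module.Projective R M] (i : ℕ) : Subsingleton (EX R M A (i+1)) := by
  have : Projective (ModuleCat.of R M) := inferInstance
  exact Abelian.Ext.subsingleton_of_projective _ _ _

/-- degree zero -/
noncomputable def EX_zero_equiv : EX R M Z 0 ≃ₗ[R] (M →ₗ[R] Z) :=
  (Abelian.Ext.linearEquiv₀ (R := R)) ≪≫ₗ (ModuleCat.homLinearEquiv (S := R))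

end ExtAPI

end PieceP3a

section PieceP3b

open MvPolynomial

section TF

variable {k : Type} [Field k] {n : ℕ}

lemma mem_of_monomials {Γ : LowerSet (Finset (Fin n))}
    (N : Submodule (MvPolynomial (Fin n) k) (Qr k Γ)) (q : Qr k Γ)
    (h : ∀ a : Fin n →₀ ℕ, a.support ∈ Γ → qc k Γ a q ≠ 0 → xm Γ a ∈ N) : q ∈ N := by
  obtain ⟨s, hs, hq, _⟩ := Qr_expand q
  rw [hq]
  refine N.sum_mem fun a ha => ?_
  by_cases h0 : qc k Γ a q = 0
  · rw [h0, map_zero, zero_smul]; exact N.zero_mem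
  · exact N.smul_mem _ (h a (hs a ha) h0)

/-- multiplication by a squarefree monomial between quotients -/
noncomputable def mulm {Γ Γ' : LowerSet (Finset (Fin n))} (σ : Finset (Fin n))
    (h : ∀ τ ∈ Γ', σ ⊆ τ → τ ∈ Γ) : Qr k Γ →ₗ[MvPolynomial (Fin n) k] Qr k Γ' :=
  Submodule.liftQ (mI k Γ)
    ((monomial (ind σ) 1 : MvPolynomial (Fin n) k) • (Algebra.linearMap (MvPolynomial (Fin n) k) (Qr k Γ')))
    (by
      classical
      intro p hp
      rw [LinearMap.mem_ker, LinearMap.smul_apply]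
      apply qc_ext
      intro a ha
      rw [map_zero, qc_monomial_smul]
      split_ifs with h1
      · rw [one_mul, Algebra.linearMap_apply]
        change qc k Γ' _ (Ideal.Quotient.mk _ p) = 0
        rw [qc_mk]
        split_ifs with h2
        · apply hp
          have : σ ⊆ a.support := by
            intro i hi
            have := h1.1 i
            simp only [ind_apply, hi, if_true] at this
            simp only [Finsupp.mem_support_iff]; omega
          refine Γ.lower ?_ (h _ ha this)
          intro i; simp only [Finsupp.mem_support_iff, Finsupp.coe_tsub, Pi.sub_apply]; omega
        · rfl
      · rfl)

lemma mulm_mk {Γ Γ' : LowerSet (Finset (Fin n))} (σ : Finset (Fin n))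
    (h : ∀ τ ∈ Γ', σ ⊆ τ → τ ∈ Γ) (p : MvPolynomial (Fin n) k) :
    mulm σ h (Ideal.Quotient.mk (mI k Γ) p) =
      (monomial (ind σ) 1 : MvPolynomial (Fin n) k) • (Ideal.Quotient.mk (mI k Γ') p) := rfl

lemma Qr_hom_ext {Γ : LowerSet (Finset (Fin n))} {M : Type} [AddCommGroup M]
    [Module (MvPolynomial (Fin n) k) M] {f g : Qr k Γ →ₗ[MvPolynomial (Fin n) k] M}
    (h : f 1 = g 1) : f = g := by
  refine LinearMap.ext fun q => ?_
  obtain ⟨p, rfl⟩ := Ideal.Quotient.mk_surjective q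
  have : (Ideal.Quotient.mk (mI k Γ) p) = p • (1 : Qr k Γ) := by
    rw [smul_eq_mk_mul, mul_one]
  rw [this, map_smul, map_smul, h]

lemma mulm_one {Γ Γ' : LowerSet (Finset (Fin n))} (σ : Finset (Fin n))
    (h : ∀ τ ∈ Γ', σ ⊆ τ → τ ∈ Γ) : mulm σ h (1 : Qr k Γ) = xm Γ' (ind σ) := by
  change (monomial (ind σ) 1 : MvPolynomial (Fin n) k) • (1 : Qr k Γ') = _
  rw [smul_eq_mk_mul, mul_one]

lemma pr_one {Γ Γ' : LowerSet (Finset (Fin n))} (h : Γ' ≤ Γ) : pr h (1 : Qr k Γ) = 1 := rfl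

lemma pr_xm {Γ Γ' : LowerSet (Finset (Fin n))} (h : Γ' ≤ Γ) (b : Fin n →₀ ℕ) :
    pr (k := k) h (xm Γ b) = xm Γ' b := rfl

lemma mulm_xm {Γ Γ' : LowerSet (Finset (Fin n))} (σ : Finset (Fin n))
    (h : ∀ τ ∈ Γ', σ ⊆ τ → τ ∈ Γ) (b : Fin n →₀ ℕ) : mulm σ h (xm Γ b : Qr k Γ) = xm Γ' (ind σ + b) := by
  rw [xm, mulm_mk, smul_eq_mk_mul, ← map_mul, monomial_mul, mul_one]

lemma qc_mulm {Γ Γ' : LowerSet (Finset (Fin n))} (σ : Finset (Fin n))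
    (h : ∀ τ ∈ Γ', σ ⊆ τ → τ ∈ Γ) (c : Fin n →₀ ℕ) (hc : (c + ind σ).support ∈ Γ') (q : Qr k Γ) :
    qc k Γ' (c + ind σ) (mulm σ h q) = qc k Γ c q := by
  classical
  obtain ⟨p, rfl⟩ := Ideal.Quotient.mk_surjective q
  have h1 : c.support ⊆ (c + ind σ).support := by
    intro i; simp only [Finsupp.mem_support_iff, Finsupp.add_apply]; omega
  have h2 : σ ⊆ (c + ind σ).support := by
    intro i hi; simp [hi]
  have h3 : c.support ∈ Γ' := Γ'.lower h1 hc
  have h4 : c.support ∈ Γ := Γ.lower h1 (h _ hc h2)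
  rw [mulm_mk, qc_monomial_smul_add _ _ hc, one_mul, qc_mk, qc_mk, if_pos h3, if_pos h4]

lemma qc_mulm_zero {Γ Γ' : LowerSet (Finset (Fin n))} (σ : Finset (Fin n))
    (h : ∀ τ ∈ Γ', σ ⊆ τ → τ ∈ Γ) (c : Fin n →₀ ℕ) (hc : ¬ σ ⊆ c.support) (q : Qr k Γ) :
    qc k Γ' c (mulm σ h q) = 0 := by
  classical
  obtain ⟨p, rfl⟩ := Ideal.Quotient.mk_surjective q
  rw [mulm_mk, qc_monomial_smul, if_neg]
  rintro ⟨h1, _⟩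
  apply hc
  intro i hi
  have := h1 i
  simp only [ind_apply, hi, if_true] at this
  simp only [Finsupp.mem_support_iff]; omega

variable (k) in
/-- polynomial ring on `F` as a quotient -/
abbrev TT (F : Finset (Fin n)) : Type := Qr k (LowerSet.Iic F)

lemma sub_ind_support {σ : Finset (Fin n)} {a : Fin n →₀ ℕ} : (a - ind σ).support ⊆ a.support := by
  intro i; simp only [Finsupp.mem_support_iff, Finsupp.coe_tsub, Pi.sub_apply]; omega

lemma ind_add_sub {σ : Finset (Fin n)} {a : Fin n →₀ ℕ} (h : σ ⊆ a.support) :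
    ind σ + (a - ind σ) = a := by
  apply add_tsub_cancel_of_le
  intro i
  simp only [ind_apply]
  split_ifs with hi
  · have := h hi; simp only [Finsupp.mem_support_iff] at this; omega
  · omega

/-- the sequence for `x_v` -/
lemma sesX {F G : Finset (Fin n)} {v : Fin n} (hv : v ∈ F) (hG : G = F.erase v) :
    SES (R := MvPolynomial (Fin n) k) (mulm {v} (fun τ hτ _ => hτ) : TT k F →ₗ[_] TT k F)
      (pr (k := k) (LowerSet.Iic_le.mpr (by subst hG; exact Finset.erase_subset _ _) :
        LowerSet.Iic G ≤ LowerSet.Iic F)) where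
  inj := by
    rw [injective_iff_map_eq_zero]
    intro q hq
    apply qc_ext
    intro a ha
    have hs : (a + ind {v}).support ∈ LowerSet.Iic F := by
      rw [LowerSet.mem_Iic_iff] at ha ⊢
      intro i hi
      by_cases h : i = v
      · subst h; exact hv
      · apply ha; simpa [h] using hi
    rw [← qc_mulm {v} (fun τ hτ _ => hτ) a hs, hq, map_zero, map_zero]
  exact := by
    intro q
    constructor
    · intro hq
      rw [pr_eq_zero_iff] at hq
      apply mem_of_monomials (LinearMap.range (mulm {v} (fun τ hτ _ => hτ) : TT k F →ₗ[_] TT k F)) q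
      intro a ha h0
      have : v ∈ a.support := by
        by_contra hva
        apply h0
        apply hq
        rw [LowerSet.mem_Iic_iff] at ha ⊢
        subst hG
        intro i hi
        exact Finset.mem_erase.mpr ⟨fun h => hva (h ▸ hi), ha hi⟩
      refine ⟨xm _ (a - ind {v}), ?_⟩
      rw [mulm_xm, ind_add_sub (by simpa using this)]
    · rintro ⟨q, rfl⟩
      rw [pr_eq_zero_iff]
      intro a ha
      apply qc_mulm_zero
      rw [LowerSet.mem_Iic_iff] at ha
      intro h
      have := ha (h (Finset.mem_singleton_self v))
      subst hG
      simp at this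
  surj := pr_surj _

lemma Iio_le_Iic (F : Finset (Fin n)) : LowerSet.Iio F ≤ LowerSet.Iic F :=
  fun _ hσ => (LowerSet.mem_Iio_iff.mp hσ).le

/-- the sequence for the boundary of a simplex -/
lemma sesBd (F : Finset (Fin n)) :
    SES (R := MvPolynomial (Fin n) k) (mulm F (fun τ hτ _ => hτ) : TT k F →ₗ[_] TT k F)
      (pr (k := k) (Iio_le_Iic F)) where
  inj := by
    rw [injective_iff_map_eq_zero]
    intro q hq
    apply qc_ext
    intro a ha
    have hs : (a + ind F).support ∈ LowerSet.Iic F := by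
      rw [LowerSet.mem_Iic_iff] at ha ⊢
      intro i hi
      by_contra h
      exact h (ha (by simpa [h] using hi))
    rw [← qc_mulm F (fun τ hτ _ => hτ) a hs, hq, map_zero, map_zero]
  exact := by
    intro q
    constructor
    · intro hq
      rw [pr_eq_zero_iff] at hq
      apply mem_of_monomials (LinearMap.range (mulm F (fun τ hτ _ => hτ) : TT k F →ₗ[_] TT k F)) q
      intro a ha h0
      have : F ⊆ a.support := by
        by_contra hva
        apply h0
        apply hq
        rw [LowerSet.mem_Iic_iff] at ha
        rw [LowerSet.mem_Iio_iff]
        exact ⟨ha, hva⟩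
      refine ⟨xm _ (a - ind F), ?_⟩
      rw [mulm_xm, ind_add_sub this]
    · rintro ⟨q, rfl⟩
      rw [pr_eq_zero_iff]
      intro a ha
      apply qc_mulm_zero
      rw [LowerSet.mem_Iio_iff] at ha
      exact ha.2
  surj := pr_surj _

/-- section ring hom -/
lemma TT_unit {G : Finset (Fin n)} {u : TT k G} (hu : IsUnit u) :
    ∃ c : k, c ≠ 0 ∧ u = Ideal.Quotient.mk _ (C c) := by
  classical
  let φ : MvPolynomial (Fin n) k →ₐ[k] MvPolynomial (Fin n) k :=
    aeval (fun i => if i ∈ G then X i else 0)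
  have hφ : ∀ p ∈ mI k (LowerSet.Iic G), φ p = 0 := by
    intro p hp
    rw [← p.support_sum_monomial_coeff, map_sum]
    apply Finset.sum_eq_zero
    intro a ha
    have h1 : ¬ a.support ⊆ G := fun h => (mem_support_iff.mp ha) (hp a h)
    obtain ⟨i, hi, hiG⟩ := Finset.not_subset.mp h1
    rw [aeval_monomial]
    have : (a.prod fun i m => (if i ∈ G then X i else 0 : MvPolynomial (Fin n) k) ^ m) = 0 := by
      rw [Finsupp.prod]
      apply Finset.prod_eq_zero hi
      rw [if_neg hiG, zero_pow (Finsupp.mem_support_iff.mp hi)]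
    rw [this, mul_zero]
  let s : TT k G →+* MvPolynomial (Fin n) k := Ideal.Quotient.lift _ φ.toRingHom hφ
  have hs : ∀ q, Ideal.Quotient.mk _ (s q) = q := by
    intro q
    obtain ⟨p, rfl⟩ := Ideal.Quotient.mk_surjective q
    change Ideal.Quotient.mk _ (φ p) = _
    have : (Ideal.Quotient.mkₐ k (mI k (LowerSet.Iic G))).comp φ = Ideal.Quotient.mkₐ k _ := by
      apply MvPolynomial.algHom_ext
      intro i
      simp only [AlgHom.comp_apply, φ, aeval_X]
      split_ifs with h
      · rfl
      · rw [map_zero]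
        symm
        rw [Ideal.Quotient.mkₐ_eq_mk, Ideal.Quotient.eq_zero_iff_mem]
        apply monomial_mem_mI
        rw [LowerSet.mem_Iic_iff, Finsupp.support_single_ne_zero _ one_ne_zero]
        simpa using h
    exact DFunLike.congr_fun this p
  have h1 : IsUnit (s u) := hu.map s
  obtain ⟨c, hc, h2⟩ := MvPolynomial.isUnit_iff_eq_C_of_isReduced.mp h1
  refine ⟨c, hc.ne_zero, ?_⟩
  rw [← hs u, h2]

lemma TT_surj {F G : Finset (Fin n)} (hGF : LowerSet.Iic G ≤ LowerSet.Iic F)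
    (φ : TT k F →ₗ[MvPolynomial (Fin n) k] TT k G) (hφ : Function.Surjective φ) :
    ∃ c : k, c ≠ 0 ∧ ∀ q, φ q = (C c : MvPolynomial (Fin n) k) • pr hGF q := by
  have hu : IsUnit (φ 1) := by
    obtain ⟨q, hq⟩ := hφ 1
    obtain ⟨p, rfl⟩ := Ideal.Quotient.mk_surjective q
    rw [← mul_one (Ideal.Quotient.mk _ p), ← smul_eq_mk_mul, map_smul, smul_eq_mk_mul] at hq
    exact IsUnit.of_mul_eq_one _ (by rw [mul_comm]; exact hq)
  obtain ⟨c, hc, h⟩ := TT_unit hu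
  refine ⟨c, hc, fun q => ?_⟩
  have : φ = (C c : MvPolynomial (Fin n) k) • pr hGF := by
    apply Qr_hom_ext
    rw [h, LinearMap.smul_apply, pr_one, smul_eq_mk_mul, mul_one]
  rw [this]; rfl

end TF

end PieceP3b

section PieceP3c

open MvPolynomial

section TA

variable {k : Type} [Field k] {n : ℕ}

lemma mI_Iic_univ : mI k (LowerSet.Iic (Finset.univ : Finset (Fin n))) = ⊥ := by
  rw [eq_bot_iff]
  intro p hp
  rw [Ideal.mem_bot]
  ext a
  rw [coeff_zero]
  exact hp a (Finset.subset_univ _)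

/-- the full polynomial ring -/
noncomputable def TT_univ : TT k (Finset.univ : Finset (Fin n)) ≃ₗ[MvPolynomial (Fin n) k]
    MvPolynomial (Fin n) k :=
  Submodule.quotEquivOfEqBot _ mI_Iic_univ

lemma erase_Iic {F G : Finset (Fin n)} {v : Fin n} (hG : G = F.erase v) :
    LowerSet.Iic G ≤ LowerSet.Iic F :=
  LowerSet.Iic_le.mpr (by subst hG; exact Finset.erase_subset _ _)

lemma mulm_self (Γ : LowerSet (Finset (Fin n))) (v : Fin n) :
    (mulm {v} (fun _ hτ _ => hτ) : Qr k Γ →ₗ[MvPolynomial (Fin n) k] Qr k Γ) =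
      (X v : MvPolynomial (Fin n) k) • LinearMap.id := by
  apply Qr_hom_ext
  rw [mulm_one, LinearMap.smul_apply, LinearMap.id_apply, smul_eq_mk_mul, mul_one, ind_singleton]
  rfl

lemma TT_tf {F : Finset (Fin n)} {v : Fin n} (hv : v ∈ F) (q : TT k F)
    (h : (X v : MvPolynomial (Fin n) k) • q = 0) : q = 0 := by
  apply (sesX (k := k) hv rfl).inj
  rw [mulm_self, map_zero]; exact h

theorem lemmaA (m : ℕ) : ∀ F : Finset (Fin n), F.card + m = n →
    (∀ i, i ≠ m → Subsingleton (EX (MvPolynomial (Fin n) k) (TT k F) (MvPolynomial (Fin n) k) i)) ∧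
    Nonempty (EX (MvPolynomial (Fin n) k) (TT k F) (MvPolynomial (Fin n) k) m
      ≃ₗ[MvPolynomial (Fin n) k] TT k F) := by
  induction m with
  | zero =>
    intro F hF
    obtain rfl : F = Finset.univ := by
      rw [← Finset.card_eq_iff_eq_univ]; simpa using hF
    have : Module.Projective (MvPolynomial (Fin n) k) (TT k (Finset.univ : Finset (Fin n))) :=
      Module.Projective.of_equiv TT_univ.symm
    refine ⟨?_, ?_⟩
    · intro i hi
      obtain ⟨j, rfl⟩ := Nat.exists_eq_succ_of_ne_zero hi
      exact EX_proj_subsingleton j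
    · exact ⟨EX_zero_equiv ≪≫ₗ (LinearEquiv.congrLeft _ _ TT_univ) ≪≫ₗ
        (LinearMap.ringLmapEquivSelf _ _ _) ≪≫ₗ TT_univ.symm⟩
  | succ m ih =>
    intro F hF
    have : ∃ v, v ∉ F := by
      by_contra h
      push Not at h
      have : F = Finset.univ := Finset.eq_univ_of_forall h
      rw [this, Finset.card_univ, Fintype.card_fin] at hF
      omega
    obtain ⟨v, hv⟩ := this
    have hvF : v ∈ insert v F := Finset.mem_insert_self _ _
    have hG : F = (insert v F).erase v := by rw [Finset.erase_insert hv]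
    obtain ⟨ih1, ⟨e⟩⟩ := ih (insert v F) (by rw [Finset.card_insert_of_notMem hv]; omega)
    have ses := sesX (k := k) hvF hG
    have hx : ∀ i (β : EX (MvPolynomial (Fin n) k) (TT k (insert v F)) (MvPolynomial (Fin n) k) i),
        (X v : MvPolynomial (Fin n) k) • β = 0 → β = 0 := by
      intro i β hβ
      by_cases hi : i = m
      · subst hi
        have := congrArg e hβ
        rw [map_smul, map_zero] at this
        have := TT_tf hvF _ this
        exact e.map_eq_zero_iff.mp this
      · have := ih1 i hi
        exact Subsingleton.elim _ _
    have hp : ∀ i (β : EX (MvPolynomial (Fin n) k) (TT k (insert v F)) (MvPolynomial (Fin n) k) i),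
        pull (mulm {v} (fun _ hτ _ => hτ) : TT k (insert v F) →ₗ[_] TT k (insert v F))
          (MvPolynomial (Fin n) k) i β = (X v : MvPolynomial (Fin n) k) • β := by
      intro i β
      rw [mulm_self, pull_smul, pull_id]
    have hg : ∀ i (γ : EX (MvPolynomial (Fin n) k) (TT k F) (MvPolynomial (Fin n) k) i),
        pull (pr (erase_Iic hG)) (MvPolynomial (Fin n) k) i γ = 0 := by
      intro i γ
      apply hx
      rw [← hp, pull_pull, ses.zero, pull_zero]
    have hsurj : ∀ i (γ : EX (MvPolynomial (Fin n) k) (TT k F) (MvPolynomial (Fin n) k) (i+1)),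
        ∃ α, ses.del (MvPolynomial (Fin n) k) i α = γ := fun i γ => ses.les3 i γ (hg _ γ)
    refine ⟨?_, ?_⟩
    · intro i hi
      refine subsingleton_of_forall_eq 0 fun γ => ?_
      cases i with
      | zero => exact ses.les0 γ (hg _ γ)
      | succ i =>
        obtain ⟨α, rfl⟩ := hsurj i γ
        have := ih1 i (by omega)
        rw [Subsingleton.elim α 0, map_zero]
    · have hker : LinearMap.ker (ses.del (MvPolynomial (Fin n) k) m) =
          LinearMap.ker ((pr (erase_Iic hG)) ∘ₗ e.toLinearMap) := by
        ext α
        rw [LinearMap.mem_ker, LinearMap.mem_ker]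
        constructor
        · intro h
          obtain ⟨β, rfl⟩ := ses.les1 m α h
          rw [hp, LinearMap.comp_apply, LinearEquiv.coe_coe, map_smul]
          have := ses.exact.apply_apply_eq_zero (e β)
          rw [mulm_self] at this
          exact this
        · intro h
          obtain ⟨q, hq⟩ := (ses.exact (e α)).mp h
          have : α = pull (mulm {v} (fun _ hτ _ => hτ) : TT k (insert v F) →ₗ[_] TT k (insert v F))
              (MvPolynomial (Fin n) k) m (e.symm q) := by
            apply e.injective
            rw [hp, map_smul, e.apply_symm_apply, ← hq, mulm_self]; rfl
          rw [this, ses.del_pull]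
      refine ⟨(LinearMap.quotKerEquivOfSurjective _ (hsurj m)).symm ≪≫ₗ
        Submodule.quotEquivOfEq _ _ hker ≪≫ₗ LinearMap.quotKerEquivOfSurjective _ ?_⟩
      exact (pr_surj (erase_Iic hG)).comp e.surjective

/-- skeleton -/
def sk (Γ : LowerSet (Finset (Fin n))) (j : ℕ) : LowerSet (Finset (Fin n)) where
  carrier := {σ | σ ∈ Γ ∧ σ.card < j}
  lower' := fun _ _ h hs => ⟨Γ.lower h hs.1, (Finset.card_le_card h).trans_lt hs.2⟩

lemma mem_sk {Γ : LowerSet (Finset (Fin n))} {j : ℕ} {σ : Finset (Fin n)} :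
    σ ∈ sk Γ j ↔ σ ∈ Γ ∧ σ.card < j := Iff.rfl

lemma sk_le (Γ : LowerSet (Finset (Fin n))) (j : ℕ) : sk Γ j ≤ sk Γ (j+1) :=
  fun _ h => ⟨h.1, by have := h.2; omega⟩

/-- faces of given size -/
abbrev Fc (Γ : LowerSet (Finset (Fin n))) (j : ℕ) : Type := {F : Finset (Fin n) // F ∈ Γ ∧ F.card = j}

noncomputable instance (Γ : LowerSet (Finset (Fin n))) (j : ℕ) : Fintype (Fc Γ j) := Fintype.ofFinite _

variable (k) in
/-- layer of the skeleton filtration -/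
abbrev KK (Γ : LowerSet (Finset (Fin n))) (j : ℕ) : Type := (F : Fc Γ j) → TT k F.1

/-- inclusion of a component -/
noncomputable def mi {Γ : LowerSet (Finset (Fin n))} {j : ℕ} (F : Fc Γ j) :
    TT k F.1 →ₗ[MvPolynomial (Fin n) k] Qr k (sk Γ (j+1)) :=
  mulm F.1 (fun τ hτ h => by
    have h1 := (mem_sk.mp hτ).2
    have h2 := F.2.2
    have : F.1 = τ := Finset.eq_of_subset_of_card_le h (by omega)
    rw [LowerSet.mem_Iic_iff, this])

variable (k) in
/-- inclusion of the layer -/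
noncomputable def io (Γ : LowerSet (Finset (Fin n))) (j : ℕ) :
    KK k Γ j →ₗ[MvPolynomial (Fin n) k] Qr k (sk Γ (j+1)) :=
  ∑ F : Fc Γ j, mi F ∘ₗ LinearMap.proj F

lemma io_apply (Γ : LowerSet (Finset (Fin n))) (j : ℕ) (t : KK k Γ j) :
    io k Γ j t = ∑ F : Fc Γ j, mi F (t F) := by
  rw [io, LinearMap.sum_apply]; rfl

open Classical in
lemma io_single (Γ : LowerSet (Finset (Fin n))) (j : ℕ) (F : Fc Γ j) :
    io k Γ j ∘ₗ LinearMap.single (MvPolynomial (Fin n) k) (fun F : Fc Γ j => TT k F.1) F = mi F := by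
  refine LinearMap.ext fun q => ?_
  rw [LinearMap.comp_apply, io_apply, Finset.sum_eq_single F]
  · rw [LinearMap.single_apply, Pi.single_eq_same]
  · intro G _ hG
    rw [LinearMap.single_apply, Pi.single_eq_of_ne hG, map_zero]
  · simp

lemma add_ind_support {F : Finset (Fin n)} {a : Fin n →₀ ℕ} (h : a.support ⊆ F) :
    (a + ind F).support = F := by
  ext i
  simp only [Finsupp.mem_support_iff, Finsupp.add_apply, ind_apply]
  by_cases hi : i ∈ F
  · simp [hi]
  · have : i ∉ a.support := fun h' => hi (h h')
    simp only [Finsupp.mem_support_iff, not_not] at this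
    simp [hi, this]

theorem sesK (Γ : LowerSet (Finset (Fin n))) (j : ℕ) :
    SES (R := MvPolynomial (Fin n) k) (io k Γ j) (pr (k := k) (sk_le Γ j)) where
  inj := by
    classical
    rw [injective_iff_map_eq_zero]
    intro t ht
    funext F
    apply qc_ext
    intro a ha
    have hs := add_ind_support (LowerSet.mem_Iic_iff.mp ha)
    have h1 : qc k _ (a + ind F.1) (io k Γ j t) = 0 := by rw [ht, map_zero]
    rw [io_apply, map_sum, Finset.sum_eq_single F] at h1
    · rw [mi, qc_mulm] at h1
      · rw [h1, Pi.zero_apply, map_zero]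
      · rw [hs]; exact ⟨F.2.1, by rw [F.2.2]; omega⟩
    · intro G _ hG
      apply qc_mulm_zero
      rw [hs]
      intro h
      apply hG
      exact Subtype.ext (Finset.eq_of_subset_of_card_le h (by rw [F.2.2, G.2.2]))
    · simp
  exact := by
    classical
    intro q
    constructor
    · intro hq
      rw [pr_eq_zero_iff] at hq
      apply mem_of_monomials (LinearMap.range (io k Γ j)) q
      intro a ha h0
      have hc : a.support.card = j := by
        by_contra hc
        apply h0
        apply hq
        exact ⟨ha.1, by have := ha.2; omega⟩
      let F : Fc Γ j := ⟨a.support, ha.1, hc⟩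
      refine ⟨LinearMap.single (MvPolynomial (Fin n) k) (fun F : Fc Γ j => TT k F.1) F
        (xm _ (a - ind a.support)), ?_⟩
      have := LinearMap.congr_fun (io_single (k := k) Γ j F) (xm _ (a - ind a.support))
      rw [LinearMap.comp_apply] at this
      rw [this, mi, mulm_xm, ind_add_sub (le_refl _)]
    · rintro ⟨t, rfl⟩
      rw [pr_eq_zero_iff]
      intro a ha
      rw [io_apply, map_sum]
      apply Finset.sum_eq_zero
      intro F _
      apply qc_mulm_zero
      intro h
      have := Finset.card_le_card h
      have h2 := F.2.2
      have h3 := ha.2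
      omega
  surj := pr_surj _

lemma EX_pi_ext {R : Type} [CommRing R] {Z : Type} [AddCommGroup Z] [Module R Z] {ι : Type} [Fintype ι]
    [DecidableEq ι] {A : ι → Type} [∀ j, AddCommGroup (A j)] [∀ j, Module R (A j)] (i : ℕ)
    (α : EX R ((j : ι) → A j) Z i) :
    α = ∑ j, pull (LinearMap.proj j : ((j : ι) → A j) →ₗ[R] A j) Z i
      (pull (LinearMap.single R A j) Z i α) := by
  have key : (LinearMap.id : ((j : ι) → A j) →ₗ[R] ((j : ι) → A j)) =
      ∑ j, LinearMap.single R A j ∘ₗ LinearMap.proj j := by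
    refine LinearMap.ext fun x => ?_
    rw [LinearMap.sum_apply]
    simp only [LinearMap.comp_apply, LinearMap.proj_apply, LinearMap.single_apply, LinearMap.id_apply]
    exact (Finset.univ_sum_single x).symm
  conv_lhs => rw [← pull_id i α, key, pull_sum]
  refine Finset.sum_congr rfl fun j _ => ?_
  rw [pull_pull]

theorem lemmaB (Γ : LowerSet (Finset (Fin n))) (j : ℕ) : ∀ i, i + j ≤ n →
    Subsingleton (EX (MvPolynomial (Fin n) k) (Qr k (sk Γ j)) (MvPolynomial (Fin n) k) i) := by
  classical
  induction j with
  | zero =>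
    intro i _
    refine subsingleton_of_forall_eq 0 fun γ => ?_
    have : (LinearMap.id : Qr k (sk Γ 0) →ₗ[MvPolynomial (Fin n) k] Qr k (sk Γ 0)) = 0 := by
      refine LinearMap.ext fun q => ?_
      apply qc_ext
      intro a ha
      exact absurd ha.2 (by omega)
    rw [← pull_id i γ, this, pull_zero]
  | succ j ih =>
    intro i hi
    refine subsingleton_of_forall_eq 0 fun β => ?_
    have hβ : pull (io k Γ j) (MvPolynomial (Fin n) k) i β = 0 := by
      rw [EX_pi_ext i (pull (io k Γ j) (MvPolynomial (Fin n) k) i β)]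
      apply Finset.sum_eq_zero
      intro F _
      have hF := F.2.2
      have := (lemmaA (k := k) (n - j) F.1 (by omega)).1 i (by omega)
      rw [Subsingleton.elim (pull (LinearMap.single (MvPolynomial (Fin n) k) (fun F : Fc Γ j => TT k F.1) F)
        (MvPolynomial (Fin n) k) i _) 0, map_zero]
    obtain ⟨γ, rfl⟩ := (sesK Γ j).les2 i β hβ
    have := ih i (by omega)
    rw [Subsingleton.elim γ 0, map_zero]

/-! matrix entries of the differential -/

lemma pr_mulm {Γ Γ' Γ'' : LowerSet (Finset (Fin n))} (σ : Finset (Fin n))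
    (h : ∀ τ ∈ Γ', σ ⊆ τ → τ ∈ Γ) (h' : Γ'' ≤ Γ') :
    pr h' ∘ₗ (mulm σ h : Qr k Γ →ₗ[_] Qr k Γ') = mulm σ (fun τ hτ hs => h τ (h' hτ) hs) := by
  apply Qr_hom_ext
  rw [LinearMap.comp_apply, mulm_one, mulm_one, pr_xm]

lemma mulm_eq_zero {Γ Γ' : LowerSet (Finset (Fin n))} (σ : Finset (Fin n))
    (h : ∀ τ ∈ Γ', σ ⊆ τ → τ ∈ Γ) (h' : σ ∉ Γ') : (mulm σ h : Qr k Γ →ₗ[_] Qr k Γ') = 0 := by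
  apply Qr_hom_ext
  rw [mulm_one, xm_eq_zero (by rwa [ind_support])]; rfl

lemma Iic_le_sk {Γ : LowerSet (Finset (Fin n))} {j : ℕ} (F : Fc Γ j) :
    LowerSet.Iic F.1 ≤ sk Γ (j+1) :=
  fun σ hσ => ⟨Γ.lower hσ F.2.1, by
    have h1 := Finset.card_le_card hσ; have := F.2.2; omega⟩

lemma Iio_le_sk {Γ : LowerSet (Finset (Fin n))} {j : ℕ} (F : Fc Γ j) :
    LowerSet.Iio F.1 ≤ sk Γ j :=
  fun σ hσ => ⟨Γ.lower (le_of_lt hσ) F.2.1, by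
    have h1 := Finset.card_lt_card hσ; have := F.2.2; omega⟩

lemma del_proj {Γ : LowerSet (Finset (Fin n))} {j : ℕ} (F : Fc Γ j) (i : ℕ)
    (α : EX (MvPolynomial (Fin n) k) (TT k F.1) (MvPolynomial (Fin n) k) i) :
    (sesK Γ j).del (MvPolynomial (Fin n) k) i
      (pull (LinearMap.proj F : KK k Γ j →ₗ[_] TT k F.1) (MvPolynomial (Fin n) k) i α) =
    pull (pr (Iio_le_sk F)) _ (i+1) ((sesBd F.1).del _ i α) := by
  classical
  symm
  refine SES.natural (sesK Γ j) (sesBd F.1) _ (pr (Iic_le_sk F)) _ ?_ (Qr_hom_ext (by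
    rw [LinearMap.comp_apply, LinearMap.comp_apply, pr_one, pr_one, pr_one, pr_one])) i α
  refine LinearMap.ext fun t => ?_
  rw [LinearMap.comp_apply, LinearMap.comp_apply, io_apply, map_sum, Finset.sum_eq_single F]
  · rw [← LinearMap.comp_apply (pr (Iic_le_sk F)), mi, pr_mulm]; rfl
  · intro G _ hG
    rw [← LinearMap.comp_apply, mi, pr_mulm, mulm_eq_zero, LinearMap.zero_apply]
    intro h
    apply hG
    exact Subtype.ext (Finset.eq_of_subset_of_card_le h (by rw [F.2.2, G.2.2]))
  · simp

lemma D_eq_zero {Γ : LowerSet (Finset (Fin n))} {j : ℕ} (F : Fc Γ (j+1)) (G : Fc Γ j) (h : ¬ G.1 ⊆ F.1)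
    (i : ℕ) (α : EX (MvPolynomial (Fin n) k) (TT k F.1) (MvPolynomial (Fin n) k) i) :
    pull (mi G) _ _ ((sesK Γ (j+1)).del (MvPolynomial (Fin n) k) i
      (pull (LinearMap.proj F : KK k Γ (j+1) →ₗ[_] TT k F.1) (MvPolynomial (Fin n) k) i α)) = 0 := by
  rw [del_proj, pull_pull, mi, pr_mulm, mulm_eq_zero, pull_zero]
  intro h'
  exact h (le_of_lt h')

lemma xG_aux {F G : Finset (Fin n)} {v : Fin n} (hv : v ∈ F) (hG : G = F.erase v) :
    ∀ τ ∈ LowerSet.Iio F, G ⊆ τ → τ ∈ LowerSet.Iic G := by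
  intro τ hτ hs
  rw [LowerSet.mem_Iic_iff]
  rw [LowerSet.mem_Iio_iff] at hτ
  have h1 := Finset.card_lt_card hτ
  have h2 := Finset.card_erase_of_mem hv
  rw [← hG] at h2
  exact (Finset.eq_of_subset_of_card_le hs (by omega)).ge

lemma xG_sq1 {F G : Finset (Fin n)} {v : Fin n} (hv : v ∈ F) (hG : G = F.erase v) :
    (mulm F (fun _ hτ _ => hτ) : TT k F →ₗ[_] TT k F) ∘ₗ LinearMap.id =
    (mulm G (fun _ hτ _ => hτ) : TT k F →ₗ[_] TT k F) ∘ₗ (mulm {v} (fun _ hτ _ => hτ) : TT k F →ₗ[_] TT k F) := by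
  apply Qr_hom_ext
  rw [LinearMap.comp_apply, LinearMap.comp_apply, mulm_one, LinearMap.id_apply, mulm_one, mulm_xm]
  congr 2
  ext i
  simp only [hG, ind_apply, Finsupp.add_apply, Finset.mem_erase, Finset.mem_singleton]
  by_cases h : i = v
  · subst h; simp [hv]
  · simp [h]

lemma xG_sq2 {F G : Finset (Fin n)} {v : Fin n} (hv : v ∈ F) (hG : G = F.erase v) :
    pr (Iio_le_Iic F) ∘ₗ (mulm G (fun _ hτ _ => hτ) : TT k F →ₗ[_] TT k F) =
    (mulm G (xG_aux hv hG)) ∘ₗ pr (erase_Iic hG) := by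
  apply Qr_hom_ext
  rw [LinearMap.comp_apply, LinearMap.comp_apply, mulm_one, pr_xm, pr_one, mulm_one]

lemma xG_del {F G : Finset (Fin n)} {v : Fin n} (hv : v ∈ F) (hG : G = F.erase v)
    (i : ℕ) (α : EX (MvPolynomial (Fin n) k) (TT k F) (MvPolynomial (Fin n) k) i) :
    pull (mulm G (xG_aux hv hG)) _ (i+1) ((sesBd F).del _ i α) = (sesX hv hG).del _ i α := by
  rw [SES.natural (sesX hv hG) (sesBd F) LinearMap.id _ _ (xG_sq1 hv hG) (xG_sq2 hv hG) i α, pull_id]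

lemma D_eq {Γ : LowerSet (Finset (Fin n))} {j : ℕ} (F : Fc Γ (j+1)) (G : Fc Γ j) {v : Fin n}
    (hv : v ∈ F.1) (hG : G.1 = F.1.erase v)
    (i : ℕ) (α : EX (MvPolynomial (Fin n) k) (TT k F.1) (MvPolynomial (Fin n) k) i) :
    pull (mi G) _ _ ((sesK Γ (j+1)).del (MvPolynomial (Fin n) k) i
      (pull (LinearMap.proj F : KK k Γ (j+1) →ₗ[_] TT k F.1) (MvPolynomial (Fin n) k) i α)) =
    (sesX hv hG).del _ i α := by
  rw [del_proj, pull_pull, mi, pr_mulm, ← xG_del hv hG]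

end TA

end PieceP3c

section PieceP3d

open MvPolynomial

section TD

variable {k : Type} [Field k] {n : ℕ}

open Classical in
lemma pull_single_io {Γ : LowerSet (Finset (Fin n))} {j : ℕ} (F : Fc Γ j) (i : ℕ)
    (γ : EX (MvPolynomial (Fin n) k) (Qr k (sk Γ (j+1))) (MvPolynomial (Fin n) k) i) :
    pull (LinearMap.single (MvPolynomial (Fin n) k) (fun F : Fc Γ j => TT k F.1) F) _ i
      (pull (io k Γ j) _ i γ) = pull (mi F) _ i γ := by
  rw [pull_pull, io_single]

lemma DD {F A B H : Finset (Fin n)} {a b : Fin n} (hab : a ≠ b) (ha : a ∈ F) (hb : b ∈ F)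
    (hA : A = F.erase a) (hB : B = F.erase b) (hbA : b ∈ A) (haB : a ∈ B)
    (hH : H = A.erase b) (hH' : H = B.erase a)
    (i : ℕ) (α : EX (MvPolynomial (Fin n) k) (TT k F) (MvPolynomial (Fin n) k) i) :
    (sesX hbA hH).del _ (i+1) ((sesX ha hA).del _ i α) +
      (sesX haB hH').del _ (i+1) ((sesX hb hB).del _ i α) = 0 := by
  classical
  obtain ⟨j, hj⟩ : ∃ j, F.card = j + 2 := by
    have h1 : ({a, b} : Finset (Fin n)) ⊆ F := by
      intro x hx; simp only [Finset.mem_insert, Finset.mem_singleton] at hx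
      rcases hx with rfl | rfl <;> assumption
    have := Finset.card_le_card h1
    rw [Finset.card_pair hab] at this
    exact ⟨F.card - 2, by omega⟩
  have cA : A.card = j + 1 := by rw [hA, Finset.card_erase_of_mem ha]; omega
  have cB : B.card = j + 1 := by rw [hB, Finset.card_erase_of_mem hb]; omega
  have cH : H.card = j := by rw [hH, Finset.card_erase_of_mem hbA]; omega
  let F' : Fc (⊤ : LowerSet (Finset (Fin n))) (j+2) := ⟨F, trivial, hj⟩
  let A' : Fc (⊤ : LowerSet (Finset (Fin n))) (j+1) := ⟨A, trivial, cA⟩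
  let B' : Fc (⊤ : LowerSet (Finset (Fin n))) (j+1) := ⟨B, trivial, cB⟩
  let H' : Fc (⊤ : LowerSet (Finset (Fin n))) j := ⟨H, trivial, cH⟩
  set γ := (sesK (k := k) (⊤ : LowerSet (Finset (Fin n))) (j+2)).del (MvPolynomial (Fin n) k) i
      (pull (LinearMap.proj F' : KK k ⊤ (j+2) →ₗ[_] TT k F) (MvPolynomial (Fin n) k) i α) with hγ
  have h0 := (sesK (k := k) (⊤ : LowerSet (Finset (Fin n))) (j+1)).del_pull
    (Z := MvPolynomial (Fin n) k) (i+1) γ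
  rw [EX_pi_ext (i+1) (pull (io k ⊤ (j+1)) _ (i+1) γ), map_sum] at h0
  have h1 := congrArg (pull (mi H') (MvPolynomial (Fin n) k) (i+1+1)) h0
  rw [map_zero, map_sum] at h1
  have hAB : A' ≠ B' := by
    intro h
    have : A = B := congrArg Subtype.val h
    rw [this, hB] at hbA
    simp at hbA
  rw [Fintype.sum_eq_add A' B' hAB] at h1
  · rw [D_eq A' H' hbA hH, D_eq B' H' haB hH', pull_single_io, pull_single_io,
      D_eq F' A' ha hA, D_eq F' B' hb hB] at h1
    exact h1
  · rintro G ⟨hGA, hGB⟩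
    rw [pull_single_io]
    by_cases hG : G.1 ⊆ F
    · have hHG : ¬ H ⊆ G.1 := by
        intro hHG
        have hcG := G.2.2
        by_cases h1 : a ∈ G.1
        · by_cases h2 : b ∈ G.1
          · have : F ⊆ G.1 := by
              intro x hx
              by_cases hxa : x = a
              · rw [hxa]; exact h1
              by_cases hxb : x = b
              · rw [hxb]; exact h2
              apply hHG
              rw [hH, hA]
              simp [hxa, hxb, hx]
            have := Finset.card_le_card this
            omega
          · apply hGB
            apply Subtype.ext
            refine Finset.eq_of_subset_of_card_le ?_ (by omega)
            change G.1 ⊆ B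
            rw [hB]
            exact Finset.subset_erase.mpr ⟨hG, h2⟩
        · apply hGA
          apply Subtype.ext
          refine Finset.eq_of_subset_of_card_le ?_ (by omega)
          change G.1 ⊆ A
          rw [hA]
          exact Finset.subset_erase.mpr ⟨hG, h1⟩
      exact D_eq_zero _ H' hHG _ _
    · rw [hγ, D_eq_zero F' G hG, map_zero, map_zero, map_zero]

/-- chosen isomorphisms -/
noncomputable def phi (F : Finset (Fin n)) (m : ℕ) (h : F.card + m = n) :
    EX (MvPolynomial (Fin n) k) (TT k F) (MvPolynomial (Fin n) k) m
      ≃ₗ[MvPolynomial (Fin n) k] TT k F := (lemmaA m F h).2.some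

lemma cc_exists (F : Finset (Fin n)) (v : Fin n) (hv : v ∈ F) : ∃ c : k, c ≠ 0 ∧
    ∀ G (hG : G = F.erase v) (m : ℕ) (h : F.card + m = n) (h' : G.card + (m+1) = n) α,
      phi G (m+1) h' ((sesX hv hG).del (MvPolynomial (Fin n) k) m α) =
        (C c : MvPolynomial (Fin n) k) • pr (erase_Iic hG) (phi F m h α) := by
  have hF : F.card + (n - F.card) = n := by
    have := Finset.card_le_univ F
    rw [Fintype.card_fin] at this; omega
  have hG' : (F.erase v).card + (n - F.card + 1) = n := by
    rw [Finset.card_erase_of_mem hv]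
    have := Finset.card_pos.mpr ⟨v, hv⟩
    omega
  obtain ⟨c, hc, h⟩ := TT_surj (erase_Iic (rfl : F.erase v = F.erase v))
    ((phi (F.erase v) _ hG').toLinearMap ∘ₗ ((sesX hv rfl).del (MvPolynomial (Fin n) k) (n - F.card)) ∘ₗ
      (phi (k := k) F _ hF).symm.toLinearMap) (by
      have : Function.Surjective ((sesX (k := k) hv rfl).del (MvPolynomial (Fin n) k) (n - F.card)) := by
        intro γ
        have := (lemmaA (k := k) (n - F.card) F hF).1 (n - F.card + 1) (by omega)
        exact (sesX hv rfl).les3 _ γ (Subsingleton.elim _ _)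
      rw [LinearMap.coe_comp, LinearMap.coe_comp]
      exact (LinearEquiv.surjective _).comp (this.comp (LinearEquiv.surjective _)))
  refine ⟨c, hc, ?_⟩
  intro G hG m h1 h2 α
  subst hG
  obtain rfl : m = n - F.card := by omega
  have := h (phi F _ hF α)
  rw [← this]
  simp

variable (k) in
open Classical in
/-- constants -/
noncomputable def cc (F : Finset (Fin n)) (v : Fin n) : k :=
  if hv : v ∈ F then (cc_exists (k := k) F v hv).choose else 1

lemma cc_ne (F : Finset (Fin n)) (v : Fin n) : cc k F v ≠ 0 := by
  rw [cc]
  split_ifs with h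
  · exact (cc_exists (k := k) F v h).choose_spec.1
  · exact one_ne_zero

lemma cc_spec {F : Finset (Fin n)} {v : Fin n} (hv : v ∈ F) 
    {G} (hG : G = F.erase v) {m : ℕ} (h : F.card + m = n) (h' : G.card + (m+1) = n) (α) :
      phi G (m+1) h' ((sesX hv hG).del (MvPolynomial (Fin n) k) m α) =
        (C (cc k F v) : MvPolynomial (Fin n) k) • pr (erase_Iic hG) (phi F m h α) := by
  rw [cc, dif_pos hv]
  exact (cc_exists (k := k) F v hv).choose_spec.2 G hG m h h' α

lemma cc_rel {F : Finset (Fin n)} {a b : Fin n} (hab : a ≠ b) (ha : a ∈ F) (hb : b ∈ F) :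
    cc k F a * cc k (F.erase a) b + cc k F b * cc k (F.erase b) a = 0 := by
  have hbA : b ∈ F.erase a := Finset.mem_erase.mpr ⟨hab.symm, hb⟩
  have haB : a ∈ F.erase b := Finset.mem_erase.mpr ⟨hab, ha⟩
  have hF : F.card + (n - F.card) = n := by
    have := Finset.card_le_univ F
    rw [Fintype.card_fin] at this; omega
  have h1 := DD (k := k) hab ha hb rfl rfl hbA haB rfl Finset.erase_right_comm (n - F.card)
    ((phi F _ hF).symm 1)
  have cA := Finset.card_erase_add_one ha
  have cB := Finset.card_erase_add_one hb
  have cH := Finset.card_erase_add_one hbA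
  have h2 := congrArg (phi ((F.erase a).erase b) _ (by omega)) h1
  rw [map_add, map_zero, cc_spec hbA rfl (m := n - F.card + 1) (by omega) (by omega),
    cc_spec haB Finset.erase_right_comm (m := n - F.card + 1) (by omega) (by omega),
    cc_spec ha rfl hF (by omega), cc_spec hb rfl hF (by omega)] at h2
  rw [LinearEquiv.apply_symm_apply, map_smul, map_smul, pr_one, pr_one, pr_one, pr_one,
    smul_smul, smul_smul, ← add_smul, ← C_mul, ← C_mul, ← C_add, smul_eq_mk_mul, mul_one] at h2
  have h3 := congrArg (qc k _ 0) h2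
  classical
  rw [qc_mk, map_zero, if_pos (by simp)] at h3
  simp only [coeff_zero_C] at h3
  linear_combination h3

lemma eps_comm2 {F : Finset (Fin n)} {a b : Fin n} (hab : a ≠ b) (ha : a ∈ F) (hb : b ∈ F) :
    eps k a F * eps k b (F.erase a) = - (eps k b F * eps k a (F.erase b)) := by
  have h := eps_comm k hab (τ := (F.erase a).erase b) (by simp) (by simp)
  rw [Finset.insert_erase (Finset.mem_erase.mpr ⟨hab.symm, hb⟩), eps_erase_self, eps_erase_self,
    Finset.erase_right_comm, Finset.insert_erase (Finset.mem_erase.mpr ⟨hab, ha⟩), eps_erase_self,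
    eps_erase_self] at h
  exact h

variable (k) in
/-- normalised constants -/
noncomputable def rr (F : Finset (Fin n)) (v : Fin n) : k := cc k F v * eps k v F

lemma rr_rel {F : Finset (Fin n)} {a b : Fin n} (hab : a ≠ b) (ha : a ∈ F) (hb : b ∈ F) :
    rr k F a * rr k (F.erase a) b = rr k F b * rr k (F.erase b) a := by
  have h1 := cc_rel (k := k) hab ha hb
  have h2 := eps_comm2 (k := k) hab ha hb
  unfold rr
  linear_combination (cc k F a * cc k (F.erase a) b) * h2 - (eps k b F * eps k a (F.erase b)) * h1

variable (k) in
/-- potential -/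
noncomputable def uu (F : Finset (Fin n)) : k := ∏ i ∈ F, rr k (F.filter (fun j => j ≤ i)) i

lemma uu_ne (F : Finset (Fin n)) : uu k F ≠ 0 :=
  Finset.prod_ne_zero_iff.mpr fun _ _ => mul_ne_zero (cc_ne _ _) (eps_ne_zero _ _ _)

lemma uu_max {F : Finset (Fin n)} {m : Fin n} (hm : m ∈ F) (hmax : ∀ j ∈ F, j ≤ m) :
    uu k F = rr k F m * uu k (F.erase m) := by
  rw [uu, ← Finset.mul_prod_erase F _ hm, Finset.filter_true_of_mem hmax, uu]
  congr 1
  refine Finset.prod_congr rfl fun i hi => ?_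
  congr 1
  ext j
  simp only [Finset.mem_filter, Finset.mem_erase]
  constructor
  · rintro ⟨h1, h2⟩
    refine ⟨⟨?_, h1⟩, h2⟩
    rintro rfl
    rw [Finset.mem_erase] at hi
    exact hi.1 (le_antisymm (hmax i hi.2) h2)
  · rintro ⟨⟨_, h1⟩, h2⟩
    exact ⟨h1, h2⟩

lemma uu_rel (N : ℕ) : ∀ F : Finset (Fin n), F.card = N → ∀ v ∈ F,
    uu k F = rr k F v * uu k (F.erase v) := by
  induction N with
  | zero => 
    intro F hF v hv
    rw [Finset.card_eq_zero] at hF; subst hF; simp at hv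
  | succ N ih =>
    intro F hF v hv
    obtain ⟨m, hm, hmax⟩ := F.exists_max_image id ⟨v, hv⟩
    by_cases hvm : v = m
    · subst hvm; exact uu_max hv hmax
    · have h1 := ih (F.erase v) (by rw [Finset.card_erase_of_mem hv]; omega) m
        (Finset.mem_erase.mpr ⟨fun h => hvm h.symm, hm⟩)
      have h2 := ih (F.erase m) (by rw [Finset.card_erase_of_mem hm]; omega) v
        (Finset.mem_erase.mpr ⟨hvm, hv⟩)
      rw [uu_max hm hmax, h1, h2, ← mul_assoc, ← mul_assoc, rr_rel hvm hv hm,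
        Finset.erase_right_comm]

theorem psi_exists : ∃ ψ : ∀ (F : Finset (Fin n)) (m : ℕ) (_ : F.card + m = n),
    EX (MvPolynomial (Fin n) k) (TT k F) (MvPolynomial (Fin n) k) m
      ≃ₗ[MvPolynomial (Fin n) k] TT k F,
    ∀ {F G : Finset (Fin n)} {v : Fin n} (hv : v ∈ F) (hG : G = F.erase v) (m : ℕ) 
      (h : F.card + m = n) (h' : G.card + (m+1) = n) (α), 
      ψ G (m+1) h' ((sesX hv hG).del (MvPolynomial (Fin n) k) m α) =
        (C (eps k v F) : MvPolynomial (Fin n) k) • pr (erase_Iic hG) (ψ F m h α) := by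
  have hu : ∀ F : Finset (Fin n), (C (uu k F)⁻¹ : MvPolynomial (Fin n) k) * C (uu k F) = 1 := by
    intro F
    rw [← C_mul, inv_mul_cancel₀ (uu_ne F), C_1]
  refine ⟨fun F m h => (phi F m h) ≪≫ₗ LinearEquiv.ofLinearMap
    ((C (uu k F) : MvPolynomial (Fin n) k) • LinearMap.id)
    ((C (uu k F)⁻¹ : MvPolynomial (Fin n) k) • LinearMap.id) ?_ ?_, ?_⟩
  · refine LinearMap.ext fun x => ?_
    change (C (uu k F) : MvPolynomial (Fin n) k) • (C (uu k F)⁻¹ : MvPolynomial (Fin n) k) • x = x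
    rw [smul_smul, mul_comm, hu, one_smul]
  · refine LinearMap.ext fun x => ?_
    change (C (uu k F)⁻¹ : MvPolynomial (Fin n) k) • (C (uu k F) : MvPolynomial (Fin n) k) • x = x
    rw [smul_smul, hu, one_smul]
  · intro F G v hv hG m h h' α
    subst hG
    change (C (uu k (F.erase v)) : MvPolynomial (Fin n) k) • (phi (k := k) (F.erase v) (m+1) h' ((sesX hv rfl).del _ m α)) =
      (C (eps k v F) : MvPolynomial (Fin n) k) • pr (erase_Iic rfl) ((C (uu k F) : MvPolynomial (Fin n) k) • phi F m h α)
    rw [cc_spec hv rfl h h', map_smul, smul_smul, smul_smul, ← C_mul, ← C_mul, uu_rel _ F rfl v hv, rr]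
    congr 2
    have := eps_sq k v F
    linear_combination (- uu k (F.erase v) * cc k F v) * this

end TD

end PieceP3d

section PieceP3e

open MvPolynomial

section TE

variable {k : Type} [Field k] {n : ℕ}

lemma insert_Iic (G : Finset (Fin n)) (v : Fin n) : LowerSet.Iic G ≤ LowerSet.Iic (insert v G) :=
  LowerSet.Iic_le.mpr (Finset.subset_insert _ _)

variable (k) in
/-- concrete canonical module -/
noncomputable def Wm (Γ : LowerSet (Finset (Fin n))) (d : ℕ) :
    Submodule (MvPolynomial (Fin n) k) ((F : Finset (Fin n)) → TT k F) where
  carrier := {t | (∀ F, ¬ (F ∈ Γ ∧ F.card = d) → t F = 0) ∧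
    ∀ G : Finset (Fin n), G.card + 1 = d →
      ∑ v ∈ Gᶜ, (C (eps k v G) : MvPolynomial (Fin n) k) • pr (insert_Iic G v) (t (insert v G)) = 0}
  zero_mem' := ⟨fun _ _ => rfl, fun G _ => by simp⟩
  add_mem' := by
    rintro s t ⟨h1, h2⟩ ⟨h3, h4⟩
    refine ⟨fun F hF => by rw [Pi.add_apply, h1 F hF, h3 F hF, add_zero], fun G hG => ?_⟩
    simp only [Pi.add_apply, map_add, smul_add, Finset.sum_add_distrib, h2 G hG, h4 G hG, add_zero]
  smul_mem' := by
    rintro c t ⟨h1, h2⟩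
    refine ⟨fun F hF => by rw [Pi.smul_apply, h1 F hF, smul_zero], fun G hG => ?_⟩
    simp only [Pi.smul_apply, map_smul]
    have : ∀ v ∈ Gᶜ, (C (eps k v G) : MvPolynomial (Fin n) k) • c • pr (insert_Iic G v) (t (insert v G)) =
      c • (C (eps k v G) : MvPolynomial (Fin n) k) • pr (insert_Iic G v) (t (insert v G)) :=
      fun v _ => smul_comm _ _ _
    rw [Finset.sum_congr rfl this, ← Finset.smul_sum, h2 G hG, smul_zero]

lemma mem_Wm {Γ : LowerSet (Finset (Fin n))} {d : ℕ} {t : (F : Finset (Fin n)) → TT k F} :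
    t ∈ Wm k Γ d ↔ (∀ F, ¬ (F ∈ Γ ∧ F.card = d) → t F = 0) ∧
    ∀ G : Finset (Fin n), G.card + 1 = d →
      ∑ v ∈ Gᶜ, (C (eps k v G) : MvPolynomial (Fin n) k) • pr (insert_Iic G v) (t (insert v G)) = 0 :=
  Iff.rfl

/-- the isomorphisms -/
noncomputable def psi (F : Finset (Fin n)) (m : ℕ) (h : F.card + m = n) :
    EX (MvPolynomial (Fin n) k) (TT k F) (MvPolynomial (Fin n) k) m
      ≃ₗ[MvPolynomial (Fin n) k] TT k F := (psi_exists (k := k) (n := n)).choose F m h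

lemma psi_spec {F G : Finset (Fin n)} {v : Fin n} (hv : v ∈ F) (hG : G = F.erase v) (m : ℕ) 
      (h : F.card + m = n) (h' : G.card + (m+1) = n) (α) :
      psi G (m+1) h' ((sesX hv hG).del (MvPolynomial (Fin n) k) m α) =
        (C (eps k v F) : MvPolynomial (Fin n) k) • pr (erase_Iic hG) (psi F m h α) :=
  (psi_exists (k := k) (n := n)).choose_spec hv hG m h h' α

open Classical in
/-- components -/
noncomputable def tcomp {Γ : LowerSet (Finset (Fin n))} {d c : ℕ} (hcd : c + d = n)
    (α : ∀ F : Fc Γ d, EX (MvPolynomial (Fin n) k) (TT k F.1) (MvPolynomial (Fin n) k) c)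
    (F : Finset (Fin n)) : TT k F :=
  if h : F ∈ Γ ∧ F.card = d then psi F c (by omega) (α ⟨F, h⟩) else 0

lemma tcomp_pos {Γ : LowerSet (Finset (Fin n))} {d c : ℕ} (hcd : c + d = n)
    (α : ∀ F : Fc Γ d, EX (MvPolynomial (Fin n) k) (TT k F.1) (MvPolynomial (Fin n) k) c)
    (F : Fc Γ d) : tcomp hcd α F.1 = psi F.1 c (by have := F.2.2; omega) (α F) := by
  rw [tcomp, dif_pos F.2]

lemma tcomp_neg {Γ : LowerSet (Finset (Fin n))} {d c : ℕ} (hcd : c + d = n)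
    (α : ∀ F : Fc Γ d, EX (MvPolynomial (Fin n) k) (TT k F.1) (MvPolynomial (Fin n) k) c)
    (F : Finset (Fin n)) (h : ¬ (F ∈ Γ ∧ F.card = d)) : tcomp hcd α F = 0 := by
  rw [tcomp, dif_neg h]

lemma pr_cast {F F' G : Finset (Fin n)} (h : F = F') (hG : LowerSet.Iic G ≤ LowerSet.Iic F)
    (hG' : LowerSet.Iic G ≤ LowerSet.Iic F') (t : (F : Finset (Fin n)) → TT k F) :
    pr hG (t F) = pr hG' (t F') := by
  subst h; rfl

lemma key {Γ : LowerSet (Finset (Fin n))} {j c : ℕ} (hcd : c + (j+1) = n)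
    (α : ∀ F : Fc Γ (j+1), EX (MvPolynomial (Fin n) k) (TT k F.1) (MvPolynomial (Fin n) k) c)
    (G : Fc Γ j) (hG' : G.1.card + (c+1) = n) :
    psi G.1 (c+1) hG' (pull (mi G) _ (c+1) ((sesK Γ (j+1)).del (MvPolynomial (Fin n) k) c
      (∑ F : Fc Γ (j+1), pull (LinearMap.proj F : KK k Γ (j+1) →ₗ[_] TT k F.1) _ c (α F)))) =
    ∑ v ∈ G.1ᶜ, (C (eps k v G.1) : MvPolynomial (Fin n) k) •
      pr (insert_Iic G.1 v) (tcomp hcd α (insert v G.1)) := by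
  classical
  rw [map_sum, map_sum, map_sum]
  symm
  have hmem : ∀ v ∈ G.1ᶜ, (C (eps k v G.1) : MvPolynomial (Fin n) k) •
      pr (insert_Iic G.1 v) (tcomp hcd α (insert v G.1)) ≠ 0 →
      insert v G.1 ∈ Γ ∧ (insert v G.1).card = j+1 := by
    intro v hv h
    by_contra hn
    apply h
    rw [tcomp_neg _ _ _ hn, map_zero, smul_zero]
  refine Finset.sum_bij_ne_zero (fun v hv h => (⟨insert v G.1, hmem v hv h⟩ : Fc Γ (j+1))) ?_ ?_ ?_ ?_
  · intros; exact Finset.mem_univ _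
  · intro v hv h w hw h' he
    have he : insert v G.1 = insert w G.1 := congrArg Subtype.val he
    have : v ∈ insert w G.1 := he ▸ Finset.mem_insert_self v G.1
    rw [Finset.mem_insert] at this
    rcases this with h | h
    · exact h
    · exact absurd h (Finset.mem_compl.mp hv)
  · intro F _ hF
    have hsub : G.1 ⊆ F.1 := by
      by_contra hn
      apply hF
      rw [D_eq_zero F G hn, map_zero]
    have hcard : (F.1 \ G.1).card = 1 := by
      rw [Finset.card_sdiff_of_subset hsub, F.2.2, G.2.2]; omega
    obtain ⟨v, hv⟩ := Finset.card_eq_one.mp hcard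
    have hvF : v ∈ F.1 \ G.1 := by rw [hv]; simp
    rw [Finset.mem_sdiff] at hvF
    have hFi : insert v G.1 = F.1 := by
      rw [← Finset.sdiff_union_of_subset hsub, hv]; rfl
    have hGe : G.1 = F.1.erase v := by rw [← hFi, Finset.erase_insert hvF.2]
    refine ⟨v, Finset.mem_compl.mpr hvF.2, ?_, Subtype.ext hFi⟩
    rw [D_eq F G hvF.1 hGe, psi_spec hvF.1 hGe c (by have := F.2.2; omega), ← tcomp_pos hcd] at hF
    rw [pr_cast hFi _ (erase_Iic hGe) (tcomp hcd α), show eps k v G.1 = eps k v F.1 by rw [← hFi, eps_insert_self]]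
    exact hF
  · intro v hv h
    have hvG := Finset.mem_compl.mp hv
    set F : Fc Γ (j+1) := ⟨insert v G.1, hmem v hv h⟩
    have hvF : v ∈ F.1 := Finset.mem_insert_self v G.1
    have hGe : G.1 = F.1.erase v := (Finset.erase_insert hvG).symm
    rw [D_eq F G hvF hGe, psi_spec hvF hGe c (by have := F.2.2; omega), ← tcomp_pos hcd]
    rw [← eps_insert_self k v G.1]

lemma EX_sk0 (Γ : LowerSet (Finset (Fin n))) (i : ℕ) :
    Subsingleton (EX (MvPolynomial (Fin n) k) (Qr k (sk Γ 0)) (MvPolynomial (Fin n) k) i) := by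
  refine subsingleton_of_forall_eq 0 fun γ => ?_
  have : (LinearMap.id : Qr k (sk Γ 0) →ₗ[MvPolynomial (Fin n) k] Qr k (sk Γ 0)) = 0 := by
    refine LinearMap.ext fun q => ?_
    apply qc_ext
    intro a ha
    exact absurd ha.2 (by omega)
  rw [← pull_id i γ, this, pull_zero]

/-- comparison map -/
noncomputable def Theta (Γ : LowerSet (Finset (Fin n))) {d c : ℕ} (hcd : c + d = n) :
    EX (MvPolynomial (Fin n) k) (Qr k (sk Γ (d+1))) (MvPolynomial (Fin n) k) c
      →ₗ[MvPolynomial (Fin n) k] ((F : Finset (Fin n)) → TT k F) where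
  toFun β := tcomp hcd (fun F => pull (mi F) _ c β)
  map_add' β β' := by
    funext F
    by_cases h : F ∈ Γ ∧ F.card = d
    · simp only [Pi.add_apply, tcomp, dif_pos h, map_add]
    · simp only [Pi.add_apply, tcomp, dif_neg h, add_zero]
  map_smul' r β := by
    funext F
    by_cases h : F ∈ Γ ∧ F.card = d
    · simp only [Pi.smul_apply, tcomp, dif_pos h, map_smul, RingHom.id_apply]
    · simp only [Pi.smul_apply, tcomp, dif_neg h, smul_zero]

lemma Theta_apply (Γ : LowerSet (Finset (Fin n))) {d c : ℕ} (hcd : c + d = n)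
    (β : EX (MvPolynomial (Fin n) k) (Qr k (sk Γ (d+1))) (MvPolynomial (Fin n) k) c) :
    Theta Γ hcd β = tcomp hcd (fun F => pull (mi F) _ c β) := rfl

lemma pull_io_eq (Γ : LowerSet (Finset (Fin n))) {d : ℕ} (c : ℕ)
    (β : EX (MvPolynomial (Fin n) k) (Qr k (sk Γ (d+1))) (MvPolynomial (Fin n) k) c) :
    pull (io k Γ d) _ c β =
      ∑ F : Fc Γ d, pull (LinearMap.proj F : KK k Γ d →ₗ[_] TT k F.1) _ c (pull (mi F) _ c β) := by
  classical
  conv_lhs => rw [EX_pi_ext c (pull (io k Γ d) _ c β)]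
  refine Finset.sum_congr rfl fun F _ => ?_
  rw [pull_single_io]

lemma Theta_inj (Γ : LowerSet (Finset (Fin n))) {d c : ℕ} (hcd : c + d = n) :
    Function.Injective (Theta (k := k) Γ hcd) := by
  rw [injective_iff_map_eq_zero]
  intro β hβ
  have h1 : pull (io k Γ d) _ c β = 0 := by
    rw [pull_io_eq]
    refine Finset.sum_eq_zero fun F _ => ?_
    have h2 := congrFun hβ F.1
    rw [Theta_apply, tcomp_pos, Pi.zero_apply, LinearEquiv.map_eq_zero_iff] at h2
    rw [h2, map_zero]
  obtain ⟨γ, rfl⟩ := (sesK Γ d).les2 c β h1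
  have := lemmaB (k := k) Γ d c (by omega)
  rw [Subsingleton.elim γ 0, map_zero]

open Classical in
lemma pull_single_sum {Γ : LowerSet (Finset (Fin n))} {d c : ℕ}
    (α : ∀ F : Fc Γ d, EX (MvPolynomial (Fin n) k) (TT k F.1) (MvPolynomial (Fin n) k) c) (F : Fc Γ d) :
    pull (LinearMap.single (MvPolynomial (Fin n) k) (fun F : Fc Γ d => TT k F.1) F) _ c
      (∑ F : Fc Γ d, pull (LinearMap.proj F : KK k Γ d →ₗ[_] TT k F.1) _ c (α F)) = α F := by
  rw [map_sum, Finset.sum_eq_single F]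
  · rw [pull_pull, LinearMap.proj_comp_single_same, pull_id]
  · intro G _ hG
    rw [pull_pull, LinearMap.proj_comp_single_ne _ _ _ _ hG, pull_zero]
  · simp

lemma Theta_range (Γ : LowerSet (Finset (Fin n))) {d c : ℕ} (hcd : c + d = n) :
    LinearMap.range (Theta (k := k) Γ hcd) = Wm k Γ d := by
  classical
  apply le_antisymm
  · rintro _ ⟨β, rfl⟩
    rw [mem_Wm]
    refine ⟨fun F hF => by rw [Theta_apply]; exact tcomp_neg _ _ _ hF, ?_⟩
    intro G hG
    subst hG
    by_cases hGΓ : G ∈ Γ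
    · have h1 := key hcd (fun F => pull (mi F) _ c β) ⟨G, hGΓ, rfl⟩ (by change G.card + _ = n; omega)
      rw [← pull_io_eq, SES.del_pull, map_zero, map_zero] at h1
      exact h1.symm
    · refine Finset.sum_eq_zero fun v _ => ?_
      rw [Theta_apply, tcomp_neg, map_zero, smul_zero]
      rintro ⟨h, _⟩
      exact hGΓ (Γ.lower (Finset.subset_insert _ _) h)
  · intro t ht
    let α : ∀ F : Fc Γ d, EX (MvPolynomial (Fin n) k) (TT k F.1) (MvPolynomial (Fin n) k) c :=
      fun F => (psi F.1 c (by have := F.2.2; omega)).symm (t F.1)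
    have hα : tcomp hcd α = t := by
      funext F
      by_cases h : F ∈ Γ ∧ F.card = d
      · rw [tcomp, dif_pos h]; exact LinearEquiv.apply_symm_apply _ _
      · rw [tcomp_neg _ _ _ h, ht.1 F h]
    have hdel : (sesK Γ d).del (MvPolynomial (Fin n) k) c
        (∑ F : Fc Γ d, pull (LinearMap.proj F : KK k Γ d →ₗ[_] TT k F.1) _ c (α F)) = 0 := by
      cases d with
      | zero => 
        have := EX_sk0 (k := k) Γ (c+1)
        exact Subsingleton.elim _ _
      | succ j =>
        have h1 : pull (io k Γ j) _ (c+1) ((sesK Γ (j+1)).del (MvPolynomial (Fin n) k) c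
            (∑ F : Fc Γ (j+1), pull (LinearMap.proj F : KK k Γ (j+1) →ₗ[_] TT k F.1) _ c (α F))) = 0 := by
          rw [pull_io_eq]
          refine Finset.sum_eq_zero fun G _ => ?_
          have hG' : G.1.card + (c+1) = n := by have := G.2.2; omega
          have h2 := key hcd α G hG'
          rw [hα, ht.2 G.1 (by have := G.2.2; omega), LinearEquiv.map_eq_zero_iff] at h2
          rw [h2, map_zero]
        obtain ⟨γ, hγ⟩ := (sesK Γ j).les2 (c+1) _ h1
        have := lemmaB (k := k) Γ j (c+1) (by omega)
        rw [← hγ, Subsingleton.elim γ 0, map_zero]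
    obtain ⟨β, hβ⟩ := (sesK Γ d).les1 c _ hdel
    refine ⟨β, ?_⟩
    rw [Theta_apply, ← hα]
    congr 1
    funext F
    rw [← pull_single_io, hβ, pull_single_sum]

theorem canonical_iso (Γ : LowerSet (Finset (Fin n))) {d c : ℕ} (hcd : c + d = n)
    (hΓ : ∀ F ∈ Γ, F.card ≤ d) :
    Nonempty (extMod (MvPolynomial (Fin n) k) (MvPolynomial (Fin n) k ⧸ mI k Γ) (MvPolynomial (Fin n) k) c
      ≃ₗ[MvPolynomial (Fin n) k] Wm k Γ d) := by
  have hsk : sk Γ (d+1) = Γ := by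
    ext F
    exact ⟨fun h => h.1, fun h => ⟨h, Nat.lt_succ_of_le (hΓ F h)⟩⟩
  have h1 : Nonempty (EX (MvPolynomial (Fin n) k) (Qr k (sk Γ (d+1))) (MvPolynomial (Fin n) k) c
      ≃ₗ[MvPolynomial (Fin n) k] Wm k Γ d) :=
    ⟨LinearEquiv.ofInjective _ (Theta_inj Γ hcd) ≪≫ₗ LinearEquiv.ofEq _ _ (Theta_range Γ hcd)⟩
  rw [hsk] at h1
  obtain ⟨e⟩ := h1
  exact ⟨(extModEquiv _ _ c) ≪≫ₗ e⟩

end TE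

end PieceP3e

section PieceP4a

section TF

open CategoryTheory Abelian

variable {R : Type} [CommRing R]

lemma EX_zero_mod {M A : Type} [AddCommGroup M] [Module R M] [AddCommGroup A] [Module R A]
    [Subsingleton A] (i : ℕ) : Subsingleton (EX R M A i) := by
  refine subsingleton_of_forall_eq 0 fun x => ?_
  have h0 : (𝟙 (ModuleCat.of R A)) = 0 := by
    ext x
    exact Subsingleton.elim (α := A) _ _
  rw [← Abelian.Ext.comp_mk₀_id x, h0, Abelian.Ext.mk₀_zero, Abelian.Ext.comp_zero]

/-- submodule of boundaries -/
def Bsub (C : ℕ → Type) [∀ p, AddCommGroup (C p)] [∀ p, Module R (C p)]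
    (D : ∀ p, C p →ₗ[R] C (p+1)) : ∀ p, Submodule R (C p)
  | 0 => ⊥
  | p+1 => LinearMap.range (D p)

lemma soc_zero {n : ℕ} (x : Fin n → R) {Q : Type} [AddCommGroup Q] [Module R Q]
    (hQ : Subsingleton (EX R (R ⧸ Ideal.span (Set.range x)) Q 0)) (q : Q)
    (hq : ∀ v, x v • x v • q = 0) : q = 0 := by
  classical
  have h1 : ∀ q' : Q, (∀ v, x v • q' = 0) → q' = 0 := by
    intro q' h
    let f : R ⧸ Ideal.span (Set.range x) →ₗ[R] Q :=
      Submodule.liftQ _ (LinearMap.toSpanSingleton R Q q') (by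
        rw [Submodule.span_le]
        rintro _ ⟨v, rfl⟩
        exact h v)
    have h2 := EX_zero_subsingleton hQ f
    have h3 : f (Submodule.Quotient.mk 1) = q' := by
      change (1 : R) • q' = q'
      exact one_smul _ _
    rw [← h3, h2]; rfl
  have hin : ∀ (σ : Finset (Fin n)) (v : Fin n), v ∈ σ → x v • (∏ v ∈ σ, x v) • q = 0 := by
    intro σ v hv
    rw [← Finset.mul_prod_erase σ x hv, mul_comm, mul_smul, smul_comm, hq, smul_zero]
  have key : ∀ m : ℕ, ∀ σ : Finset (Fin n), σ.card + m = n → (∏ v ∈ σ, x v) • q = 0 := by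
    intro m
    induction m with
    | zero =>
      intro σ hσ
      have : σ = Finset.univ := by
        rw [← Finset.card_eq_iff_eq_univ]; simpa using hσ
      apply h1
      intro v
      exact hin σ v (this ▸ Finset.mem_univ v)
    | succ m ih =>
      intro σ hσ
      apply h1
      intro v
      by_cases hv : v ∈ σ
      · exact hin σ v hv
      · rw [smul_smul, ← Finset.prod_insert hv]
        apply ih
        rw [Finset.card_insert_of_notMem hv]; omega
  simpa using key n ∅ (by simp)

theorem exact_lemma {n : ℕ} (x : Fin n → R) (C : ℕ → Type) [∀ p, AddCommGroup (C p)] [∀ p, Module R (C p)]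
    (D : ∀ p, C p →ₗ[R] C (p+1)) (hDD : ∀ p c, D (p+1) (D p c) = 0) (d : ℕ)
    (hE : ∀ p j, j < d → Subsingleton (EX R (R ⧸ Ideal.span (Set.range x)) (C p) j))
    (hT : ∀ p, ∀ z, D p z = 0 → ∀ v, x v • x v • z ∈ Bsub C D p) :
    ∀ p, p < d → ∀ z, D p z = 0 → z ∈ Bsub C D p := by
  have hex : ∀ p, (∀ j, j + p < d → Subsingleton (EX R (R ⧸ Ideal.span (Set.range x)) (C p ⧸ Bsub C D p) j)) →
      p < d → ∀ z, D p z = 0 → z ∈ Bsub C D p := by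
    intro p h hp z hz
    rw [← Submodule.Quotient.mk_eq_zero]
    apply soc_zero x (h 0 (by omega))
    intro v
    rw [← Submodule.Quotient.mk_smul, ← Submodule.Quotient.mk_smul, Submodule.Quotient.mk_eq_zero]
    exact hT p z hz v
  have hmain : ∀ p, (∀ j, j + p < d → Subsingleton (EX R (R ⧸ Ideal.span (Set.range x)) (C p ⧸ Bsub C D p) j)) := by
    intro p
    induction p with
    | zero =>
      intro j hj
      have hs : SES (0 : (Fin 0 → R) →ₗ[R] C 0) (Submodule.mkQ (Bsub C D 0)) := by
        refine ⟨Function.injective_of_subsingleton _, ?_, Submodule.mkQ_surjective _⟩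
        intro y
        rw [Submodule.mkQ_apply, Submodule.Quotient.mk_eq_zero]
        constructor
        · intro h; exact ⟨0, by rw [LinearMap.zero_apply]; exact ((Submodule.mem_bot R).mp h).symm⟩
        · rintro ⟨_, rfl⟩; exact Submodule.zero_mem _
      exact hs.cov_vanish j (hE 0 j (by omega)) (EX_zero_mod _)
    | succ p ih =>
      intro j hj
      have hz := hex p ih (by omega)
      have hle : Bsub C D p ≤ LinearMap.ker (D p) := by
        cases p with
        | zero => exact bot_le
        | succ p => rintro _ ⟨y, rfl⟩; exact hDD p y
      have hs : SES (Submodule.liftQ (Bsub C D p) (D p) hle) (Submodule.mkQ (Bsub C D (p+1))) := by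
        refine ⟨?_, ?_, Submodule.mkQ_surjective _⟩
        · rw [← LinearMap.ker_eq_bot, Submodule.ker_liftQ_eq_bot]
          exact fun z h => hz z h
        · intro y
          rw [Submodule.mkQ_apply, Submodule.Quotient.mk_eq_zero]
          constructor
          · rintro ⟨c, rfl⟩
            exact ⟨Submodule.Quotient.mk c, rfl⟩
          · rintro ⟨c, rfl⟩
            obtain ⟨c, rfl⟩ := Submodule.Quotient.mk_surjective _ c
            exact ⟨c, rfl⟩
      exact hs.cov_vanish j (hE (p+1) j (by omega)) (ih (j+1) (by omega))
  exact fun p => hex p (hmain p)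

end TF

end PieceP4a

section PieceP4b

open MvPolynomial

section TG

variable {k : Type} [Field k] {n : ℕ}

lemma eps_anti {v w : Fin n} {τ : Finset (Fin n)} (hvw : v ≠ w) (hv : v ∈ τ) (hw : w ∈ τ) :
    eps k v τ * eps k w (τ.erase v) = - (eps k w τ * eps k v (τ.erase w)) := by
  have h := eps_comm k hvw (τ := (τ.erase v).erase w) (by simp) (by simp)
  have h1 : insert w ((τ.erase v).erase w) = τ.erase v := Finset.insert_erase (by simp [hw, hvw.symm])
  have h2 : insert v ((τ.erase v).erase w) = τ.erase w := by
    rw [Finset.erase_right_comm]; exact Finset.insert_erase (by simp [hv, hvw])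
  rw [h1, h2, eps_erase_self, eps_erase_self, eps_erase_self, Finset.erase_right_comm, eps_erase_self] at h
  exact h

lemma eps_hom {v w : Fin n} {τ : Finset (Fin n)} (hv : v ∉ τ) (hw : w ∈ τ) :
    eps k v τ * eps k w (insert v τ) = - (eps k w τ * eps k v (τ.erase w)) := by
  have hvw : v ≠ w := by rintro rfl; exact hv hw
  have h := eps_anti (k := k) (τ := insert v τ) hvw (by simp) (by simp [hw])
  rw [Finset.erase_insert hv, eps_insert_self, Finset.erase_insert_of_ne hvw, eps_insert_self] at h
  have h1 := eps_sq k w τ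
  have h2 := eps_sq k w (insert v τ)
  linear_combination (eps k w τ * eps k w (insert v τ)) * h - (eps k v (τ.erase w) * eps k w τ) * h2
    - (eps k v τ * eps k w (insert v τ)) * h1

variable {R : Type} [CommRing R] [Algebra k R]

variable (k) in
/-- big Koszul-type differential -/
def bigD (y : Fin n → R) : (Finset (Fin n) → R) →ₗ[R] (Finset (Fin n) → R) where
  toFun f τ := ∑ v ∈ τ, algebraMap k R (eps k v τ) * y v * f (τ.erase v)
  map_add' f g := by funext τ; simp [mul_add, Finset.sum_add_distrib]
  map_smul' r f := by
    funext τ; simp only [Pi.smul_apply, smul_eq_mul, RingHom.id_apply, Finset.mul_sum]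
    exact Finset.sum_congr rfl fun v _ => by ring

lemma bigD_apply (y : Fin n → R) (f : Finset (Fin n) → R) (τ : Finset (Fin n)) :
    bigD k y f τ = ∑ v ∈ τ, algebraMap k R (eps k v τ) * y v * f (τ.erase v) := rfl

lemma bigD_bigD (y : Fin n → R) (f : Finset (Fin n) → R) : bigD k y (bigD k y f) = 0 := by
  funext τ
  simp only [bigD_apply, Finset.mul_sum, Pi.zero_apply]
  rw [Finset.sum_sigma']
  refine Finset.sum_involution (fun p _ => ⟨p.2, p.1⟩) ?_ ?_ ?_ ?_
  · rintro ⟨v, w⟩ h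
    simp only [Finset.mem_sigma, Finset.mem_erase] at h
    have h1 := congrArg (algebraMap k R) (eps_anti (k := k) (Ne.symm h.2.1) h.1 h.2.2)
    simp only [map_mul, map_neg] at h1
    simp only
    rw [Finset.erase_right_comm (a := w)]
    linear_combination (y v * y w * f ((τ.erase v).erase w)) * h1
  · rintro ⟨v, w⟩ h _ he
    simp only [Finset.mem_sigma, Finset.mem_erase] at h
    simp only [Sigma.mk.injEq] at he
    exact h.2.1 he.1
  · rintro ⟨v, w⟩ h
    simp only [Finset.mem_sigma, Finset.mem_erase] at h ⊢
    exact ⟨h.2.2, h.2.1.symm, h.1⟩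
  · rintro ⟨v, w⟩ h; rfl

variable (k) in
/-- contraction -/
def iot (v : Fin n) (f : Finset (Fin n) → R) : Finset (Fin n) → R := fun τ =>
  if v ∈ τ then 0 else algebraMap k R (eps k v τ) * f (insert v τ)

lemma bigD_homotopy (y : Fin n → R) (f : Finset (Fin n) → R) (hf : bigD k y f = 0) (v : Fin n) :
    bigD k y (iot k v f) = y v • f := by
  funext τ
  rw [bigD_apply, Pi.smul_apply, smul_eq_mul]
  by_cases hv : v ∈ τ
  · rw [Finset.sum_eq_single v]
    · rw [iot, if_neg (Finset.notMem_erase v τ), Finset.insert_erase hv, eps_erase_self]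
      have := congrArg (algebraMap k R) (eps_sq k v τ)
      rw [map_mul, map_one] at this
      linear_combination (y v * f τ) * this
    · intro w hw hwv
      rw [iot, if_pos (by simp [hv, hwv.symm]), mul_zero]
    · intro h; exact absurd hv h
  · have h1 := congrFun hf (insert v τ)
    rw [bigD_apply, Finset.sum_insert hv, Finset.erase_insert hv, eps_insert_self, Pi.zero_apply] at h1
    have h2 := congrArg (fun t => algebraMap k R (eps k v τ) * t) h1
    simp only [mul_add, mul_zero, Finset.mul_sum] at h2
    have h3 : ∑ w ∈ τ, algebraMap k R (eps k w τ) * y w * iot k v f (τ.erase w) =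
        - ∑ w ∈ τ, algebraMap k R (eps k v τ) * (algebraMap k R (eps k w (insert v τ)) * y w *
          f ((insert v τ).erase w)) := by
      rw [← Finset.sum_neg_distrib]
      refine Finset.sum_congr rfl fun w hw => ?_
      have hvw : v ≠ w := by rintro rfl; exact hv hw
      rw [iot, if_neg (by simp [hv]), Finset.erase_insert_of_ne hvw]
      have h4 := congrArg (algebraMap k R) (eps_hom (k := k) hv hw)
      simp only [map_mul, map_neg] at h4
      linear_combination (y w * f (insert v (τ.erase w))) * h4
    rw [h3]
    have := congrArg (algebraMap k R) (eps_sq k v τ)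
    rw [map_mul, map_one] at this
    linear_combination (y v * f τ) * this - h2

variable (n R) in
/-- graded piece -/
abbrev Cg (p : ℕ) : Type := {σ : Finset (Fin n) // σ.card = p} → R

/-- extension by zero -/
def exz (p : ℕ) : Cg n R p →ₗ[R] (Finset (Fin n) → R) where
  toFun f σ := if h : σ.card = p then f ⟨σ, h⟩ else 0
  map_add' f g := by
    funext σ; simp only [Pi.add_apply]; split_ifs <;> simp
  map_smul' r f := by
    funext σ; simp only [Pi.smul_apply, RingHom.id_apply]; split_ifs <;> simp

lemma exz_pos {p : ℕ} (f : Cg n R p) {σ : Finset (Fin n)} (h : σ.card = p) : exz p f σ = f ⟨σ, h⟩ :=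
  dif_pos h
lemma exz_neg {p : ℕ} (f : Cg n R p) {σ : Finset (Fin n)} (h : σ.card ≠ p) : exz p f σ = 0 :=
  dif_neg h

/-- restriction -/
def resz (p : ℕ) : (Finset (Fin n) → R) →ₗ[R] Cg n R p where
  toFun f σ := f σ.1
  map_add' _ _ := rfl
  map_smul' _ _ := rfl

lemma exz_resz {p : ℕ} (f : Finset (Fin n) → R) (hf : ∀ σ, σ.card ≠ p → f σ = 0) :
    exz p (resz p f) = f := by
  funext σ
  by_cases h : σ.card = p
  · rw [exz_pos _ h]; rfl
  · rw [exz_neg _ h, hf σ h]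

lemma resz_exz {p : ℕ} (f : Cg n R p) : resz p (exz p f) = f := by
  funext σ
  change exz p f σ.1 = _
  rw [exz_pos _ σ.2]

variable (k) in
/-- graded differential -/
def Dg (y : Fin n → R) (p : ℕ) : Cg n R p →ₗ[R] Cg n R (p+1) := resz (p+1) ∘ₗ bigD k y ∘ₗ exz p

lemma exz_Dg (y : Fin n → R) (p : ℕ) (f : Cg n R p) : exz (p+1) (Dg k y p f) = bigD k y (exz p f) := by
  change exz (p+1) (resz (p+1) (bigD k y (exz p f))) = _
  refine exz_resz _ fun σ hσ => ?_
  rw [bigD_apply]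
  refine Finset.sum_eq_zero fun v hv => ?_
  rw [exz_neg, mul_zero]
  rw [Finset.card_erase_of_mem hv]
  have : 0 < σ.card := Finset.card_pos.mpr ⟨v, hv⟩
  omega

lemma Dg_exact (x : Fin n → R) (d : ℕ)
    (hCM : ∀ j, j < d → Subsingleton (EX R (R ⧸ Ideal.span (Set.range x)) R j))
    (p : ℕ) (hp : p < d) (z : Cg n R p) (hz : Dg k (fun v => x v * x v) p z = 0) :
    z ∈ Bsub (Cg n R) (Dg k (fun v => x v * x v)) p := by
  refine exact_lemma x (Cg n R) (Dg k (fun v => x v * x v)) ?_ d ?_ ?_ p hp z hz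
  · intro p c
    rw [← resz_exz (Dg k _ (p+1) _), exz_Dg, exz_Dg, bigD_bigD, map_zero]
  · intro p j hj
    exact EX_pi_subsingleton j (hCM j hj)
  · intro p z hz v
    have hz' : bigD k (fun v => x v * x v) (exz p z) = 0 := by
      rw [← exz_Dg, hz, map_zero]
    have h1 := bigD_homotopy _ _ hz' v
    have h2 : x v • x v • z = resz p (bigD k (fun v => x v * x v) (iot k v (exz p z))) := by
      rw [h1, map_smul, resz_exz, smul_smul]
    rw [h2]
    cases p with
    | zero =>
      have : iot k v (exz 0 z) = 0 := by
        funext τ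
        rw [iot]
        split_ifs
        · rfl
        · rw [exz_neg, mul_zero]; rfl
          simp
      rw [this, map_zero, map_zero]
      exact Submodule.zero_mem _
    | succ p =>
      refine ⟨resz p (iot k v (exz (p+1) z)), ?_⟩
      change resz _ (bigD k _ (exz p (resz p _))) = _
      rw [exz_resz]
      intro σ hσ
      rw [iot]
      split_ifs with hv
      · rfl
      · rw [exz_neg, mul_zero]
        rw [Finset.card_insert_of_notMem hv]
        omega

lemma quotMax_eq (Γ : LowerSet (Finset (Fin n))) : quotMax k (mI k Γ) =
    Ideal.span (Set.range fun v : Fin n => (xm Γ (Finsupp.single v 1) : Qr k Γ)) := rfl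

/-- exponent -/
noncomputable def dex (σ τ : Finset (Fin n)) : Fin n →₀ ℕ := 2 • ind σ - ind τ

lemma dex_support {σ τ : Finset (Fin n)} (h : τ ⊆ σ) : (dex σ τ).support = σ := by
  ext i
  have := @h i
  simp only [dex, Finsupp.mem_support_iff, Finsupp.tsub_apply, Finsupp.smul_apply, ind_apply, smul_eq_mul]
  by_cases h1 : i ∈ σ <;> by_cases h2 : i ∈ τ <;> simp_all

lemma dex_erase {σ τ : Finset (Fin n)} {v : Fin n} (hv : v ∈ σ) (hvt : v ∉ τ) :
    dex (σ.erase v) τ + Finsupp.single v 2 = dex σ τ := by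
  ext i
  simp only [dex, Finsupp.add_apply, Finsupp.tsub_apply, Finsupp.smul_apply, ind_apply, smul_eq_mul, 
    Finsupp.single_apply, Finset.mem_erase]
  by_cases h : v = i
  · subst h; simp [hv, hvt]
  · simp [h, Ne.symm h]

lemma algMap_mul (Γ : LowerSet (Finset (Fin n))) (c : k) (q : Qr k Γ) : algebraMap k (Qr k Γ) c * q = c • q :=
  (Algebra.smul_def c q).symm

theorem reisner (Γ : LowerSet (Finset (Fin n))) (d : ℕ)
    (hCM : ∀ j, j < d → Subsingleton (EX (Qr k Γ) (Qr k Γ ⧸ quotMax k (mI k Γ)) (Qr k Γ) j))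
    (τ : Finset (Fin n)) (p : ℕ) (hp : p < d) (f : Finset (Fin n) → k)
    (hf : ∀ σ ∈ Γ, σ.card = p+1 → τ ⊆ σ → ∑ v ∈ σ \ τ, eps k v σ * f (σ.erase v) = 0) :
    ∃ g : Finset (Fin n) → k, ∀ σ ∈ Γ, σ.card = p → τ ⊆ σ →
      f σ = ∑ v ∈ σ \ τ, eps k v σ * g (σ.erase v) := by
  classical
  rw [quotMax_eq] at hCM
  set x : Fin n → Qr k Γ := fun v : Fin n => (xm Γ (Finsupp.single v 1) : Qr k Γ) with hx
  have hxx : ∀ v, x v * x v = xm Γ (Finsupp.single v 2) := by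
    intro v; rw [hx]; simp only; rw [xm_mul, ← Finsupp.single_add]
  let Fb : Finset (Fin n) → Qr k Γ := fun σ => if τ ⊆ σ then f σ • xm Γ (dex σ τ) else 0
  let F : Cg n (Qr k Γ) p := resz p Fb
  have hDF : Dg k (fun v => x v * x v) p F = 0 := by
    funext σ
    change bigD k _ (exz p F) σ.1 = 0
    obtain ⟨σ, hσ⟩ := σ
    simp only [bigD_apply]
    have hterm : ∀ v ∈ σ, algebraMap k (Qr k Γ) (eps k v σ) * (x v * x v) * exz p F (σ.erase v) = 
        if v ∈ σ \ τ ∧ τ ⊆ σ then (eps k v σ * f (σ.erase v)) • (xm Γ (dex σ τ) : Qr k Γ) else 0 := by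
      intro v hv
      rw [exz_pos _ (by rw [Finset.card_erase_of_mem hv]; omega), mul_assoc, algMap_mul]
      change eps k v σ • (x v * x v * (if τ ⊆ σ.erase v then f (σ.erase v) • xm Γ (dex (σ.erase v) τ) else 0)) = _
      by_cases h : v ∈ σ \ τ ∧ τ ⊆ σ
      · have h' := h
        rw [Finset.mem_sdiff] at h
        rw [if_pos (Finset.subset_erase.mpr ⟨h.2, h.1.2⟩), if_pos h',
          mul_smul_comm, smul_smul, hxx, xm_mul, add_comm, dex_erase hv h.1.2]
      · rw [if_neg h, if_neg, mul_zero, smul_zero]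
        rw [Finset.subset_erase]
        rintro ⟨h1, h2⟩
        exact h ⟨Finset.mem_sdiff.mpr ⟨hv, h2⟩, h1⟩
    rw [Finset.sum_congr rfl hterm]
    by_cases hτ : τ ⊆ σ
    · by_cases hΓ : σ ∈ Γ
      · have h1 := hf σ hΓ hσ hτ
        have h2 : ∀ v ∈ σ, (if v ∈ σ \ τ ∧ τ ⊆ σ then (eps k v σ * f (σ.erase v)) • (xm Γ (dex σ τ) : Qr k Γ) else 0)
          = if v ∉ τ then (eps k v σ * f (σ.erase v)) • (xm Γ (dex σ τ) : Qr k Γ) else 0 := by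
          intro v hv; simp [hv, hτ]
        rw [Finset.sum_congr rfl h2, ← Finset.sum_filter, ← Finset.sdiff_eq_filter, ← Finset.sum_smul, h1, zero_smul]
      · have h0 : (xm Γ (dex σ τ) : Qr k Γ) = 0 := xm_eq_zero (by rw [dex_support hτ]; exact hΓ)
        simp [h0]
    · simp [hτ]
  have hmem := Dg_exact x d hCM p hp F hDF
  cases p with
  | zero =>
    refine ⟨0, fun σ hσ hc hτ => ?_⟩
    have hF : F = 0 := (Submodule.mem_bot _).mp hmem
    have h1 : (if τ ⊆ σ then f σ • (xm Γ (dex σ τ) : Qr k Γ) else 0) = 0 := congrFun hF ⟨σ, hc⟩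
    rw [if_pos hτ] at h1
    have h2 := congrArg (qc k Γ (dex σ τ)) h1
    rw [map_smul, qc_xm, if_pos ⟨by rw [dex_support hτ]; exact hσ, rfl⟩, map_zero] at h2
    simpa using h2
  | succ p =>
    obtain ⟨G, hG⟩ := hmem
    refine ⟨fun σ => qc k Γ (dex σ τ) (exz p G σ), fun σ hσ hc hτ => ?_⟩
    have h1 : bigD k (fun v => x v * x v) (exz p G) σ = (if τ ⊆ σ then f σ • (xm Γ (dex σ τ) : Qr k Γ) else 0) := 
      congrFun hG ⟨σ, hc⟩
    rw [if_pos hτ, bigD_apply] at h1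
    have hs : (dex σ τ).support ∈ Γ := by rw [dex_support hτ]; exact hσ
    have h2 := congrArg (qc k Γ (dex σ τ)) h1
    rw [map_smul, qc_xm, if_pos ⟨hs, rfl⟩, map_sum, smul_eq_mul, mul_one] at h2
    rw [← h2, Finset.sdiff_eq_filter, Finset.sum_filter]
    refine Finset.sum_congr rfl fun v hv => ?_
    rw [mul_assoc, algMap_mul, map_smul, hxx, smul_eq_mul, xm, ← smul_eq_mk_mul]
    by_cases hvt : v ∉ τ
    · rw [if_pos hvt, ← dex_erase hv hvt, qc_monomial_smul_add _ _ (by rw [dex_erase hv hvt]; exact hs), one_mul]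
    · rw [if_neg hvt, qc_monomial_smul, if_neg, mul_zero]
      rintro ⟨h, _⟩
      have := h v
      push Not at hvt
      simp [dex, hv, hvt] at this

end TG

end PieceP4b

section PieceP4c

section TH

variable {k : Type} [Field k] {n : ℕ}

variable (k) in
/-- Reisner criterion, cochain form -/
def Reis (Γ : LowerSet (Finset (Fin n))) (d : ℕ) : Prop :=
  ∀ (τ : Finset (Fin n)) (p : ℕ), p < d → ∀ (f : Finset (Fin n) → k),
    (∀ σ ∈ Γ, σ.card = p+1 → τ ⊆ σ → ∑ v ∈ σ \ τ, eps k v σ * f (σ.erase v) = 0) →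
    ∃ g : Finset (Fin n) → k, ∀ σ ∈ Γ, σ.card = p → τ ⊆ σ →
      f σ = ∑ v ∈ σ \ τ, eps k v σ * g (σ.erase v)

lemma exists_insert_of_card {σ τ : Finset (Fin n)} (h : σ ⊆ τ) (hc : τ.card = σ.card + 1) :
    ∃ v, v ∉ σ ∧ τ = insert v σ := by
  have hcard : (τ \ σ).card = 1 := by
    rw [Finset.card_sdiff_of_subset h, hc]; omega
  obtain ⟨v, hv⟩ := Finset.card_eq_one.mp hcard
  have hvF : v ∈ τ \ σ := by rw [hv]; simp
  refine ⟨v, (Finset.mem_sdiff.mp hvF).2, ?_⟩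
  rw [← Finset.sdiff_union_of_subset h, hv]; rfl

lemma insert_sdiff_self_eq {σ : Finset (Fin n)} {v : Fin n} (hv : v ∉ σ) : insert v σ \ σ = {v} := by
  ext i
  simp only [Finset.mem_sdiff, Finset.mem_insert, Finset.mem_singleton]
  constructor
  · rintro ⟨h | h, h'⟩
    · exact h
    · exact absurd h h'
  · rintro rfl; exact ⟨Or.inl rfl, hv⟩

variable {Γ : LowerSet (Finset (Fin n))} {d : ℕ}

lemma purity (hR : Reis k Γ d) {σ : Finset (Fin n)} (hσ : σ ∈ Γ) (hc : σ.card < d) :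
    ∃ v, v ∉ σ ∧ insert v σ ∈ Γ := by
  by_contra hn
  push Not at hn
  obtain ⟨g, hg⟩ := hR σ σ.card hc (fun _ => 1) (by
    intro σ' h1 h2 h3
    obtain ⟨v, hv, rfl⟩ := exists_insert_of_card h3 h2
    exact absurd h1 (hn v hv))
  have := hg σ hσ rfl (Finset.Subset.refl _)
  simp at this

lemma purity_full (hR : Reis k Γ d) : ∀ (m : ℕ) {σ : Finset (Fin n)} (_ : σ ∈ Γ) (_ : σ.card + m = d),
    ∃ F ∈ Γ, F.card = d ∧ σ ⊆ F := by
  intro m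
  induction m with
  | zero => intro σ hσ hc; exact ⟨σ, hσ, hc, Finset.Subset.refl _⟩
  | succ m ih =>
    intro σ hσ hc
    obtain ⟨v, hv, h⟩ := purity hR hσ (by omega)
    obtain ⟨F, h1, h2, h3⟩ := ih h (by rw [Finset.card_insert_of_notMem hv]; omega)
    exact ⟨F, h1, h2, (Finset.subset_insert _ _).trans h3⟩

lemma purity_facet (hR : Reis k Γ d) (hΓ : ∀ F ∈ Γ, F.card ≤ d) {σ : Finset (Fin n)} (hσ : σ ∈ Γ) :
    ∃ F ∈ Γ, F.card = d ∧ σ ⊆ F :=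
  purity_full hR (d - σ.card) hσ (by have := hΓ σ hσ; omega)

lemma link_conn (hR : Reis k Γ d) {σ : Finset (Fin n)} (hc : σ.card + 2 ≤ d) (U : Set (Fin n))
    (u : Fin n) (hu : u ∈ U) (hu' : u ∉ σ ∧ insert u σ ∈ Γ)
    (hU : ∀ v w, v ∈ U → v ∉ σ → w ∉ σ → v ≠ w → insert w (insert v σ) ∈ Γ → w ∈ U)
    (v : Fin n) (hv : v ∉ σ) (hv' : insert v σ ∈ Γ) : v ∈ U := by
  classical
  let f : Finset (Fin n) → k := fun ρ => ∑ v ∈ ρ \ σ, eps k v ρ * if v ∈ U then 1 else 0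
  have hf : ∀ v, v ∉ σ → f (insert v σ) = eps k v (insert v σ) * if v ∈ U then 1 else 0 := by
    intro v hv
    simp only [f]
    rw [insert_sdiff_self_eq hv, Finset.sum_singleton]
  obtain ⟨g, hg⟩ := hR σ (σ.card + 1) (by omega) f (by
    intro σ' h1 h2 h3
    obtain ⟨ρ, hρ, hρ', hρc⟩ := Finset.exists_subsuperset_card_eq h3 (n := σ.card + 1) (by omega) (by omega)
    obtain ⟨v, hv, rfl⟩ := exists_insert_of_card hρ (by omega)
    obtain ⟨w, hw, rfl⟩ := exists_insert_of_card hρ' (by omega)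
    rw [Finset.mem_insert, not_or] at hw
    have hs : insert w (insert v σ) \ σ = {w, v} := by
      rw [Finset.insert_sdiff_of_notMem _ hw.2, insert_sdiff_self_eq hv]
    have e1 : (insert w (insert v σ)).erase w = insert v σ := Finset.erase_insert (by simp [hw])
    have e2 : (insert w (insert v σ)).erase v = insert w σ := by
      rw [Finset.insert_comm]; exact Finset.erase_insert (by simp [hv, Ne.symm hw.1])
    rw [hs, Finset.sum_pair hw.1, e1, e2, hf v hv, hf w hw.2]
    have hiff : (w ∈ U) = (v ∈ U) := by
      refine propext ⟨fun h => hU w v h hw.2 hv hw.1 (by rw [Finset.insert_comm]; exact h1), 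
        fun h => hU v w h hv hw.2 (Ne.symm hw.1) h1⟩
    have h4 := eps_anti (k := k) (τ := insert w (insert v σ)) hw.1 (by simp) (by simp)
    rw [e1, e2] at h4
    simp only [hiff]
    linear_combination (if v ∈ U then (1:k) else 0) * h4)
  have key : ∀ v, v ∉ σ → insert v σ ∈ Γ → (if v ∈ U then (1:k) else 0) = g σ := by
    intro v hv hv'
    have h1 := hg _ hv' (Finset.card_insert_of_notMem hv) (Finset.subset_insert _ _)
    rw [hf v hv, insert_sdiff_self_eq hv, Finset.sum_singleton, Finset.erase_insert hv] at h1
    exact mul_left_cancel₀ (eps_ne_zero k _ _) h1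
  by_contra hvU
  have h1 := key u hu'.1 hu'.2
  rw [← key v hv hv', if_pos hu, if_neg hvU] at h1
  exact one_ne_zero h1

end TH

end PieceP4c

section PieceP5

open MvPolynomial

section TI

variable {k : Type} [Field k] {n : ℕ}

lemma kill_mod (F : Finset (Fin n)) (Q : Ideal (MvPolynomial (Fin n) k)) (hQ : ∀ i ∉ F, X i ∈ Q)
    (p : MvPolynomial (Fin n) k) :
    rename (Subtype.val : F → Fin n) (killCompl Subtype.val_injective p) ∈ Q ↔ p ∈ Q := by
  have h : ((Ideal.Quotient.mkₐ k Q).comp ((rename (Subtype.val : F → Fin n)).comp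
      (killCompl Subtype.val_injective))) = Ideal.Quotient.mkₐ k Q := by
    apply algHom_ext
    intro i
    by_cases hi : i ∈ F
    · have : (X i : MvPolynomial (Fin n) k) = rename (Subtype.val : F → Fin n) (X ⟨i, hi⟩) := by
        rw [rename_X]
      simp only [AlgHom.comp_apply]
      rw [this, killCompl_rename_app]
    · simp only [AlgHom.comp_apply]
      have : killCompl (R := k) (Subtype.val_injective : Function.Injective (Subtype.val : F → Fin n)) (X i) = 0 := by
        rw [killCompl, aeval_X, dif_neg]
        simpa using hi
      rw [this, map_zero, map_zero]
      symm
      exact Ideal.Quotient.eq_zero_iff_mem.mpr (hQ i hi)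
  have h1 := AlgHom.congr_fun h p
  rw [← Ideal.Quotient.eq_zero_iff_mem, ← Ideal.Quotient.eq_zero_iff_mem (I := Q) (a := p)]
  change _ = Ideal.Quotient.mk Q p at h1
  rw [← h1]
  rfl

lemma dim_poly (F : Finset (Fin n)) : ringKrullDim (MvPolynomial F k) = (F.card : WithBot (WithTop ℕ)) := by
  rw [MvPolynomial.ringKrullDim_of_isNoetherianRing, ringKrullDim_eq_zero_of_field, zero_add]
  simp
  rfl

theorem krull_dim (Γ : LowerSet (Finset (Fin n))) (d : ℕ) (hΓ : ∀ F ∈ Γ, F.card ≤ d)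
    (hF : ∃ F ∈ Γ, F.card = d) : ringKrullDim (Qr k Γ) = (d : WithBot (WithTop ℕ)) := by
  classical
  apply le_antisymm
  · rw [ringKrullDim, Order.krullDim]
    apply iSup_le
    intro l
    let Q : Fin (l.length + 1) → Ideal (MvPolynomial (Fin n) k) := fun j =>
      (l j).asIdeal.comap (Ideal.Quotient.mk (mI k Γ))
    have hQm : StrictMono Q := by
      intro a b hab
      have h1 : (l a).asIdeal < (l b).asIdeal := l.strictMono hab
      exact lt_of_le_of_ne (Ideal.comap_mono h1.le) fun h =>
        h1.ne (Ideal.comap_injective_of_surjective _ Ideal.Quotient.mk_surjective h)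
    have hQp : ∀ j, (Q j).IsPrime := fun j => Ideal.IsPrime.comap _
    let F : Finset (Fin n) := Finset.univ.filter fun i => X i ∉ Q 0
    have hFΓ : F ∈ Γ := by
      by_contra h
      have h1 : (∏ i ∈ F, (X i : MvPolynomial (Fin n) k)) ∈ Q 0 := by
        rw [prod_X_eq]
        change Ideal.Quotient.mk (mI k Γ) _ ∈ (l 0).asIdeal
        rw [Ideal.Quotient.eq_zero_iff_mem.mpr (monomial_mem_mI k 1 (by rw [ind_support]; exact h))]
        exact Ideal.zero_mem _
      obtain ⟨i, hi, hi'⟩ := ((hQp 0).prod_mem_iff).mp h1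
      exact (Finset.mem_filter.mp hi).2 hi'
    have hX : ∀ j, ∀ i ∉ F, X i ∈ Q j := by
      intro j i hi
      apply hQm.monotone (Fin.zero_le j)
      by_contra h
      exact hi (Finset.mem_filter.mpr ⟨Finset.mem_univ _, h⟩)
    let L : LTSeries (PrimeSpectrum (MvPolynomial F k)) := LTSeries.mk l.length
      (fun j => ⟨(Q j).comap (rename (Subtype.val : F → Fin n)).toRingHom, Ideal.IsPrime.comap _⟩) (by
        intro a b hab
        change (Q a).comap _ < (Q b).comap _
        refine lt_of_le_of_ne (Ideal.comap_mono (hQm hab).le) fun h => (hQm hab).not_ge ?_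
        intro p hp
        rw [← kill_mod F (Q b) (hX b)] at hp
        rw [← kill_mod F (Q a) (hX a)]
        have h2 : killCompl Subtype.val_injective p ∈ (Q b).comap (rename (Subtype.val : F → Fin n)).toRingHom := hp
        rw [← h] at h2
        exact h2)
    have h1 : (L.length : WithBot (WithTop ℕ)) ≤ ringKrullDim (MvPolynomial F k) := by
      rw [ringKrullDim, Order.krullDim]
      exact le_iSup (fun p : LTSeries (PrimeSpectrum (MvPolynomial F k)) => (p.length : WithBot (WithTop ℕ))) L
    rw [dim_poly] at h1
    refine h1.trans ?_
    exact_mod_cast hΓ F hFΓ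
  · obtain ⟨F, hFΓ, rfl⟩ := hF
    rw [← dim_poly (k := k)]
    refine ringKrullDim_le_of_surjective (Ideal.Quotient.lift (mI k Γ)
      (killCompl (R := k) (Subtype.val_injective : Function.Injective (Subtype.val : F → Fin n))).toRingHom ?_) ?_
    · intro p hp
      change killCompl (R := k) (Subtype.val_injective : Function.Injective (Subtype.val : F → Fin n)) p = 0
      ext s
      rw [coeff_killCompl, coeff_zero]
      apply hp
      refine Γ.lower ?_ hFΓ
      intro i hi
      have := Finsupp.mapDomain_support hi
      simp only [Finset.mem_image] at this
      obtain ⟨j, _, rfl⟩ := this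
      exact j.2
    · apply Ideal.Quotient.lift_surjective_of_surjective
      intro p
      exact ⟨rename Subtype.val p, killCompl_rename_app _ p⟩

end TI

end PieceP5

section PieceP6a

open MvPolynomial

section TJ

variable {k : Type} [Field k] {n : ℕ}

variable (k) in
/-- relative top cycles -/
def Cyc (Γ : LowerSet (Finset (Fin n))) (d : ℕ) (σ : Finset (Fin n)) : Submodule k (Finset (Fin n) → k) where
  carrier := {z | (∀ F, ¬ (F ∈ Γ ∧ F.card = d ∧ σ ⊆ F) → z F = 0) ∧
    ∀ G : Finset (Fin n), G.card + 1 = d → σ ⊆ G → ∑ v ∈ Gᶜ, eps k v G * z (insert v G) = 0}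
  zero_mem' := ⟨fun _ _ => rfl, fun G _ _ => by simp⟩
  add_mem' := by
    rintro s t ⟨h1, h2⟩ ⟨h3, h4⟩
    refine ⟨fun F hF => by rw [Pi.add_apply, h1 F hF, h3 F hF, add_zero], fun G hG hs => ?_⟩
    simp only [Pi.add_apply, mul_add, Finset.sum_add_distrib, h2 G hG hs, h4 G hG hs, add_zero]
  smul_mem' := by
    rintro c t ⟨h1, h2⟩
    refine ⟨fun F hF => by rw [Pi.smul_apply, h1 F hF, smul_zero], fun G hG hs => ?_⟩
    have : ∀ v ∈ Gᶜ, eps k v G * (c • t) (insert v G) = c * (eps k v G * t (insert v G)) := by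
      intro v _; rw [Pi.smul_apply, smul_eq_mul]; ring
    rw [Finset.sum_congr rfl this, ← Finset.mul_sum, h2 G hG hs, mul_zero]

variable {Γ : LowerSet (Finset (Fin n))} {d : ℕ}

lemma mem_Cyc {σ : Finset (Fin n)} {z : Finset (Fin n) → k} : z ∈ Cyc k Γ d σ ↔
    (∀ F, ¬ (F ∈ Γ ∧ F.card = d ∧ σ ⊆ F) → z F = 0) ∧
    ∀ G : Finset (Fin n), G.card + 1 = d → σ ⊆ G → ∑ v ∈ Gᶜ, eps k v G * z (insert v G) = 0 := Iff.rfl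

lemma Cyc_ne {σ F : Finset (Fin n)} {z : Finset (Fin n) → k} (hz : z ∈ Cyc k Γ d σ) (h : z F ≠ 0) :
    F ∈ Γ ∧ F.card = d ∧ σ ⊆ F := by
  by_contra hn; exact h (hz.1 F hn)

/-- restriction -/
def rs (σ : Finset (Fin n)) (z : Finset (Fin n) → k) : Finset (Fin n) → k := fun F => if σ ⊆ F then z F else 0

lemma rs_mem {σ σ' : Finset (Fin n)} (h : σ ⊆ σ') {z : Finset (Fin n) → k} (hz : z ∈ Cyc k Γ d σ) :
    rs σ' z ∈ Cyc k Γ d σ' := by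
  refine ⟨fun F hF => ?_, fun G hG hs => ?_⟩
  · rw [rs]
    split_ifs with h1
    · exact hz.1 F fun h2 => hF ⟨h2.1, h2.2.1, h1⟩
    · rfl
  · rw [← hz.2 G hG (h.trans hs)]
    refine Finset.sum_congr rfl fun v _ => ?_
    rw [rs, if_pos (hs.trans (Finset.subset_insert _ _))]

/-- homogeneous elements -/
noncomputable def hh (c : Fin n →₀ ℕ) (z : Finset (Fin n) → k) : (F : Finset (Fin n)) → TT k F :=
  fun F => (C (z F) : MvPolynomial (Fin n) k) • xm (LowerSet.Iic F) c

lemma hh_apply (c : Fin n →₀ ℕ) (z : Finset (Fin n) → k) (F : Finset (Fin n)) :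
    hh c z F = (C (z F) : MvPolynomial (Fin n) k) • xm (LowerSet.Iic F) c := rfl

lemma hh_add (c : Fin n →₀ ℕ) (z z' : Finset (Fin n) → k) : hh c (z + z') = hh c z + hh c z' := by
  funext F; simp only [hh, Pi.add_apply, C_add, add_smul]

lemma hh_smul (c : Fin n →₀ ℕ) (r : k) (z : Finset (Fin n) → k) :
    hh c (r • z) = (C r : MvPolynomial (Fin n) k) • hh c z := by
  funext F; simp only [hh, Pi.smul_apply, smul_eq_mul, C_mul, mul_smul]

lemma hh_congr (c : Fin n →₀ ℕ) {z z' : Finset (Fin n) → k} (h : ∀ F, c.support ⊆ F → z F = z' F) :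
    hh c z = hh c z' := by
  funext F
  by_cases hF : c.support ⊆ F
  · rw [hh, hh, h F hF]
  · have : (xm (LowerSet.Iic F) c : TT k F) = 0 := xm_eq_zero hF
    rw [hh, hh, this, smul_zero, smul_zero]

lemma hh_zero (c : Fin n →₀ ℕ) : hh c (0 : Finset (Fin n) → k) = 0 := by
  funext F; simp [hh]

lemma monomial_hh (b c : Fin n →₀ ℕ) (r : k) (z : Finset (Fin n) → k) :
    (monomial b r : MvPolynomial (Fin n) k) • hh c z = hh (b + c) (r • z) := by
  funext F
  have h1 : (monomial b r : MvPolynomial (Fin n) k) = C r * monomial b 1 := by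
    rw [C_mul_monomial, mul_one]
  have h2 : (monomial b 1 : MvPolynomial (Fin n) k) • (xm (LowerSet.Iic F) c : TT k F) = xm (LowerSet.Iic F) (b + c) := by
    rw [smul_eq_mk_mul]; exact xm_mul _ _
  rw [Pi.smul_apply, hh, hh, h1, mul_smul, smul_comm (monomial b 1), h2, Pi.smul_apply, smul_eq_mul, C_mul, mul_smul]

lemma C_smul_eq {Γ : LowerSet (Finset (Fin n))} (r : k) (q : Qr k Γ) :
    (C r : MvPolynomial (Fin n) k) • q = r • q := by
  rw [smul_eq_mk_mul]
  exact algMap_mul Γ r q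

lemma hh_mem {c : Fin n →₀ ℕ} {z : Finset (Fin n) → k} (hz : z ∈ Cyc k Γ d c.support) :
    hh c z ∈ Wm k Γ d := by
  rw [mem_Wm]
  refine ⟨fun F hF => ?_, fun G hG => ?_⟩
  · rw [hh, hz.1 F (fun h => hF ⟨h.1, h.2.1⟩), C_0, zero_smul]
  · have : ∀ v ∈ Gᶜ, (C (eps k v G) : MvPolynomial (Fin n) k) • pr (insert_Iic G v) (hh c z (insert v G)) =
        (eps k v G * z (insert v G)) • (xm (LowerSet.Iic G) c : TT k G) := by
      intro v _
      rw [hh, map_smul, pr_xm, C_smul_eq, C_smul_eq, smul_smul]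
    rw [Finset.sum_congr rfl this, ← Finset.sum_smul]
    by_cases hs : c.support ⊆ G
    · rw [hz.2 G hG hs, zero_smul]
    · have h0 : (xm (LowerSet.Iic G) c : TT k G) = 0 := xm_eq_zero hs
      rw [h0, smul_zero]

/-- coefficient functions -/
noncomputable def cof (c : Fin n →₀ ℕ) (t : (F : Finset (Fin n)) → TT k F) : Finset (Fin n) → k :=
  fun F => qc k (LowerSet.Iic F) c (t F)

lemma cof_mem (c : Fin n →₀ ℕ) {t : (F : Finset (Fin n)) → TT k F} (ht : t ∈ Wm k Γ d) :
    cof c t ∈ Cyc k Γ d c.support := by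
  rw [mem_Wm] at ht
  refine ⟨fun F hF => ?_, fun G hG hs => ?_⟩
  · by_cases h : c.support ⊆ F
    · rw [cof, ht.1 F (fun h1 => hF ⟨h1.1, h1.2, h⟩), map_zero]
    · exact qc_of_not_mem h _
  · have h1 := congrArg (qc k (LowerSet.Iic G) c) (ht.2 G hG)
    rw [map_sum, map_zero] at h1
    rw [← h1]
    refine Finset.sum_congr rfl fun v _ => ?_
    classical
    rw [C_smul_eq, map_smul, qc_pr, if_pos (show c.support ∈ LowerSet.Iic G from hs)]; rfl

lemma hh_decomp (t : (F : Finset (Fin n)) → TT k F) :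
    ∃ s : Finset (Fin n →₀ ℕ), t = ∑ c ∈ s, hh c (cof c t) := by
  classical
  choose s hs1 hs2 hs3 using fun F => Qr_expand (t F)
  refine ⟨Finset.univ.biUnion s, ?_⟩
  funext F
  rw [Finset.sum_apply]
  conv_lhs => rw [hs2 F]
  refine Finset.sum_subset (Finset.subset_biUnion_of_mem s (Finset.mem_univ F)) fun a _ ha => ?_
  rw [hs3 F a ha, C_0, zero_smul]

variable (k) in
/-- local data at a vertex -/
structure Data (Γ : LowerSet (Finset (Fin n))) (d : ℕ) (v : Fin n) (B : Finset (Fin n))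
    (ζ : Finset (Fin n) → k) : Prop where
  vB : v ∈ B
  cyc : ζ ∈ Cyc k Γ d B
  full : ∀ F ∈ Γ, F.card = d → v ∈ F → B ⊆ F ∧ ζ F ≠ 0
  uniq : ∀ σ ∈ Γ, v ∈ σ → ∀ z ∈ Cyc k Γ d σ, z ≠ 0 → B ⊆ σ ∧ ∃ r : k, ∀ F, σ ⊆ F → z F = r * ζ F

abbrev PT (k : Type) [Field k] (n : ℕ) : Type := (F : Finset (Fin n)) → TT k F

lemma pt_zero_smul (t : PT k n) : (0 : MvPolynomial (Fin n) k) • t = 0 := by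
  funext F; exact zero_smul (MvPolynomial (Fin n) k) (t F)

lemma pt_add_smul (p q : MvPolynomial (Fin n) k) (t : PT k n) : (p + q) • t = p • t + q • t := by
  funext F; exact add_smul p q (t F)

lemma pt_sub_smul (p q : MvPolynomial (Fin n) k) (t : PT k n) : (p - q) • t = p • t - q • t := by
  funext F; exact sub_smul p q (t F)

lemma pt_sum_smul {ι : Type} (s : Finset ι) (p : ι → MvPolynomial (Fin n) k) (t : PT k n) :
    (∑ i ∈ s, p i) • t = ∑ i ∈ s, p i • t := by
  classical
  induction s using Finset.induction_on with
  | empty => rw [Finset.sum_empty, Finset.sum_empty, pt_zero_smul]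
  | insert a s ha ih => rw [Finset.sum_insert ha, Finset.sum_insert ha, pt_add_smul, ih]

lemma exists_p {v : Fin n} {B : Finset (Fin n)} {ζ : Finset (Fin n) → k} (hD : Data k Γ d v B ζ)
    {t : (F : Finset (Fin n)) → TT k F} (ht : t ∈ Wm k Γ d) :
    ∃ p : MvPolynomial (Fin n) k, (X v : MvPolynomial (Fin n) k) • t = p • hh (ind B) ζ := by
  have h1 : ∀ c : Fin n →₀ ℕ, ∃ p : MvPolynomial (Fin n) k,
      (X v : MvPolynomial (Fin n) k) • hh c (cof c t) = p • hh (ind B) ζ := by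
    intro c
    have hz := cof_mem c ht
    have hX : (X v : MvPolynomial (Fin n) k) • hh c (cof c t) = hh (Finsupp.single v 1 + c) (cof c t) := by
      rw [X, monomial_hh, one_smul]
    rw [hX]
    set σ := (Finsupp.single v 1 + c).support with hσ
    have hsub : c.support ⊆ σ := by
      intro i hi
      rw [Finsupp.mem_support_iff] at hi
      simp only [hσ, Finsupp.mem_support_iff, Finsupp.add_apply]
      omega
    have hv : v ∈ σ := by simp [hσ]
    rw [hh_congr (z' := rs σ (cof c t)) _ (fun F hF => by rw [rs, if_pos hF])]
    have hz' := rs_mem hsub hz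
    by_cases h0 : rs σ (cof c t) = 0
    · exact ⟨0, by rw [h0, hh_zero, pt_zero_smul]⟩
    · have hσΓ : σ ∈ Γ := by
        obtain ⟨F, hF⟩ := Function.ne_iff.mp h0
        have := Cyc_ne hz' hF
        exact Γ.lower this.2.2 this.1
      obtain ⟨hB, r, hr⟩ := hD.uniq σ hσΓ hv _ hz' h0
      refine ⟨monomial (Finsupp.single v 1 + c - ind B) r, ?_⟩
      rw [monomial_hh, tsub_add_cancel_of_le]
      · exact hh_congr _ hr
      · intro i
        rw [ind_apply]
        split_ifs with hi
        · have := hB hi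
          rw [hσ, Finsupp.mem_support_iff] at this
          omega
        · omega
  choose p hp using h1
  obtain ⟨s, hs⟩ := hh_decomp t
  refine ⟨∑ c ∈ s, p c, ?_⟩
  conv_lhs => rw [hs]
  rw [Finset.smul_sum, pt_sum_smul]
  exact Finset.sum_congr rfl fun c _ => hp c

lemma p_zero (hR : Reis k Γ d) (hΓ : ∀ F ∈ Γ, F.card ≤ d)
    {v : Fin n} {B : Finset (Fin n)} {ζ : Finset (Fin n) → k} (hD : Data k Γ d v B ζ)
    (e : Fin n →₀ ℕ) (he : ∀ F ∈ Γ, F.card = d → e.support ⊆ F → v ∈ F)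
    (p : MvPolynomial (Fin n) k) (hp : p • hh (ind B) ζ = 0) : p • (xm Γ e : Qr k Γ) = 0 := by
  classical
  have h1 : p • (xm Γ e : Qr k Γ) = (monomial e 1 : MvPolynomial (Fin n) k) • (Ideal.Quotient.mk _ p) := by
    rw [smul_eq_mk_mul, smul_eq_mk_mul, mul_comm]
  rw [h1]
  apply qc_ext
  intro a ha
  rw [qc_monomial_smul, map_zero]
  split_ifs with h
  · obtain ⟨F, hF, hFd, hsub⟩ := purity_facet hR hΓ ha
    have hes : e.support ⊆ F := fun i hi => hsub (by
      rw [Finsupp.mem_support_iff] at hi ⊢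
      have := h.1 i
      omega)
    obtain ⟨hB, hz⟩ := hD.full F hF hFd (he F hF hFd hes)
    have hae : (a - e).support ⊆ F := fun i hi => hsub (by
      rw [Finsupp.mem_support_iff] at hi ⊢
      rw [Finsupp.tsub_apply] at hi
      omega)
    have hae' : ((a - e) + ind B).support ⊆ F := fun i hi => by
      have := Finsupp.support_add hi
      rw [Finset.mem_union, ind_support] at this
      exact this.elim (fun h => hae h) (fun h => hB h)
    have hm : (a - e).support ∈ Γ := Γ.lower hae hF
    rw [one_mul, qc_mk, if_pos hm]
    have h2 := congrArg (qc k (LowerSet.Iic F) (a - e + ind B)) (congrFun hp F)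
    rw [Pi.zero_apply, map_zero, Pi.smul_apply, hh, smul_comm, C_smul_eq, map_smul] at h2
    have h3 : p • (xm (LowerSet.Iic F) (ind B) : TT k F) = (monomial (ind B) 1 : MvPolynomial (Fin n) k) • (Ideal.Quotient.mk _ p) := by
      rw [smul_eq_mk_mul, smul_eq_mk_mul, mul_comm]
    rw [h3, qc_monomial_smul_add _ _ hae', qc_mk, if_pos (show _ ∈ LowerSet.Iic F from hae), one_mul, smul_eq_mul] at h2
    exact (mul_eq_zero.mp h2).resolve_left hz
  · rfl

theorem lemmaL (hR : Reis k Γ d) (hΓ : ∀ F ∈ Γ, F.card ≤ d)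
    {v : Fin n} {B : Finset (Fin n)} {ζ : Finset (Fin n) → k} (hD : Data k Γ d v B ζ)
    (e : Fin n →₀ ℕ) (he : ∀ F ∈ Γ, F.card = d → e.support ⊆ F → v ∈ F) :
    ∃ φ : Wm k Γ d →ₗ[MvPolynomial (Fin n) k] Qr k Γ, ∀ (w : Wm k Γ d) (p : MvPolynomial (Fin n) k),
      (X v : MvPolynomial (Fin n) k) • w.1 = p • hh (ind B) ζ → φ w = p • xm Γ e := by
  choose P hP using fun w : Wm k Γ d => exists_p hD w.2
  have key : ∀ (w : Wm k Γ d) (p : MvPolynomial (Fin n) k),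
      (X v : MvPolynomial (Fin n) k) • w.1 = p • hh (ind B) ζ → P w • (xm Γ e : Qr k Γ) = p • xm Γ e := by
    intro w p hp
    rw [← sub_eq_zero, ← sub_smul]
    apply p_zero hR hΓ hD e he
    rw [pt_sub_smul, ← hp, ← hP, sub_self]
  refine ⟨{ toFun := fun w => P w • (xm Γ e : Qr k Γ), map_add' := ?_, map_smul' := ?_ }, fun w p h => key w p h⟩
  · intro w w'
    rw [← add_smul]
    apply key
    rw [Submodule.coe_add, smul_add, pt_add_smul, hP, hP]
  · intro r w
    rw [RingHom.id_apply, smul_smul]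
    apply key
    rw [Submodule.coe_smul, smul_comm, hP, smul_smul]

end TJ

end PieceP6a

section PieceP6b

open MvPolynomial

section TK

variable {k : Type} [Field k] {n : ℕ} {Γ : LowerSet (Finset (Fin n))} {d : ℕ}

variable (k Γ d) in
/-- trace of the concrete module -/
noncomputable def trW : Ideal (Qr k Γ) :=
  Ideal.span {q | ∃ (f : Wm k Γ d →ₗ[MvPolynomial (Fin n) k] Qr k Γ) (w : Wm k Γ d), f w = q}

lemma trace_transfer (hΓ : ∀ F ∈ Γ, F.card ≤ d) (hF : ∃ F ∈ Γ, F.card = d)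
    (ω : Type) [AddCommGroup ω] [Module (Qr k Γ) ω] (hω : IsCanonicalModuleQ k (mI k Γ) ω) :
    traceIdeal (Qr k Γ) ω = trW k Γ d := by
  obtain ⟨_, d', hd', hne⟩ := hω
  have hdn : d ≤ n := by
    obtain ⟨F, _, hF⟩ := hF
    rw [← hF]; simpa using Finset.card_le_univ F
  have hdd : d' = d := by
    rw [krull_dim Γ d hΓ hF] at hd'
    have h2 : ((d' : ℕ∞) : WithBot ℕ∞) = ((d : ℕ∞) : WithBot ℕ∞) := hd'.symm
    exact Nat.cast_injective (WithBot.coe_injective h2)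
  subst hdd
  letI : Module (MvPolynomial (Fin n) k) ω := Module.compHom ω (Ideal.Quotient.mk (mI k Γ))
  haveI : IsScalarTower (MvPolynomial (Fin n) k) (Qr k Γ) ω := ⟨fun p q x => by
    rw [smul_eq_mk_mul, mul_smul]; rfl⟩
  obtain ⟨e1⟩ := hne
  obtain ⟨e2⟩ := canonical_iso (k := k) Γ (Nat.sub_add_cancel hdn) hΓ
  let e : ω ≃ₗ[MvPolynomial (Fin n) k] Wm k Γ d' := e1 ≪≫ₗ e2
  apply le_antisymm
  · refine iSup_le fun f => ?_
    rintro _ ⟨x, rfl⟩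
    refine Ideal.subset_span ⟨(f.restrictScalars (MvPolynomial (Fin n) k)) ∘ₗ e.symm.toLinearMap, e x, ?_⟩
    rw [LinearMap.comp_apply]
    simp
  · rw [trW, Ideal.span_le]
    rintro _ ⟨f, w, rfl⟩
    have hs : Function.Surjective (algebraMap (MvPolynomial (Fin n) k) (Qr k Γ)) :=
      Ideal.Quotient.mk_surjective
    let g : ω →ₗ[Qr k Γ] Qr k Γ := (f ∘ₗ e.toLinearMap).extendScalarsOfSurjective hs
    refine Submodule.mem_iSup_of_mem g ⟨e.symm w, ?_⟩
    change f (e (e.symm w)) = f w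
    rw [e.apply_symm_apply]

lemma mem_trW (f : Wm k Γ d →ₗ[MvPolynomial (Fin n) k] Qr k Γ) (w : Wm k Γ d) : f w ∈ trW k Γ d :=
  Ideal.subset_span ⟨f, w, rfl⟩

lemma smul_mem_trW {q : Qr k Γ} {r : k} (hr : r ≠ 0) (h : r • q ∈ trW k Γ d) : q ∈ trW k Γ d := by
  have := (trW k Γ d).mul_mem_left (algebraMap k _ r⁻¹) h
  rwa [algMap_mul, smul_smul, inv_mul_cancel₀ hr, one_smul] at this

theorem trace_mem (hR : Reis k Γ d) (hΓ : ∀ F ∈ Γ, F.card ≤ d)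
    {v : Fin n} {B : Finset (Fin n)} {ζ : Finset (Fin n) → k} (hD : Data k Γ d v B ζ)
    (e : Fin n →₀ ℕ) (he : ∀ F ∈ Γ, F.card = d → e.support ⊆ F → v ∈ F)
    (a : Fin n →₀ ℕ) (z : Finset (Fin n) → k) (hz : z ∈ Cyc k Γ d a.support)
    (F : Finset (Fin n)) (hvF : v ∈ F) (hzF : z F ≠ 0) :
    (xm Γ (Finsupp.single v 1 + a - ind B + e) : Qr k Γ) ∈ trW k Γ d := by
  obtain ⟨φ, hφ⟩ := lemmaL hR hΓ hD e he
  set σ := insert v a.support with hσ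
  have hc := Cyc_ne hz hzF
  have hσF : σ ⊆ F := Finset.insert_subset hvF hc.2.2
  have hσΓ : σ ∈ Γ := Γ.lower hσF hc.1
  have hz' : rs σ z ∈ Cyc k Γ d σ := rs_mem (Finset.subset_insert _ _) hz
  have hz0 : rs σ z F ≠ 0 := by rw [rs, if_pos hσF]; exact hzF
  obtain ⟨hB, r, hr⟩ := hD.uniq σ hσΓ (Finset.mem_insert_self _ _) _ hz' (fun h => hz0 (by rw [h]; rfl))
  have hr0 : r ≠ 0 := by
    rintro rfl
    apply hz0
    rw [hr F hσF, zero_mul]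
  have hle : ind B ≤ Finsupp.single v 1 + a := by
    intro i
    rw [ind_apply, Finsupp.add_apply]
    split_ifs with hi
    · rcases Finset.mem_insert.mp (hB hi) with rfl | h
      · simp
      · have := Finsupp.mem_support_iff.mp h
        omega
    · omega
  have h1 : (X v : MvPolynomial (Fin n) k) • hh a z =
      (monomial (Finsupp.single v 1 + a - ind B) r : MvPolynomial (Fin n) k) • hh (ind B) ζ := by
    rw [X, monomial_hh, one_smul, monomial_hh, tsub_add_cancel_of_le hle]
    refine hh_congr _ fun F' hF' => ?_
    have hs : σ ⊆ F' := by
      intro i hi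
      apply hF'
      rw [Finsupp.mem_support_iff, Finsupp.add_apply]
      rcases Finset.mem_insert.mp hi with rfl | h
      · simp
      · have := Finsupp.mem_support_iff.mp h
        omega
    have := hr F' hs
    rw [rs, if_pos hs] at this
    exact this
  have h2 := hφ ⟨hh a z, hh_mem hz⟩ _ h1
  have h3 : (monomial (Finsupp.single v 1 + a - ind B) r : MvPolynomial (Fin n) k) • (xm Γ e : Qr k Γ) =
      r • xm Γ (Finsupp.single v 1 + a - ind B + e) := by
    have h4 : (monomial (Finsupp.single v 1 + a - ind B) r : MvPolynomial (Fin n) k) =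
      C r * monomial (Finsupp.single v 1 + a - ind B) 1 := by rw [C_mul_monomial, mul_one]
    rw [h4, mul_smul, C_smul_eq, smul_eq_mk_mul]
    congr 1
    exact xm_mul _ _
  rw [h3] at h2
  apply smul_mem_trW hr0
  rw [← h2]
  exact mem_trW _ _

lemma quotMax_eq' : quotMax k (mI k Γ) = Ideal.span (Set.range fun i : Fin n => (xm Γ (Finsupp.single i 1) : Qr k Γ)) := rfl

lemma qc_xm_mul (a b : Fin n →₀ ℕ) (q : Qr k Γ) (h : ¬ b ≤ a) : qc k Γ a (xm Γ b * q) = 0 := by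
  classical
  have : (xm Γ b * q : Qr k Γ) = (monomial b 1 : MvPolynomial (Fin n) k) • q := by
    rw [smul_eq_mk_mul]
  rw [this, qc_monomial_smul, if_neg (fun h' => h h'.1)]

lemma sq_eq : quotMax k (mI k Γ) ^ 2 = Ideal.span {q | ∃ u v : Fin n, q = (xm Γ (Finsupp.single u 1 + Finsupp.single v 1) : Qr k Γ)} := by
  rw [quotMax_eq', pow_two, Ideal.span_mul_span']
  congr 1
  ext q
  constructor
  · rintro ⟨_, ⟨u, rfl⟩, _, ⟨v, rfl⟩, rfl⟩
    exact ⟨u, v, xm_mul _ _⟩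
  · rintro ⟨u, v, rfl⟩
    exact ⟨_, ⟨u, rfl⟩, _, ⟨v, rfl⟩, xm_mul _ _⟩

lemma sq_coeff {q : Qr k Γ} (hq : q ∈ quotMax k (mI k Γ) ^ 2) :
    qc k Γ 0 q = 0 ∧ ∀ v, qc k Γ (Finsupp.single v 1) q = 0 := by
  rw [sq_eq] at hq
  have key : ∀ a : Fin n →₀ ℕ, (∀ u v, ¬ (Finsupp.single u 1 + Finsupp.single v 1 ≤ a)) →
      ∀ r : Qr k Γ, qc k Γ a (r * q) = 0 := by
    intro a ha
    induction hq using Submodule.span_induction with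
    | mem x h =>
      obtain ⟨u, v, rfl⟩ := h
      intro r
      rw [mul_comm, qc_xm_mul _ _ _ (ha u v)]
    | zero => intro r; rw [mul_zero, map_zero]
    | add x y _ _ h1 h2 => intro r; rw [mul_add, map_add, h1, h2, add_zero]
    | smul s x _ h => intro r; rw [smul_eq_mul, ← mul_assoc]; exact h _
  refine ⟨?_, fun w => ?_⟩
  · have := key 0 (fun u v h => by
      have := h u
      rw [Finsupp.add_apply, Finsupp.single_eq_same, Finsupp.zero_apply] at this
      omega) 1
    rwa [one_mul] at this
  · have := key (Finsupp.single w 1) (fun u v h => by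
      have h1 := h u
      have h2 := h v
      rw [Finsupp.add_apply, Finsupp.single_eq_same] at h1 h2
      by_cases hu : w = u
      · subst hu
        rw [Finsupp.single_eq_same] at h1
        by_cases hv : w = v
        · subst hv
          rw [Finsupp.single_eq_same] at h1
          omega
        · rw [Finsupp.single_apply (a := w) (a' := v) (b := 1), if_neg hv] at h2
          omega
      · rw [Finsupp.single_apply (a := w) (a' := u) (b := 1), if_neg hu] at h1
        omega) 1
    rwa [one_mul] at this

lemma mem_sq {q : Qr k Γ} (h0 : qc k Γ 0 q = 0) (h1 : ∀ v, qc k Γ (Finsupp.single v 1) q = 0) :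
    q ∈ quotMax k (mI k Γ) ^ 2 := by
  obtain ⟨s, hs1, hs2, hs3⟩ := Qr_expand q
  rw [hs2]
  refine Ideal.sum_mem _ fun a _ => ?_
  by_cases h : ∃ u v : Fin n, Finsupp.single u 1 + Finsupp.single v 1 ≤ a
  · obtain ⟨u, v, h⟩ := h
    rw [smul_eq_mk_mul]
    apply Ideal.mul_mem_left
    rw [← tsub_add_cancel_of_le h, ← xm_mul]
    apply Ideal.mul_mem_left
    rw [sq_eq]
    exact Ideal.subset_span ⟨u, v, rfl⟩
  · have : qc k Γ a q = 0 := by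
      by_cases ha : a = 0
      · rw [ha, h0]
      · obtain ⟨u, hu⟩ := Finsupp.ne_iff.mp ha
        rw [Finsupp.zero_apply] at hu
        have hle : Finsupp.single u 1 ≤ a := by
          rw [Finsupp.single_le_iff]; omega
        have : a - Finsupp.single u 1 = 0 := by
          by_contra hne
          obtain ⟨v, hv⟩ := Finsupp.ne_iff.mp hne
          rw [Finsupp.zero_apply] at hv
          apply h
          refine ⟨u, v, ?_⟩
          rw [add_comm, ← le_tsub_iff_right hle, Finsupp.single_le_iff]
          omega
        have : a = Finsupp.single u 1 := le_antisymm (tsub_eq_zero_iff_le.mp this) hle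
        rw [this, h1]
    rw [this, C_0, zero_smul]
    exact zero_mem _

end TK

end PieceP6b

section PieceP8

open MvPolynomial

section TL

variable {k : Type} [Field k] {n : ℕ} {Γ : LowerSet (Finset (Fin n))} {d : ℕ}

variable (k Γ d) in
/-- one dimensionality -/
def OneDim (σ : Finset (Fin n)) : Prop :=
  (∃ z ∈ Cyc k Γ d σ, z ≠ 0) ∧ ∀ x ∈ Cyc k Γ d σ, ∀ y ∈ Cyc k Γ d σ, x ≠ 0 → ∃ c : k, y = c • x

lemma nonvanish (hR : Reis k Γ d) (hΓ : ∀ F ∈ Γ, F.card ≤ d)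
    (h1 : ∀ σ ∈ Γ, σ ≠ ∅ → OneDim k Γ d σ) :
    ∀ (m : ℕ) (σ : Finset (Fin n)), σ ∈ Γ → σ ≠ ∅ → σ.card + m = d → ∀ z ∈ Cyc k Γ d σ,
      ∀ F, F ∈ Γ → F.card = d → σ ⊆ F → z F = 0 → z = 0 := by
  intro m
  induction m with
  | zero =>
    intro σ hσ hne hc z hz F hF hFd hσF hzF
    have hFσ : σ = F := Finset.eq_of_subset_of_card_le hσF (by omega)
    funext F'
    by_contra h
    have := Cyc_ne hz h
    have h2 : σ = F' := Finset.eq_of_subset_of_card_le this.2.2 (by omega)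
    apply h
    rw [← h2, hFσ, hzF]; rfl
  | succ m ih =>
    intro σ hσ hne hc z hz F hF hFd hσF hzF
    by_contra hz0
    obtain ⟨F', hF'⟩ := Function.ne_iff.mp hz0
    have hc' := Cyc_ne hz hF'
    rcases Nat.eq_zero_or_pos m with rfl | hm
    · obtain ⟨v, hv, rfl⟩ := exists_insert_of_card hσF (by omega)
      obtain ⟨v', hv', rfl⟩ := exists_insert_of_card hc'.2.2 (by omega)
      have hvv : v' ≠ v := by rintro rfl; exact hF' hzF
      have hins : ∀ a b : Fin n, a ∉ σ → insert a σ = insert b σ → a = b := by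
        intro a b ha h
        have : a ∈ insert b σ := h ▸ Finset.mem_insert_self a σ
        exact (Finset.mem_insert.mp this).resolve_right ha
      have hne2 : insert v' σ ≠ insert v σ := fun h => hvv (hins _ _ hv' h)
      let z' : Finset (Fin n) → k := fun G => if G = insert v σ then eps k v σ else
        if G = insert v' σ then - eps k v' σ else 0
      have e1 : z' (insert v σ) = eps k v σ := if_pos rfl
      have e2 : z' (insert v' σ) = - eps k v' σ := by
        change (if _ then _ else _) = _
        rw [if_neg hne2, if_pos rfl]
      have hz' : z' ∈ Cyc k Γ d σ := by
        refine ⟨fun G hG => ?_, fun G hG hs => ?_⟩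
        · change (if _ then _ else _) = _
          rw [if_neg, if_neg]
          · rintro rfl; exact hG hc'
          · rintro rfl; exact hG ⟨hF, hFd, hσF⟩
        · have hGσ : σ = G := Finset.eq_of_subset_of_card_le hs (by omega)
          subst hGσ
          have hsub : ({v, v'} : Finset (Fin n)) ⊆ σᶜ := by
            intro i hi
            rw [Finset.mem_insert, Finset.mem_singleton] at hi
            rw [Finset.mem_compl]
            rcases hi with rfl | rfl <;> assumption
          rw [← Finset.sum_subset hsub, Finset.sum_pair hvv.symm, e1, e2]
          · rw [eps_sq, mul_neg, eps_sq, add_neg_cancel]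
          · intro i hi hi'
            rw [Finset.mem_compl] at hi
            rw [Finset.mem_insert, Finset.mem_singleton, not_or] at hi'
            have : z' (insert i σ) = 0 := by
              change (if _ then _ else _) = _
              rw [if_neg (fun h => hi'.1 (hins _ _ hi h)), if_neg (fun h => hi'.2 (hins _ _ hi h))]
            rw [this, mul_zero]
      obtain ⟨c, hcc⟩ := (h1 σ hσ hne).2 z hz z' hz' hz0
      have := congrFun hcc (insert v σ)
      rw [e1, Pi.smul_apply, hzF, smul_zero] at this
      exact eps_ne_zero k v σ this
    · have step : ∀ v, v ∉ σ → insert v σ ∈ Γ → ∀ F, F ∈ Γ → F.card = d → insert v σ ⊆ F → z F = 0 →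
          rs (insert v σ) z = 0 := by
        intro v hv hvΓ F hF hFd hs hzF
        refine ih _ hvΓ (Finset.insert_ne_empty _ _) (by rw [Finset.card_insert_of_notMem hv]; omega) _
          (rs_mem (Finset.subset_insert _ _) hz) F hF hFd hs ?_
        rw [rs, if_pos hs, hzF]
      have pick : ∀ F : Finset (Fin n), σ ⊆ F → F.card = d → ∃ u ∈ F, u ∉ σ := by
        intro F hs hFd
        by_contra h
        push Not at h
        have := Finset.card_le_card (show F ⊆ σ from h)
        omega
      obtain ⟨u, huF, hu⟩ := pick F hσF hFd
      obtain ⟨v, hvF, hv⟩ := pick F' hc'.2.2 hc'.2.1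
      have hinsF : insert u σ ⊆ F := Finset.insert_subset huF hσF
      have hinsF' : insert v σ ⊆ F' := Finset.insert_subset hvF hc'.2.2
      have hU := link_conn hR (by omega : σ.card + 2 ≤ d) {v | rs (insert v σ) z = 0} u
        (step u hu (Γ.lower hinsF hF) F hF hFd hinsF hzF) ⟨hu, Γ.lower hinsF hF⟩ (by
          intro a b ha ha' hb' hab hΓab
          obtain ⟨F1, hF1, hF1d, hs⟩ := purity_facet hR hΓ hΓab
          have hs1 : insert a σ ⊆ F1 := (Finset.subset_insert _ _).trans hs
          have hs2 : insert b σ ⊆ F1 := fun i hi => hs (by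
            rw [Finset.mem_insert] at hi ⊢
            exact hi.imp_right fun h => Finset.mem_insert_of_mem h)
          refine step b hb' (Γ.lower hs2 hF1) F1 hF1 hF1d hs2 ?_
          have := congrFun ha F1
          rw [rs, if_pos hs1] at this
          exact this) v hv (Γ.lower hinsF' hc'.1)
      have := congrFun hU F'
      rw [rs, if_pos hinsF'] at this
      exact hF' this

lemma exists_data (hR : Reis k Γ d) (hΓ : ∀ F ∈ Γ, F.card ≤ d)
    (h1 : ∀ σ ∈ Γ, σ ≠ ∅ → OneDim k Γ d σ) (v : Fin n) (hv : {v} ∈ Γ) :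
    ∃ ζ, Data k Γ d v {v} ζ := by
  obtain ⟨ζ, hζ, hne⟩ := (h1 {v} hv (Finset.singleton_ne_empty _)).1
  have hfull : ∀ F ∈ Γ, F.card = d → v ∈ F → ζ F ≠ 0 := by
    intro F hF hFd hvF h
    have hs : {v} ⊆ F := by simpa using hvF
    have := hΓ _ hv
    exact hne (nonvanish hR hΓ h1 (d - ({v} : Finset (Fin n)).card) {v} hv (Finset.singleton_ne_empty _) (by omega)
      ζ hζ F hF hFd hs h)
  refine ⟨ζ, Finset.mem_singleton_self _, hζ, fun F hF hFd hvF => ⟨by simpa using hvF, hfull F hF hFd hvF⟩, ?_⟩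
  intro σ hσ hvσ z hz hz0
  have hvs : {v} ⊆ σ := by simpa using hvσ
  refine ⟨hvs, ?_⟩
  obtain ⟨F, hF, hFd, hs⟩ := purity_facet hR hΓ hσ
  have hr0 : rs σ ζ ≠ 0 := by
    intro h
    have := congrFun h F
    rw [rs, if_pos hs] at this
    exact hfull F hF hFd (hs hvσ) this
  obtain ⟨c, hc⟩ := (h1 σ hσ (Finset.ne_empty_of_mem hvσ)).2 _ (rs_mem hvs hζ) z hz hr0
  refine ⟨c, fun F' hF' => ?_⟩
  rw [hc, Pi.smul_apply, rs, if_pos hF', smul_eq_mul]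

end TL

end PieceP8

section PieceP8b

open MvPolynomial

section TM

variable {k : Type} [Field k] {n : ℕ} {Γ : LowerSet (Finset (Fin n))} {d : ℕ}

lemma single_pair_support {u v : Fin n} : (Finsupp.single u 1 + Finsupp.single v 1 : Fin n →₀ ℕ).support = {u, v} := by
  ext i
  rw [Finsupp.mem_support_iff, Finsupp.add_apply, Finsupp.single_apply, Finsupp.single_apply,
    Finset.mem_insert, Finset.mem_singleton]
  by_cases h1 : u = i <;> by_cases h2 : v = i <;> simp [h1, h2, eq_comm]

lemma supp_single (v : Fin n) (m : ℕ) (hm : m ≠ 0) : (Finsupp.single v m : Fin n →₀ ℕ).support = {v} :=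
  Finsupp.support_single v hm

lemma not_single_le {u v : Fin n} (h : u ≠ v) (m : ℕ) : ¬ (Finsupp.single u 1 : Fin n →₀ ℕ) ≤ Finsupp.single v m := by
  intro hle
  have := hle u
  rw [Finsupp.single_eq_same, Finsupp.single_apply, if_neg (Ne.symm h)] at this
  omega

/-- the element of the canonical module attached to a cycle -/
noncomputable def wz (c : Fin n →₀ ℕ) (z : Finset (Fin n) → k) (hz : z ∈ Cyc k Γ d c.support) : Wm k Γ d :=
  ⟨hh c z, hh_mem hz⟩

lemma qc_X_smul (v : Fin n) (c : Fin n →₀ ℕ) (q : Qr k Γ) (h : (c + Finsupp.single v 1).support ∈ Γ) :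
    qc k Γ (c + Finsupp.single v 1) ((X v : MvPolynomial (Fin n) k) • q) = qc k Γ c q := by
  rw [X, qc_monomial_smul_add _ _ h, one_mul]

lemma qc_X_smul_zero (v : Fin n) (c : Fin n →₀ ℕ) (q : Qr k Γ) (h : ¬ Finsupp.single v 1 ≤ c) :
    qc k Γ c ((X v : MvPolynomial (Fin n) k) • q) = 0 := by
  classical
  rw [X, qc_monomial_smul, if_neg (fun h' => h h'.1)]

section
variable {ζ : Fin n → Finset (Fin n) → k}

lemma edge_rel (hD : ∀ v, {v} ∈ Γ → Data k Γ d v {v} (ζ v)) (hR : Reis k Γ d) (hΓ : ∀ F ∈ Γ, F.card ≤ d)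
    {u t : Fin n} (hut : ({u, t} : Finset (Fin n)) ∈ Γ) :
    ∃ c : k, c ≠ 0 ∧ (∀ F, u ∈ F → t ∈ F → ζ u F = c * ζ t F) ∧
      (X t : MvPolynomial (Fin n) k) • hh (Finsupp.single u 1) (ζ u) =
      (C c : MvPolynomial (Fin n) k) • (X u : MvPolynomial (Fin n) k) • hh (Finsupp.single t 1) (ζ t) := by
  have hu : {u} ∈ Γ := Γ.lower (by simp) hut
  have ht : {t} ∈ Γ := Γ.lower (by simp) hut
  obtain ⟨F, hF, hFd, hs⟩ := purity_facet hR hΓ hut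
  have hsu : {u} ⊆ ({u, t} : Finset (Fin n)) := by simp
  have hz := rs_mem hsu (hD u hu).cyc
  have huF : u ∈ F := hs (by simp)
  have hF0 := ((hD u hu).full F hF hFd huF).2
  have hz0 : rs {u, t} (ζ u) ≠ 0 := by
    intro h
    have := congrFun h F
    rw [rs, if_pos hs] at this
    exact hF0 this
  obtain ⟨_, c, hc⟩ := (hD t ht).uniq _ hut (by simp) _ hz hz0
  have hc' : ∀ F, u ∈ F → t ∈ F → ζ u F = c * ζ t F := by
    intro F h1 h2
    have hs : {u, t} ⊆ F := by
      intro i hi; rw [Finset.mem_insert, Finset.mem_singleton] at hi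
      rcases hi with rfl | rfl <;> assumption
    have := hc F hs
    rwa [rs, if_pos hs] at this
  refine ⟨c, ?_, hc', ?_⟩
  · rintro rfl
    apply hF0
    rw [hc' F huF (hs (by simp)), zero_mul]
  · rw [← mul_smul, C_mul_X_eq_monomial, X, monomial_hh, monomial_hh, one_smul,
      add_comm (Finsupp.single u 1)]
    refine hh_congr _ fun F' hF' => ?_
    rw [single_pair_support] at hF'
    rw [Pi.smul_apply, smul_eq_mul]
    exact hc' F' (hF' (by simp)) (hF' (by simp))

lemma linear_zero (hD : ∀ v, {v} ∈ Γ → Data k Γ d v {v} (ζ v)) (hR : Reis k Γ d)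
    (hΓ : ∀ F ∈ Γ, F.card ≤ d) (hd : 2 ≤ d) (h0 : ∀ z ∈ Cyc k Γ d ∅, z = 0)
    (f : Wm k Γ d →ₗ[MvPolynomial (Fin n) k] Qr k Γ) (r : Fin n → Qr k Γ)
    (hr : ∀ u, {u} ∈ Γ → ∃ hz, r u = f (wz (Finsupp.single u 1) (ζ u) hz)) (u : Fin n) (hu : {u} ∈ Γ) :
    r u ∈ quotMax k (mI k Γ) ^ 2 := by
  have hrel : ∀ u t, ({u, t} : Finset (Fin n)) ∈ Γ → ∃ c : k, c ≠ 0 ∧ (∀ F, u ∈ F → t ∈ F → ζ u F = c * ζ t F) ∧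
      (X t : MvPolynomial (Fin n) k) • r u = c • (X u : MvPolynomial (Fin n) k) • r t := by
    intro u t hut
    obtain ⟨c, hc0, hc1, hc2⟩ := edge_rel hD hR hΓ hut
    refine ⟨c, hc0, hc1, ?_⟩
    obtain ⟨hz1, h1⟩ := hr u (Γ.lower (by simp) hut)
    obtain ⟨hz2, h2⟩ := hr t (Γ.lower (by simp) hut)
    rw [h1, h2, ← C_smul_eq, ← map_smul, ← map_smul, ← map_smul]
    congr 1
    exact Subtype.ext hc2
  have hnon : ∀ u t, {u} ∈ Γ → ({u, t} : Finset (Fin n)) ∉ Γ → (X t : MvPolynomial (Fin n) k) • r u = 0 := by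
    intro u t hu hut
    obtain ⟨hz1, h1⟩ := hr u hu
    rw [h1, ← map_smul]
    have : (X t : MvPolynomial (Fin n) k) • wz (Finsupp.single u 1) (ζ u) hz1 = 0 := by
      apply Subtype.ext
      change (X t : MvPolynomial (Fin n) k) • hh (Finsupp.single u 1) (ζ u) = 0
      rw [X, monomial_hh, one_smul, ← hh_zero]
      refine hh_congr _ fun F hF => ?_
      rw [add_comm, single_pair_support] at hF
      apply hz1.1
      rintro ⟨h, _⟩
      exact hut (Γ.lower hF h)
    rw [this, map_zero]
  have hsq : ∀ v, Finsupp.single v 1 + Finsupp.single v 1 = (Finsupp.single v 2 : Fin n →₀ ℕ) := by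
    intro v; rw [← Finsupp.single_add]
  have hoff : ∀ u v, {u} ∈ Γ → u ≠ v → qc k Γ (Finsupp.single v 1) (r u) = 0 := by
    intro u v hu huv
    by_cases hv : {v} ∈ Γ
    · rw [← qc_X_smul v _ _ (by rw [hsq, supp_single _ _ two_ne_zero]; exact hv)]
      by_cases hut : ({u, v} : Finset (Fin n)) ∈ Γ
      · obtain ⟨c, -, -, hc⟩ := hrel u v hut
        rw [hc, map_smul, qc_X_smul_zero, smul_zero]
        rw [hsq]
        exact not_single_le huv _
      · rw [hnon u v hu hut, map_zero]
    · apply qc_of_not_mem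
      rw [supp_single _ _ one_ne_zero]; exact hv
  have hzero : ∀ u, {u} ∈ Γ → qc k Γ 0 (r u) = 0 := by
    intro u hu
    obtain ⟨F, hF, hFd, hs⟩ := purity_facet hR hΓ hu
    obtain ⟨t, ht, htu⟩ : ∃ t ∈ F, t ≠ u := Finset.exists_mem_ne (by omega) u
    have hut : ({u, t} : Finset (Fin n)) ∈ Γ := Γ.lower (by
      intro i hi; rw [Finset.mem_insert, Finset.mem_singleton] at hi
      rcases hi with rfl | rfl
      · exact hs (by simp)
      · exact ht) hF
    have htΓ : {t} ∈ Γ := Γ.lower (by simp) hut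
    rw [← qc_X_smul t _ _ (by rw [zero_add, supp_single _ _ one_ne_zero]; exact htΓ)]
    obtain ⟨c, -, -, hc⟩ := hrel u t hut
    rw [hc, map_smul, qc_X_smul_zero, smul_zero]
    rw [zero_add]
    exact not_single_le htu.symm _
  refine mem_sq (hzero u hu) fun v => ?_
  by_cases huv : u = v
  swap
  · exact hoff u v hu huv
  subst huv
  by_contra hne
  set lam : Fin n → k := fun u => qc k Γ (Finsupp.single u 1) (r u) with hlam
  have hl : ∀ u t, u ≠ t → ({u, t} : Finset (Fin n)) ∈ Γ → ∃ c : k, c ≠ 0 ∧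
      (∀ F, u ∈ F → t ∈ F → ζ u F = c * ζ t F) ∧ lam u = c * lam t := by
    intro u t hne hut
    obtain ⟨c, hc0, hc1, hc⟩ := hrel u t hut
    refine ⟨c, hc0, hc1, ?_⟩
    rw [hlam]
    simp only
    rw [← qc_X_smul t (Finsupp.single u 1), ← qc_X_smul u (Finsupp.single t 1), hc, map_smul,
      add_comm (Finsupp.single t 1), smul_eq_mul]
    · rw [add_comm, single_pair_support]; exact hut
    · rw [single_pair_support]; exact hut
  have hall : ∀ v, {v} ∈ Γ → lam v ≠ 0 := by
    intro v hv
    refine link_conn hR (σ := ∅) (by simpa using hd) {v | lam v ≠ 0} u hne ⟨by simp, by simpa using hu⟩ ?_ v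
      (by simp) (by simpa using hv)
    intro a b ha _ _ hab hΓab
    obtain ⟨c, hc0, -, hc⟩ := hl a b hab (by
      rw [Finset.pair_comm]; simpa using hΓab)
    intro hb
    apply ha
    rw [hc, hb, mul_zero]
  have hcons : ∀ F ∈ Γ, ∀ u ∈ F, ∀ t ∈ F, ζ u F / lam u = ζ t F / lam t := by
    intro F hF u hu t ht
    by_cases hut : u = t
    · rw [hut]
    have hutΓ : ({u, t} : Finset (Fin n)) ∈ Γ := Γ.lower (by
      intro i hi; rw [Finset.mem_insert, Finset.mem_singleton] at hi
      rcases hi with rfl | rfl <;> assumption) hF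
    obtain ⟨c, hc0, hc1, hc⟩ := hl u t hut hutΓ
    rw [hc1 F hu ht, hc, mul_div_mul_left _ _ hc0]
  classical
  let z : Finset (Fin n) → k := fun F =>
    if h : (F ∈ Γ ∧ F.card = d) ∧ F.Nonempty then ζ h.2.choose F / lam h.2.choose else 0
  have hz : ∀ F ∈ Γ, F.card = d → ∀ u ∈ F, z F = ζ u F / lam u := by
    intro F hF hFd u hu
    have h : (F ∈ Γ ∧ F.card = d) ∧ F.Nonempty := ⟨⟨hF, hFd⟩, u, hu⟩
    change dite _ _ _ = _
    rw [dif_pos h]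
    exact hcons F hF _ h.2.choose_spec u hu
  have hz' : ∀ F, ¬ (F ∈ Γ ∧ F.card = d) → z F = 0 := by
    intro F hF
    change dite _ _ _ = _
    rw [dif_neg (fun h => hF h.1)]
  have hzC : z ∈ Cyc k Γ d ∅ := by
    refine ⟨fun F hF => hz' F fun h => hF ⟨h.1, h.2, Finset.empty_subset _⟩, fun G hG _ => ?_⟩
    by_cases hGΓ : G ∈ Γ
    · obtain ⟨t, ht⟩ : G.Nonempty := Finset.card_pos.mp (by omega)
      have htΓ : {t} ∈ Γ := Γ.lower (by simpa using ht) hGΓ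
      have hcyc := (hD t htΓ).cyc
      have := hcyc.2 G hG (by simpa using ht)
      have h2 : ∀ v ∈ Gᶜ, eps k v G * z (insert v G) = (eps k v G * ζ t (insert v G)) * (lam t)⁻¹ := by
        intro v _
        rw [mul_assoc, ← div_eq_mul_inv]
        by_cases hv : insert v G ∈ Γ ∧ (insert v G).card = d
        · rw [hz _ hv.1 hv.2 t (Finset.mem_insert_of_mem ht)]
        · rw [hz' _ hv, hcyc.1 _ (fun h => hv ⟨h.1, h.2.1⟩), zero_div]
      rw [Finset.sum_congr rfl h2, ← Finset.sum_mul, this, zero_mul]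
    · refine Finset.sum_eq_zero fun v _ => ?_
      rw [hz', mul_zero]
      intro h
      exact hGΓ (Γ.lower (Finset.subset_insert v G) h.1)
  obtain ⟨F, hF, hFd, hs⟩ := purity_facet hR hΓ hu
  have huF : u ∈ F := by simpa using hs
  have := hz F hF hFd u huF
  rw [h0 z hzC] at this
  exact div_ne_zero ((hD u hu).full F hF hFd huF).2 (hall u hu) this.symm

end

theorem backward (hR : Reis k Γ d) (hΓ : ∀ F ∈ Γ, F.card ≤ d) (hd : 2 ≤ d)
    (h0 : ∀ z ∈ Cyc k Γ d ∅, z = 0) (h1 : ∀ σ ∈ Γ, σ ≠ ∅ → OneDim k Γ d σ) :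
    trW k Γ d = quotMax k (mI k Γ) ^ 2 := by
  classical
  have hex : ∀ v, ∃ ζ, {v} ∈ Γ → Data k Γ d v {v} ζ := by
    intro v
    by_cases hv : {v} ∈ Γ
    · obtain ⟨ζ, h⟩ := exists_data hR hΓ h1 v hv
      exact ⟨ζ, fun _ => h⟩
    · exact ⟨0, fun h => absurd h hv⟩
  choose ζ hD using hex
  have hcyc : ∀ u, {u} ∈ Γ → ζ u ∈ Cyc k Γ d (Finsupp.single u 1 : Fin n →₀ ℕ).support := by
    intro u hu
    rw [supp_single _ _ one_ne_zero]
    exact (hD u hu).cyc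
  apply le_antisymm
  · rw [trW, Ideal.span_le]
    rintro _ ⟨f, w, rfl⟩
    have hlin : ∀ u (hu : {u} ∈ Γ), f (wz _ (ζ u) (hcyc u hu)) ∈ quotMax k (mI k Γ) ^ 2 := by
      intro u hu
      have := linear_zero hD hR hΓ hd h0 f
        (fun u => if hu : {u} ∈ Γ then f (wz _ (ζ u) (hcyc u hu)) else 0)
        (fun u hu => ⟨hcyc u hu, by rw [dif_pos hu]⟩) u hu
      rwa [dif_pos hu] at this
    obtain ⟨s, hs⟩ := hh_decomp w.1
    have hw : w = ∑ c ∈ s, wz c (cof c w.1) (cof_mem c w.2) := by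
      apply Subtype.ext
      rw [AddSubmonoidClass.coe_finsetSum]
      exact hs
    rw [hw, map_sum]
    refine Ideal.sum_mem _ fun c _ => ?_
    by_cases hz0 : cof c w.1 = 0
    · have : wz c (cof c w.1) (cof_mem c w.2) = 0 := by
        apply Subtype.ext
        change hh c (cof c w.1) = 0
        rw [hz0, hh_zero]
      rw [this, map_zero]
      exact zero_mem _
    · have hc := cof_mem c w.2
      obtain ⟨F, hF⟩ := Function.ne_iff.mp hz0
      have hFc := Cyc_ne hc hF
      have hsΓ : c.support ∈ Γ := Γ.lower hFc.2.2 hFc.1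
      have hne : c.support.Nonempty := by
        rw [Finset.nonempty_iff_ne_empty]
        intro h
        rw [h] at hc
        exact hz0 (h0 _ hc)
      obtain ⟨u, hu⟩ := hne
      have huΓ : {u} ∈ Γ := Γ.lower (by simpa using hu) hsΓ
      obtain ⟨_, r, hr⟩ := (hD u huΓ).uniq _ hsΓ hu _ hc hz0
      have : wz c (cof c w.1) (cof_mem c w.2) =
          (monomial (c - Finsupp.single u 1) r : MvPolynomial (Fin n) k) • wz _ (ζ u) (hcyc u huΓ) := by
        apply Subtype.ext
        change hh c (cof c w.1) = (monomial (c - Finsupp.single u 1) r : MvPolynomial (Fin n) k) • hh _ (ζ u)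
        rw [monomial_hh, tsub_add_cancel_of_le]
        · exact hh_congr _ hr
        · rw [Finsupp.single_le_iff]
          have := Finsupp.mem_support_iff.mp hu
          omega
      rw [this, map_smul, smul_eq_mk_mul]
      exact Ideal.mul_mem_left _ _ (hlin u huΓ)
  · rw [sq_eq, Ideal.span_le]
    rintro _ ⟨u, v, rfl⟩
    by_cases huv : ({u, v} : Finset (Fin n)) ∈ Γ
    · have hu : {u} ∈ Γ := Γ.lower (by simp) huv
      have hv : {v} ∈ Γ := Γ.lower (by simp) huv
      obtain ⟨F, hF, hFd, hs⟩ := purity_facet hR hΓ huv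
      have := trace_mem hR hΓ (hD v hv) (Finsupp.single v 1) (fun F _ _ h => by
        rw [supp_single _ _ one_ne_zero] at h; simpa using h) (Finsupp.single u 1) (ζ u) (hcyc u hu) F
        (hs (by simp)) ((hD u hu).full F hF hFd (hs (by simp))).2
      rwa [ind_singleton, add_tsub_cancel_left] at this
    · have : (xm Γ (Finsupp.single u 1 + Finsupp.single v 1) : Qr k Γ) = 0 := xm_eq_zero (by
        rw [single_pair_support]; exact huv)
      rw [this]
      exact zero_mem _

end TM

end PieceP8b

section PieceP9

open MvPolynomial

section TN

variable {k : Type} [Field k] {n : ℕ} {Γ : LowerSet (Finset (Fin n))} {d : ℕ}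

lemma trW_coeff (a : Fin n →₀ ℕ)
    (h : ∀ (f : Wm k Γ d →ₗ[MvPolynomial (Fin n) k] Qr k Γ) (w : Wm k Γ d), qc k Γ a (f w) = 0)
    (q : Qr k Γ) (hq : q ∈ trW k Γ d) : qc k Γ a q = 0 := by
  have key : ∀ r : Qr k Γ, qc k Γ a (r * q) = 0 := by
    induction hq using Submodule.span_induction with
    | mem x hx =>
      obtain ⟨f, w, rfl⟩ := hx
      intro r
      obtain ⟨p, rfl⟩ := Ideal.Quotient.mk_surjective r
      rw [← smul_eq_mk_mul, ← map_smul]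
      exact h _ _
    | zero => intro r; rw [mul_zero, map_zero]
    | add x y _ _ h1 h2 => intro r; rw [mul_add, map_add, h1, h2, add_zero]
    | smul s x _ h => intro r; rw [smul_eq_mul, ← mul_assoc]; exact h _
  have := key 1
  rwa [one_mul] at this

lemma trW_witness (a : Fin n →₀ ℕ) (q : Qr k Γ) (hq : q ∈ trW k Γ d) (hne : qc k Γ a q ≠ 0) :
    ∃ (f : Wm k Γ d →ₗ[MvPolynomial (Fin n) k] Qr k Γ) (c : Fin n →₀ ℕ) (z : Finset (Fin n) → k)
      (hz : z ∈ Cyc k Γ d c.support), qc k Γ a (f (wz c z hz)) ≠ 0 := by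
  by_contra hcon
  push Not at hcon
  refine hne (trW_coeff a (fun f w => ?_) q hq)
  obtain ⟨s, hs⟩ := hh_decomp w.1
  have hw : w = ∑ c ∈ s, wz c (cof c w.1) (cof_mem c w.2) := by
    apply Subtype.ext
    rw [AddSubmonoidClass.coe_finsetSum]
    exact hs
  rw [hw, map_sum, map_sum]
  exact Finset.sum_eq_zero fun c _ => hcon f c _ _

lemma add_support_subset {a b : Fin n →₀ ℕ} {F : Finset (Fin n)} (ha : a.support ⊆ F) (hb : b.support ⊆ F) :
    (a + b).support ⊆ F := by
  classical
  exact Finsupp.support_add.trans (Finset.union_subset ha hb)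

lemma subset_of_add {a b : Fin n →₀ ℕ} {F : Finset (Fin n)} (h : (a + b).support ⊆ F) :
    a.support ⊆ F ∧ b.support ⊆ F := by
  constructor <;> intro i hi <;> apply h <;> rw [Finsupp.mem_support_iff] at hi ⊢ <;>
    rw [Finsupp.add_apply] <;> omega

lemma monomial_wz (b c : Fin n →₀ ℕ) (r : k) (z : Finset (Fin n) → k) (hz : z ∈ Cyc k Γ d c.support) :
    ((monomial b r : MvPolynomial (Fin n) k) • wz c z hz).1 = hh (b + c) (r • z) := monomial_hh b c r z

lemma hh_full {F : Finset (Fin n)} (hΓ : ∀ F ∈ Γ, F.card ≤ d) (hFd : F.card = d)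
    {σ τ : Finset (Fin n)} {z z' : Finset (Fin n) → k} (hz : z ∈ Cyc k Γ d σ) (hz' : z' ∈ Cyc k Γ d τ)
    {c : Fin n →₀ ℕ} (hc : F ⊆ c.support) (h : c.support ⊆ F → z F = z' F) : hh c z = hh c z' := by
  refine hh_congr _ fun F' hF' => ?_
  by_cases h1 : F' ∈ Γ
  · have : F = F' := Finset.eq_of_subset_of_card_le (hc.trans hF') (by rw [hFd]; exact hΓ _ h1)
    subst this
    exact h hF'
  · rw [hz.1 F' (fun h => h1 h.1), hz'.1 F' (fun h => h1 h.1)]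

lemma data_of (hR : Reis k Γ d) (hΓ : ∀ F ∈ Γ, F.card ≤ d) (v : Fin n)
    (f : Wm k Γ d →ₗ[MvPolynomial (Fin n) k] Qr k Γ) (a : Fin n →₀ ℕ) (z : Finset (Fin n) → k)
    (hz : z ∈ Cyc k Γ d a.support) (hne : qc k Γ (Finsupp.single v 2) (f (wz a z hz)) ≠ 0) :
    ∃ B ζ, Data k Γ d v B ζ := by
  classical
  have hs2 : (Finsupp.single v 2 : Fin n →₀ ℕ).support = {v} := supp_single _ _ two_ne_zero
  have hfull : ∀ F ∈ Γ, F.card = d → v ∈ F → a.support ⊆ F ∧ z F ≠ 0 := by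
    intro F hF hFd hvF
    by_contra hcon
    have h0 : (monomial (ind F) 1 : MvPolynomial (Fin n) k) • wz a z hz = 0 := by
      apply Subtype.ext
      rw [monomial_wz, one_smul]
      change _ = (0 : PT k n)
      rw [← hh_zero (ind F + a)]
      refine hh_full hΓ hFd hz (Submodule.zero_mem (Cyc k Γ d ∅)) ?_ ?_
      · have := (subset_of_add (Finset.Subset.refl (ind F + a).support)).1
        rwa [ind_support] at this
      · intro h
        by_contra h'
        exact hcon ⟨(subset_of_add h).2, h'⟩
    have h1 := congrArg (fun w => qc k Γ (Finsupp.single v 2 + ind F) (f w)) h0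
    simp only [map_smul, map_zero] at h1
    rw [qc_monomial_smul_add, one_mul] at h1
    · exact hne h1
    · have hm : (Finsupp.single v 2 + ind F).support ⊆ F :=
        add_support_subset (by rw [hs2]; simpa using hvF) (by rw [ind_support])
      exact Γ.lower hm hF
  have hinj : ∀ σ ∈ Γ, v ∈ σ → ∀ (y : Finset (Fin n) → k) (hy : y ∈ Cyc k Γ d (ind σ).support), y ≠ 0 →
      a ≤ ind σ + Finsupp.single v 2 ∧
      qc k Γ (ind σ + Finsupp.single v 2 - a) (f (wz (ind σ) y hy)) ≠ 0 := by
    intro σ hσ hv y hy hy0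
    obtain ⟨F, hF⟩ := Function.ne_iff.mp hy0
    have hFc := Cyc_ne hy hF
    have hσF : σ ⊆ F := by have := hFc.2.2; rwa [ind_support] at this
    obtain ⟨haF, hzF⟩ := hfull F hFc.1 hFc.2.1 (hσF hv)
    set r := y F / z F with hr
    have hr0 : r ≠ 0 := div_ne_zero hF hzF
    have h0 : (monomial (ind F + a) 1 : MvPolynomial (Fin n) k) • wz (ind σ) y hy =
        (monomial (ind F + ind σ) r : MvPolynomial (Fin n) k) • wz a z hz := by
      apply Subtype.ext
      rw [monomial_wz, monomial_wz, one_smul]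
      have e1 : ind F + ind σ + a = ind F + a + ind σ := by abel
      rw [e1]
      refine hh_full hΓ hFc.2.1 hy (Submodule.smul_mem _ r hz) ?_ ?_
      · have := (subset_of_add (subset_of_add (Finset.Subset.refl (ind F + a + ind σ).support)).1).1
        rwa [ind_support] at this
      · intro _
        rw [Pi.smul_apply, smul_eq_mul, hr, div_mul_cancel₀ _ hzF]
    have hm : (Finsupp.single v 2 + (ind F + ind σ)).support ∈ Γ := by
      have : (Finsupp.single v 2 + (ind F + ind σ)).support ⊆ F :=
        add_support_subset (by rw [hs2]; simpa using hσF hv)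
          (add_support_subset (by rw [ind_support]) (by rw [ind_support]; exact hσF))
      exact Γ.lower this hFc.1
    have h1 := congrArg (fun w => qc k Γ (Finsupp.single v 2 + (ind F + ind σ)) (f w)) h0
    simp only [map_smul] at h1
    rw [qc_monomial_smul_add _ _ hm, qc_monomial_smul] at h1
    have hrhs : r * qc k Γ (Finsupp.single v 2) (f (wz a z hz)) ≠ 0 := mul_ne_zero hr0 hne
    by_cases hle : ind F + a ≤ Finsupp.single v 2 + (ind F + ind σ)
    · have hle' : a ≤ ind σ + Finsupp.single v 2 := by
        intro i
        have := hle i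
        simp only [Finsupp.add_apply] at this ⊢
        omega
      rw [if_pos ⟨hle, hm⟩, one_mul] at h1
      refine ⟨hle', ?_⟩
      have e2 : Finsupp.single v 2 + (ind F + ind σ) - (ind F + a) = ind σ + Finsupp.single v 2 - a := by
        ext i
        simp only [Finsupp.tsub_apply, Finsupp.add_apply]
        omega
      rw [e2] at h1
      rw [h1]; exact hrhs
    · rw [if_neg (fun h => hle h.1)] at h1
      exact absurd h1.symm hrhs
  refine ⟨insert v a.support, rs (insert v a.support) z, Finset.mem_insert_self _ _,
    rs_mem (Finset.subset_insert _ _) hz, ?_, ?_⟩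
  · intro F hF hFd hvF
    obtain ⟨h1, h2⟩ := hfull F hF hFd hvF
    have h3 : insert v a.support ⊆ F := Finset.insert_subset hvF h1
    exact ⟨h3, by rw [rs, if_pos h3]; exact h2⟩
  · intro σ hσ hvσ y hy hy0
    have hy' : y ∈ Cyc k Γ d (ind σ).support := by rwa [ind_support]
    obtain ⟨hle, hL1⟩ := hinj σ hσ hvσ y hy' hy0
    have hB : insert v a.support ⊆ σ := by
      refine Finset.insert_subset hvσ fun i hi => ?_
      by_contra hiσ
      have h1 := hle i
      rw [Finsupp.add_apply, ind_apply, if_neg hiσ, Finsupp.single_apply, if_neg (by rintro rfl; exact hiσ hvσ)] at h1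
      have := Finsupp.mem_support_iff.mp hi
      omega
    refine ⟨hB, ?_⟩
    set ζ := rs (insert v a.support) z with hζ
    have hζc : ζ ∈ Cyc k Γ d (insert v a.support) := rs_mem (Finset.subset_insert _ _) hz
    have hx : rs σ ζ ∈ Cyc k Γ d (ind σ).support := by rw [ind_support]; exact rs_mem hB hζc
    have hx0 : rs σ ζ ≠ 0 := by
      obtain ⟨F, hF, hFd, hs⟩ := purity_facet hR hΓ hσ
      intro h
      have := congrFun h F
      rw [rs, if_pos hs, hζ, rs, if_pos (hB.trans hs)] at this
      exact (hfull F hF hFd (hs hvσ)).2 this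
    obtain ⟨-, hL2⟩ := hinj σ hσ hvσ _ hx hx0
    set L1 := qc k Γ (ind σ + Finsupp.single v 2 - a) (f (wz (ind σ) y hy')) with hL1d
    set L2 := qc k Γ (ind σ + Finsupp.single v 2 - a) (f (wz (ind σ) (rs σ ζ) hx)) with hL2d
    set c := L1 / L2 with hc
    have hdiff : y - c • rs σ ζ ∈ Cyc k Γ d (ind σ).support :=
      Submodule.sub_mem _ hy' (Submodule.smul_mem _ _ hx)
    have hzero : y - c • rs σ ζ = 0 := by
      by_contra hcon
      refine (hinj σ hσ hvσ _ hdiff hcon).2 ?_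
      have e : wz (ind σ) (y - c • rs σ ζ) hdiff =
          wz (ind σ) y hy' + (C (-c) : MvPolynomial (Fin n) k) • wz (ind σ) (rs σ ζ) hx := by
        apply Subtype.ext
        change hh _ _ = hh _ _ + (C (-c) : MvPolynomial (Fin n) k) • hh _ _
        rw [← hh_smul, ← hh_add, neg_smul, sub_eq_add_neg]
      rw [e, map_add, map_smul, C_smul_eq, map_add, map_smul, ← hL1d, ← hL2d, smul_eq_mul, hc, neg_mul,
        div_mul_cancel₀ _ hL2, add_neg_cancel]
    refine ⟨c, fun F hF => ?_⟩
    have := congrFun hzero F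
    rw [Pi.sub_apply, Pi.smul_apply, rs, if_pos hF, smul_eq_mul, Pi.zero_apply, sub_eq_zero] at this
    exact this

end TN

end PieceP9

section PieceP9b

open MvPolynomial

section TO

variable {k : Type} [Field k] {n : ℕ} {Γ : LowerSet (Finset (Fin n))} {d : ℕ}

lemma not_var (htr : trW k Γ d = quotMax k (mI k Γ) ^ 2) {v : Fin n} (hv : {v} ∈ Γ)
    (h : (xm Γ (Finsupp.single v 1) : Qr k Γ) ∈ trW k Γ d) : False := by
  classical
  rw [htr] at h
  have := (sq_coeff h).2 v
  rw [qc_xm, if_pos ⟨by rw [supp_single _ _ one_ne_zero]; exact hv, rfl⟩] at this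
  exact one_ne_zero this

lemma d_pos (h0 : ∅ ∈ Γ) (hΓ : ∀ F ∈ Γ, F.card ≤ d)
    (htr : trW k Γ d = quotMax k (mI k Γ) ^ 2) : 1 ≤ d := by
  classical
  by_contra hd
  have hd : d = 0 := by omega
  subst hd
  have hle : Γ ≤ LowerSet.Iic (∅ : Finset (Fin n)) := by
    intro F hF
    have := hΓ F hF
    have : F = ∅ := Finset.card_eq_zero.mp (by omega)
    rw [this]
    exact Finset.Subset.refl _
  let z : Finset (Fin n) → k := fun F => if F = ∅ then 1 else 0
  have hz : z ∈ Cyc k Γ 0 (0 : Fin n →₀ ℕ).support := by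
    refine ⟨fun F hF => ?_, fun G hG => by omega⟩
    change (if _ then _ else _) = _
    rw [if_neg]
    rintro rfl
    exact hF ⟨h0, rfl, by simp⟩
  let f : Wm k Γ 0 →ₗ[MvPolynomial (Fin n) k] Qr k Γ :=
    (pr hle) ∘ₗ (LinearMap.proj (R := MvPolynomial (Fin n) k) (φ := fun F : Finset (Fin n) => TT k F) ∅) ∘ₗ
      (Wm k Γ 0).subtype
  have h1 : f (wz 0 z hz) = xm Γ 0 := by
    change pr hle (hh 0 z ∅) = _
    have : z ∅ = 1 := if_pos rfl
    rw [hh_apply, this, C_1, one_smul, pr_xm]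
  have h2 : (xm Γ 0 : Qr k Γ) ∈ trW k Γ 0 := h1 ▸ mem_trW f _
  rw [htr] at h2
  have := (sq_coeff h2).1
  rw [qc_xm, if_pos ⟨by simpa using h0, rfl⟩] at this
  exact one_ne_zero this

lemma not_cone (hR : Reis k Γ d) (hΓ : ∀ F ∈ Γ, F.card ≤ d)
    (htr : trW k Γ d = quotMax k (mI k Γ) ^ 2) {u : Fin n} (hu : {u} ∈ Γ)
    {B : Finset (Fin n)} {ζ : Finset (Fin n) → k} (hD : Data k Γ d u B ζ)
    (hcone : ∀ F ∈ Γ, F.card = d → u ∈ F) : False := by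
  obtain ⟨F, hF, hFd, hs⟩ := purity_facet hR hΓ hu
  have huF := hcone F hF hFd
  have := trace_mem hR hΓ hD 0 (fun F hF hFd _ => hcone F hF hFd) (ind B) ζ
    (by rw [ind_support]; exact hD.cyc) F huF (hD.full F hF hFd huF).2
  rw [add_tsub_cancel_right, add_zero] at this
  exact not_var htr hu this

lemma claimA (hR : Reis k Γ d) (hΓ : ∀ F ∈ Γ, F.card ≤ d)
    (htr : trW k Γ d = quotMax k (mI k Γ) ^ 2)
    {B : Fin n → Finset (Fin n)} {ζ : Fin n → Finset (Fin n) → k}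
    (hD : ∀ v, {v} ∈ Γ → Data k Γ d v (B v) (ζ v)) (v : Fin n) (hv : {v} ∈ Γ) : B v = {v} := by
  classical
  by_contra hne
  obtain ⟨u, hu, huv⟩ : ∃ u ∈ B v, u ≠ v := by
    by_contra hcon
    push Not at hcon
    apply hne
    refine Finset.Subset.antisymm (fun i hi => by simp [hcon i hi]) (by simpa using (hD v hv).vB)
  have hvert : ∀ {F}, F ∈ Γ → ∀ {i}, i ∈ F → {i} ∈ Γ := by
    intro F hF i hi
    exact Γ.lower (by simpa using hi) hF
  have hpair : ∀ {F}, F ∈ Γ → ∀ {i j}, i ∈ F → j ∈ F → ({i, j} : Finset (Fin n)) ∈ Γ := by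
    intro F hF i j hi hj
    refine Γ.lower ?_ hF
    intro a ha; rw [Finset.mem_insert, Finset.mem_singleton] at ha
    rcases ha with rfl | rfl <;> assumption
  -- closure under adjacency
  have hclos : ∀ a b, a ≠ u → b ≠ u → ({a, b} : Finset (Fin n)) ∈ Γ → u ∈ B a → u ∈ B b := by
    intro a b hau hbu hab hua
    by_contra hub
    obtain ⟨F, hF, hFd, hs⟩ := purity_facet hR hΓ hab
    have haF : a ∈ F := hs (by simp)
    have hbF : b ∈ F := hs (by simp)
    have ha := hvert hF haF
    have hb := hvert hF hbF
    have hBb := (hD b hb).full F hF hFd hbF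
    have hsub : B b ⊆ F.erase u := fun i hi => Finset.mem_erase.mpr ⟨by rintro rfl; exact hub hi, hBb.1 hi⟩
    have hG : F.erase u ∈ Γ := Γ.lower (Finset.erase_subset _ _) hF
    have hz := rs_mem hsub (hD b hb).cyc
    have hz0 : rs (F.erase u) (ζ b) ≠ 0 := by
      intro h
      have := congrFun h F
      rw [rs, if_pos (Finset.erase_subset _ _)] at this
      exact hBb.2 this
    have := ((hD a ha).uniq _ hG (Finset.mem_erase.mpr ⟨hau, haF⟩) _ hz hz0).1 hua
    simp at this
  obtain ⟨F, hF, hFd, hs⟩ := purity_facet hR hΓ hv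
  have hvF : v ∈ F := by simpa using hs
  have hBF := (hD v hv).full F hF hFd hvF
  have huF := hBF.1 hu
  have huΓ := hvert hF huF
  have hd2 : 2 ≤ d := by
    rw [← hFd]
    exact Finset.one_lt_card.mpr ⟨u, huF, v, hvF, huv⟩
  rcases Nat.lt_or_ge 2 d with hd3 | hd3
  · -- d ≥ 3
    have hlk : ∀ w, w ≠ u → ({w, u} : Finset (Fin n)) ∈ Γ → u ∈ B w := by
      intro w hwu hw
      refine link_conn hR (σ := {u}) (by rw [Finset.card_singleton]; omega) {w | u ∈ B w} v hu
        ⟨by simpa using huv.symm, hpair hF hvF huF⟩ ?_ w (by simpa using hwu) hw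
      intro a b ha ha' hb' hab hΓab
      refine hclos a b (by simpa using ha') (by simpa using hb') (hpair hΓab ?_ ?_) ha <;> simp
    have hall : ∀ w, {w} ∈ Γ → w = u ∨ u ∈ B w := by
      intro w hw
      refine link_conn hR (σ := ∅) (by rw [Finset.card_empty]; omega) {w | w = u ∨ u ∈ B w} u (Or.inl rfl)
        ⟨by simp, by simpa using huΓ⟩ ?_ w (by simp) (by simpa using hw)
      intro a b ha _ _ hab hΓab
      have hab' : ({a, b} : Finset (Fin n)) ∈ Γ := hpair hΓab (by simp) (by simp)
      by_cases hb : b = u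
      · exact Or.inl hb
      right
      by_cases ha1 : a = u
      · subst ha1
        exact hlk b hb (by rw [Finset.pair_comm]; exact hab')
      · exact hclos a b ha1 hb hab' (ha.resolve_left ha1)
    refine not_cone hR hΓ htr huΓ (hD u huΓ) fun F' hF' hFd' => ?_
    obtain ⟨w, hw, hwu⟩ : ∃ w ∈ F', w ≠ u := Finset.exists_mem_ne (by omega) u
    exact ((hD w (hvert hF' hw)).full F' hF' hFd' hw).1 ((hall w (hvert hF' hw)).resolve_left hwu)
  · have hd : d = 2 := by omega
    subst hd
    have hsubF : ({u, v} : Finset (Fin n)) ⊆ F := by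
      intro a ha; rw [Finset.mem_insert, Finset.mem_singleton] at ha
      rcases ha with rfl | rfl <;> assumption
    have hFeq : ({u, v} : Finset (Fin n)) = F :=
      Finset.eq_of_subset_of_card_le hsubF (by rw [hFd, Finset.card_pair huv])
    have hBv : B v = {u, v} := by
      refine Finset.Subset.antisymm (hFeq ▸ hBF.1) ?_
      intro a ha; rw [Finset.mem_insert, Finset.mem_singleton] at ha
      rcases ha with rfl | rfl
      · exact hu
      · exact (hD _ hv).vB
    have hBuF := (hD u huΓ).full F hF hFd huF
    by_cases hvu : v ∈ B u
    · -- single edge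
      have hadj : ∀ a b, (a = u ∨ a = v) → ({a, b} : Finset (Fin n)) ∈ Γ → b = u ∨ b = v := by
        intro a b ha hab
        obtain ⟨F1, hF1, hF1d, hs1⟩ := purity_facet hR hΓ hab
        have ha1 : a ∈ F1 := hs1 (by simp)
        have hb1 : b ∈ F1 := hs1 (by simp)
        have hsub1 : ({u, v} : Finset (Fin n)) ⊆ F1 := by
          have : ({u, v} : Finset (Fin n)) ⊆ B a := by
            intro i hi; rw [Finset.mem_insert, Finset.mem_singleton] at hi
            rcases ha with rfl | rfl <;> rcases hi with rfl | rfl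
            · exact (hD _ huΓ).vB
            · exact hvu
            · exact hu
            · exact (hD _ hv).vB
          exact this.trans ((hD a (hvert hF1 ha1)).full F1 hF1 hF1d ha1).1
        have : ({u, v} : Finset (Fin n)) = F1 :=
          Finset.eq_of_subset_of_card_le hsub1 (by rw [hF1d, Finset.card_pair huv])
        rw [← this, Finset.mem_insert, Finset.mem_singleton] at hb1
        exact hb1
      have hall : ∀ w, {w} ∈ Γ → w = u ∨ w = v := by
        intro w hw
        refine link_conn hR (σ := ∅) (by rw [Finset.card_empty]) {w | w = u ∨ w = v} u (Or.inl rfl)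
          ⟨by simp, by simpa using huΓ⟩ ?_ w (by simp) (by simpa using hw)
        intro a b ha _ _ hab hΓab
        exact hadj a b ha (hpair hΓab (by simp) (by simp))
      refine not_cone hR hΓ htr huΓ (hD u huΓ) fun F' hF' hFd' => ?_
      obtain ⟨w, hw, hwv⟩ : ∃ w ∈ F', w ≠ v := Finset.exists_mem_ne (by omega) v
      rwa [(hall w (hvert hF' hw)).resolve_right hwv] at hw
    · have hBu : B u = {u} := by
        refine Finset.Subset.antisymm (fun i hi => ?_) (by simpa using (hD u huΓ).vB)
        have := hBuF.1 hi
        rw [← hFeq, Finset.mem_insert, Finset.mem_singleton] at this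
        rcases this with rfl | rfl
        · simp
        · exact absurd hi hvu
      have := trace_mem hR hΓ (hD v hv) (Finsupp.single v 1) (fun F _ _ h => by
        rw [supp_single _ _ one_ne_zero] at h; simpa using h) (Finsupp.single u 1) (ζ u)
        (by rw [supp_single _ _ one_ne_zero, ← hBu]; exact (hD u huΓ).cyc) F hvF hBuF.2
      have e : Finsupp.single v 1 + Finsupp.single u 1 - ind (B v) = 0 := by
        ext i
        rw [hBv, Finsupp.tsub_apply, ind_apply, Finsupp.add_apply, Finsupp.single_apply, Finsupp.single_apply]
        by_cases h1 : v = i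
        · subst h1; simp [huv]
        · by_cases h2 : u = i
          · subst h2; simp [h1]
          · simp [h1, h2]
      rw [e, zero_add] at this
      exact not_var htr hv this

theorem forward (hR : Reis k Γ d) (hΓ : ∀ F ∈ Γ, F.card ≤ d) (h0 : ∅ ∈ Γ)
    (htr : trW k Γ d = quotMax k (mI k Γ) ^ 2) :
    2 ≤ d ∧ (∀ z ∈ Cyc k Γ d ∅, z = 0) ∧ ∀ σ ∈ Γ, σ ≠ ∅ → OneDim k Γ d σ := by
  classical
  have hd1 := d_pos h0 hΓ htr
  have hex : ∀ v, ∃ B ζ, {v} ∈ Γ → Data k Γ d v B ζ := by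
    intro v
    by_cases hv : {v} ∈ Γ
    · have hsq : (xm Γ (Finsupp.single v 2) : Qr k Γ) ∈ trW k Γ d := by
        rw [htr, sq_eq]
        refine Ideal.subset_span ⟨v, v, ?_⟩
        rw [← Finsupp.single_add]
      obtain ⟨f, c, z, hz, h⟩ := trW_witness (Finsupp.single v 2) _ hsq (by
        rw [qc_xm, if_pos ⟨by rw [supp_single _ _ two_ne_zero]; exact hv, rfl⟩]; exact one_ne_zero)
      obtain ⟨B, ζ, hD⟩ := data_of hR hΓ v f c z hz h
      exact ⟨B, ζ, fun _ => hD⟩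
    · exact ⟨∅, 0, fun h => absurd h hv⟩
  choose B ζ hD' using hex
  have hD : ∀ v, {v} ∈ Γ → Data k Γ d v {v} (ζ v) := by
    intro v hv
    have := hD' v hv
    rwa [claimA hR hΓ htr hD' v hv] at this
  have hB : ∀ z ∈ Cyc k Γ d ∅, z = 0 := by
    intro z hz
    by_contra hz0
    obtain ⟨F, hF⟩ := Function.ne_iff.mp hz0
    have hFc := Cyc_ne hz hF
    obtain ⟨v, hv⟩ : F.Nonempty := Finset.card_pos.mp (by omega)
    have hvΓ : {v} ∈ Γ := Γ.lower (by simpa using hv) hFc.1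
    have := trace_mem hR hΓ (hD v hvΓ) (Finsupp.single v 1) (fun F _ _ h => by
        rw [supp_single _ _ one_ne_zero] at h; simpa using h) 0 z (by simpa using hz) F hv hF
    rw [add_zero, ind_singleton, tsub_self, zero_add] at this
    exact not_var htr hvΓ this
  refine ⟨?_, hB, ?_⟩
  · by_contra hd2
    have hd : d = 1 := by omega
    subst hd
    obtain ⟨F, hF, hFd, -⟩ := purity_facet hR hΓ h0
    obtain ⟨u, rfl⟩ := Finset.card_eq_one.mp hFd
    refine not_cone hR hΓ htr hF (hD u hF) fun F' hF' hFd' => ?_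
    obtain ⟨w, rfl⟩ := Finset.card_eq_one.mp hFd'
    rw [Finset.mem_singleton]
    by_contra huw
    let z : Finset (Fin n) → k := fun G => if G = {u} then eps k u ∅ else
        if G = {w} then - eps k w ∅ else 0
    have e1 : z {u} = eps k u ∅ := if_pos rfl
    have e2 : z {w} = - eps k w ∅ := by
      change (if _ then _ else _) = _
      rw [if_neg (by rw [Finset.singleton_inj]; exact Ne.symm huw), if_pos rfl]
    have hz : z ∈ Cyc k Γ 1 ∅ := by
      refine ⟨fun G hG => ?_, fun G hG _ => ?_⟩
      · change (if _ then _ else _) = _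
        rw [if_neg, if_neg]
        · rintro rfl; exact hG ⟨hF', hFd', by simp⟩
        · rintro rfl; exact hG ⟨hF, hFd, by simp⟩
      · have hG0 : G = ∅ := Finset.card_eq_zero.mp (by omega)
        subst hG0
        have hsub : ({u, w} : Finset (Fin n)) ⊆ ∅ᶜ := by simp
        rw [← Finset.sum_subset hsub, Finset.sum_pair huw]
        · rw [insert_empty_eq, insert_empty_eq, e1, e2, eps_sq, mul_neg, eps_sq, add_neg_cancel]
        · intro i _ hi
          rw [Finset.mem_insert, Finset.mem_singleton, not_or] at hi
          have : z {i} = 0 := by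
            change (if _ then _ else _) = _
            rw [if_neg (by rw [Finset.singleton_inj]; exact hi.1), if_neg (by rw [Finset.singleton_inj]; exact hi.2)]
          rw [insert_empty_eq, this, mul_zero]
    have := congrFun (hB z hz) {u}
    rw [e1] at this
    exact eps_ne_zero k u ∅ this
  · intro σ hσ hσ0
    obtain ⟨v, hv⟩ := Finset.nonempty_iff_ne_empty.mpr hσ0
    have hvs : {v} ⊆ σ := by simpa using hv
    have hvΓ : {v} ∈ Γ := Γ.lower hvs hσ
    obtain ⟨F, hF, hFd, hs⟩ := purity_facet hR hΓ hσ
    refine ⟨⟨rs σ (ζ v), rs_mem hvs (hD v hvΓ).cyc, fun h => ?_⟩, fun x hx y hy hx0 => ?_⟩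
    · have := congrFun h F
      rw [rs, if_pos hs] at this
      exact ((hD v hvΓ).full F hF hFd (hs hv)).2 this
    · by_cases hy0 : y = 0
      · exact ⟨0, by rw [hy0, zero_smul]⟩
      obtain ⟨-, r, hr⟩ := (hD v hvΓ).uniq σ hσ hv x hx hx0
      obtain ⟨-, r', hr'⟩ := (hD v hvΓ).uniq σ hσ hv y hy hy0
      have hr0 : r ≠ 0 := by
        rintro rfl
        apply hx0
        funext G
        by_cases hG : σ ⊆ G
        · rw [hr G hG, zero_mul]; rfl
        · exact hx.1 G fun h => hG h.2.2
      refine ⟨r' / r, funext fun G => ?_⟩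
      rw [Pi.smul_apply, smul_eq_mul]
      by_cases hG : σ ⊆ G
      · rw [hr G hG, hr' G hG, ← mul_assoc, div_mul_cancel₀ _ hr0]
      · rw [hx.1 G (fun h => hG h.2.2), hy.1 G (fun h => hG h.2.2), mul_zero]

end TO

end PieceP9b

section PieceP7a

section TP7

variable {k : Type} [Field k] {n : ℕ}

lemma relB_apply (Δ : SC n) (i : ℕ) (z : Finset (Fin n) → k) (hz : ∀ F, F ∉ Δ.faces → z F = 0)
    (ρ : Δ.RFace ∅ i) :
    Δ.relBoundary k ∅ i (fun τ => z τ.1) ρ = ∑ v ∈ ρ.1ᶜ, eps k v ρ.1 * z (insert v ρ.1) := by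
  have h1 : Δ.relBoundary k ∅ i (fun τ => z τ.1) ρ = ∑ τ : Δ.RFace ∅ (i+1), ∑ v : Fin n,
      if v ∈ τ.1 ∧ τ.1.erase v = ρ.1 then eps k v τ.1 * z τ.1 else 0 := by
    change ∑ τ : Δ.RFace ∅ (i+1), Δ.relBMat k ∅ i ρ τ * z τ.1 = _
    refine Finset.sum_congr rfl fun τ _ => ?_
    rw [SC.relBMat, Finset.sum_mul, ← Finset.sum_subset (Finset.subset_univ τ.1)]
    · refine Finset.sum_congr rfl fun v hv => ?_
      by_cases h : τ.1.erase v = ρ.1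
      · rw [if_pos ⟨by simp, h⟩, if_pos ⟨hv, h⟩]; rfl
      · rw [if_neg (fun h' => h h'.2), if_neg (fun h' => h h'.2), zero_mul]
    · intro v _ hv
      rw [if_neg (fun h' => hv h'.1)]
  rw [h1, Finset.sum_comm, ← Finset.sum_subset (Finset.subset_univ ρ.1ᶜ)]
  · refine Finset.sum_congr rfl fun v hv => ?_
    rw [Finset.mem_compl] at hv
    by_cases hf : insert v ρ.1 ∈ Δ.faces
    · refine (Finset.sum_eq_single (⟨insert v ρ.1, hf, by simp, by
        rw [Finset.card_insert_of_notMem hv, ρ.2.2.2]⟩ : Δ.RFace ∅ (i+1)) ?_ ?_).trans ?_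
      · intro τ _ hne
        rw [if_neg]
        rintro ⟨h2, h3⟩
        apply hne
        apply Subtype.ext
        change τ.1 = insert v ρ.1
        rw [← h3, Finset.insert_erase h2]
      · intro h; exact absurd (Finset.mem_univ _) h
      · rw [if_pos ⟨Finset.mem_insert_self _ _, Finset.erase_insert hv⟩]
        simp only [eps_insert_self]
    · rw [hz _ hf, mul_zero]
      refine Finset.sum_eq_zero fun τ _ => ?_
      rw [if_neg]
      rintro ⟨h2, h3⟩
      apply hf
      rw [← h3, Finset.insert_erase h2]
      exact τ.2.1
  · intro v _ hv
    refine Finset.sum_eq_zero fun τ _ => ?_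
    rw [if_neg]
    rintro ⟨h2, h3⟩
    apply hv
    rw [Finset.mem_compl, ← h3]
    simp

lemma relBT_apply (Δ : SC n) (i : ℕ) (f : Finset (Fin n) → k) (τ : Δ.RFace ∅ (i+1)) :
    ∑ ρ : Δ.RFace ∅ i, Δ.relBMat k ∅ i ρ τ * f ρ.1 = ∑ v ∈ τ.1, eps k v τ.1 * f (τ.1.erase v) := by
  simp only [SC.relBMat, Finset.sum_mul]
  rw [Finset.sum_comm]
  refine Finset.sum_congr rfl fun v hv => ?_
  refine (Finset.sum_eq_single (⟨τ.1.erase v, Δ.down_closed τ.2.1 (Finset.erase_subset _ _), by simp, by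
        rw [Finset.card_erase_of_mem hv, τ.2.2.2]; rfl⟩ : Δ.RFace ∅ i) ?_ ?_).trans ?_
  · intro ρ _ hne
    rw [if_neg, zero_mul]
    rintro ⟨_, h3⟩
    exact hne (Subtype.ext h3.symm)
  · intro h; exact absurd (Finset.mem_univ _) h
  · rw [if_pos ⟨by simp, rfl⟩]; rfl

open Classical in
/-- extension by zero -/
noncomputable def ext0 (Δ : SC n) (i : ℕ) (x : Δ.relChain k ∅ i) : Finset (Fin n) → k :=
  fun F => if h : F ∈ Δ.faces ∧ ∅ ⊆ F ∧ F.card = i then x ⟨F, h⟩ else 0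

lemma ext0_coe (Δ : SC n) (i : ℕ) (x : Δ.relChain k ∅ i) : (fun τ : Δ.RFace ∅ i => ext0 Δ i x τ.1) = x := by
  funext τ
  change dite _ _ _ = _
  rw [dif_pos τ.2]
  rfl

lemma ext0_zero (Δ : SC n) (i : ℕ) (x : Δ.relChain k ∅ i) (F : Finset (Fin n))
    (h : ¬ (F ∈ Δ.faces ∧ F.card = i)) : ext0 Δ i x F = 0 :=
  dif_neg fun h' => h ⟨h'.1, h'.2.2⟩

lemma exact_dual {a b c : Type} [Fintype a] [Fintype b] [Fintype c] (A : Matrix a b k) (B : Matrix b c k)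
    (h : ∀ f : b → k, (∀ t, ∑ s, B s t * f s = 0) → ∃ g : a → k, ∀ s, f s = ∑ r, A r s * g r)
    (x : b → k) (hx : A.mulVecLin x = 0) : x ∈ LinearMap.range B.mulVecLin := by
  classical
  by_contra hn
  obtain ⟨φ, h1, h2⟩ := Submodule.exists_le_ker_of_notMem hn
  have hφ : ∀ y : b → k, φ y = ∑ s, y s * φ (Pi.single s 1) := by
    intro y
    conv_lhs => rw [← Finset.univ_sum_single y]
    rw [map_sum]
    refine Finset.sum_congr rfl fun s _ => ?_
    rw [← smul_eq_mul, ← map_smul]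
    congr 1
    rw [← Pi.single_smul, smul_eq_mul, mul_one]
  obtain ⟨g, hg⟩ := h (fun s => φ (Pi.single s 1)) (by
    intro t
    have : φ (B.mulVecLin (Pi.single t 1)) = 0 := h2 ⟨_, rfl⟩
    rw [hφ] at this
    rw [← this]
    refine Finset.sum_congr rfl fun s _ => ?_
    simp)
  apply h1
  rw [hφ]
  simp only [hg, Finset.mul_sum]
  rw [Finset.sum_comm]
  refine Finset.sum_eq_zero fun r _ => ?_
  have := congrFun hx r
  change ∑ s, A r s * x s = 0 at this
  calc _ = g r * ∑ s, A r s * x s := by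
        rw [Finset.mul_sum]; exact Finset.sum_congr rfl fun s _ => by ring
    _ = 0 := by rw [this, mul_zero]

variable (k) in
/-- Reis at the empty face -/
def Reis0 (Γ : LowerSet (Finset (Fin n))) (d : ℕ) : Prop :=
  ∀ (p : ℕ), p < d → ∀ (f : Finset (Fin n) → k),
    (∀ σ ∈ Γ, σ.card = p+1 → ∑ v ∈ σ, eps k v σ * f (σ.erase v) = 0) →
    ∃ g : Finset (Fin n) → k, ∀ σ ∈ Γ, σ.card = p → f σ = ∑ v ∈ σ, eps k v σ * g (σ.erase v)

lemma red_sub_of_reis (Δ : SC n) (e i : ℕ) (hR : Reis0 k Δ.low e) (hi : i + 1 < e) :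
    Subsingleton (Δ.reducedHomology k i) := by
  rw [SC.reducedHomology, SC.relHomology, Submodule.Quotient.subsingleton_iff, eq_top_iff]
  rintro ⟨x, hx⟩ _
  rw [Submodule.mem_comap]
  refine exact_dual (Δ.relBMat k ∅ i) (Δ.relBMat k ∅ (i+1)) ?_ x hx
  intro f hf
  obtain ⟨g, hg⟩ := hR (i+1) hi (ext0 Δ (i+1) f) (by
    intro σ hσ hc
    rw [SC.mem_low] at hσ
    have := relBT_apply Δ (i+1) (ext0 Δ (i+1) f) ⟨σ, hσ, by simp, hc⟩
    rw [← this, ← hf ⟨σ, hσ, by simp, hc⟩]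
    refine Finset.sum_congr rfl fun s _ => ?_
    rw [← congrFun (ext0_coe Δ (i+1) f) s])
  refine ⟨fun ρ => g ρ.1, fun s => ?_⟩
  rw [relBT_apply, ← hg s.1 ((SC.mem_low).2 s.2.1) s.2.2.2, ← congrFun (ext0_coe Δ (i+1) f) s]

lemma red_sub_of_large (Δ : SC n) (i : ℕ) (hi : ∀ F ∈ Δ.faces, F.card < i + 1) :
    Subsingleton (Δ.reducedHomology k i) := by
  have : IsEmpty (Δ.RFace ∅ (i+1)) := ⟨fun τ => by have := hi _ τ.2.1; have := τ.2.2.2; omega⟩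
  rw [SC.reducedHomology, SC.relHomology, Submodule.Quotient.subsingleton_iff, eq_top_iff]
  rintro ⟨x, hx⟩ _
  rw [Submodule.mem_comap]
  refine ⟨0, ?_⟩
  exact Subsingleton.elim _ _

lemma range_bot (Δ : SC n) (i : ℕ) (hi : ∀ F ∈ Δ.faces, F.card ≤ i) :
    LinearMap.range (Δ.relBoundary k ∅ i) = ⊥ := by
  have : IsEmpty (Δ.RFace ∅ (i+1)) := ⟨fun τ => by have := hi _ τ.2.1; have := τ.2.2.2; omega⟩
  rw [eq_bot_iff]
  rintro _ ⟨y, rfl⟩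
  rw [Subsingleton.elim y 0, map_zero]
  exact Submodule.zero_mem _

/-- top cycles -/
noncomputable def kerCyc (Δ : SC n) (i : ℕ) :
    LinearMap.ker (Δ.relBoundary k ∅ i) ≃ₗ[k] Cyc k Δ.low (i+1) ∅ where
  toFun x := ⟨ext0 Δ (i+1) x.1, by
    refine ⟨fun F hF => ext0_zero _ _ _ _ fun h => hF ⟨(SC.mem_low).2 h.1, h.2, by simp⟩, fun G hG _ => ?_⟩
    by_cases hf : G ∈ Δ.faces
    · have := relB_apply Δ i (ext0 Δ (i+1) x.1) (fun F hF => ext0_zero _ _ _ _ fun h => hF h.1)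
        ⟨G, hf, by simp, by omega⟩
      rw [← this, ext0_coe, LinearMap.mem_ker.1 x.2]
      rfl
    · refine Finset.sum_eq_zero fun v _ => ?_
      rw [ext0_zero, mul_zero]
      rintro ⟨h, _⟩
      exact hf (Δ.down_closed h (Finset.subset_insert _ _))⟩
  invFun z := ⟨fun τ => z.1 τ.1, by
    rw [LinearMap.mem_ker]
    funext ρ
    rw [relB_apply Δ i z.1 (fun F hF => z.2.1 F fun h => hF ((SC.mem_low).1 h.1)) ρ]
    exact z.2.2 ρ.1 (by rw [ρ.2.2.2]) (by simp)⟩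
  left_inv x := Subtype.ext (ext0_coe _ _ _)
  right_inv z := by
    apply Subtype.ext
    funext F
    change ext0 (k := k) Δ (i+1) _ F = z.1 F
    by_cases h : F ∈ Δ.faces ∧ F.card = i+1
    · exact congrFun (ext0_coe (k := k) Δ (i+1) (fun τ : Δ.RFace ∅ (i+1) => z.1 τ.1)) ⟨F, h.1, by simp, h.2⟩
    · rw [ext0_zero _ _ _ _ h, z.2.1 F fun h' => h ⟨(SC.mem_low).1 h'.1, h'.2.1⟩]
  map_add' x y := by
    apply Subtype.ext
    funext F
    change ext0 (k := k) Δ (i+1) _ F = ext0 Δ (i+1) _ F + ext0 Δ (i+1) _ F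
    unfold ext0
    split_ifs
    · rfl
    · simp
  map_smul' c x := by
    apply Subtype.ext
    funext F
    change ext0 (k := k) Δ (i+1) _ F = c * ext0 Δ (i+1) _ F
    unfold ext0
    split_ifs
    · rfl
    · simp

lemma red_equiv (Δ : SC n) (i : ℕ) (hi : ∀ F ∈ Δ.faces, F.card ≤ i+1) :
    Nonempty (Δ.reducedHomology k i ≃ₗ[k] Cyc k Δ.low (i+1) ∅) := by
  refine ⟨LinearEquiv.trans (Submodule.quotEquivOfEqBot _ ?_) (kerCyc Δ i)⟩
  rw [range_bot Δ (i+1) hi, eq_bot_iff]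
  rintro ⟨x, hx⟩ h
  rw [Submodule.mem_comap] at h
  rw [Submodule.mem_bot]
  exact Subtype.ext ((Submodule.mem_bot k).1 h)

lemma oneDim_iff {Γ : LowerSet (Finset (Fin n))} {d : ℕ} {σ : Finset (Fin n)} :
    OneDim k Γ d σ ↔ Nonempty (Cyc k Γ d σ ≃ₗ[k] k) := by
  constructor
  · rintro ⟨⟨z, hz, hz0⟩, h⟩
    have : Module.finrank k (Cyc k Γ d σ) = 1 := by
      refine finrank_eq_one (⟨z, hz⟩ : Cyc k Γ d σ) (fun h => hz0 (congrArg Subtype.val h)) fun w => ?_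
      obtain ⟨c, hc⟩ := h z hz w.1 w.2 hz0
      exact ⟨c, Subtype.ext hc.symm⟩
    have hfin := Module.finite_of_finrank_eq_succ this
    exact ⟨LinearEquiv.ofFinrankEq _ _ (by rw [this, Module.finrank_self])⟩
  · rintro ⟨e⟩
    refine ⟨⟨(e.symm 1).1, (e.symm 1).2, fun h => ?_⟩, fun x hx y hy hx0 => ?_⟩
    · have : e.symm 1 = 0 := Subtype.ext h
      rw [LinearEquiv.map_eq_zero_iff] at this
      exact one_ne_zero this
    · have h1 : e ⟨x, hx⟩ ≠ 0 := fun h => hx0 (by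
        rw [LinearEquiv.map_eq_zero_iff] at h
        exact congrArg Subtype.val h)
      refine ⟨e ⟨y, hy⟩ / e ⟨x, hx⟩, ?_⟩
      have : (⟨y, hy⟩ : Cyc k Γ d σ) = (e ⟨y, hy⟩ / e ⟨x, hx⟩) • ⟨x, hx⟩ := by
        apply e.injective
        rw [map_smul, smul_eq_mul, div_mul_cancel₀ _ h1]
      exact congrArg Subtype.val this

end TP7

end PieceP7a

section PieceP7b

section TP7b

variable {k : Type} [Field k] {n : ℕ}

lemma redneg_sub (Δ : SC n) (v : Fin n) (hv : {v} ∈ Δ.faces) : Subsingleton (Δ.reducedHomologyNeg k) := by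
  rw [SC.reducedHomologyNeg, Submodule.Quotient.subsingleton_iff, eq_top_iff]
  rintro ⟨x, hx⟩ _
  rw [Submodule.mem_comap]
  refine ⟨fun τ => (fun F : Finset (Fin n) => if F = {v} then ext0 Δ 0 x ∅ else 0) τ.1, ?_⟩
  funext ρ
  have hρ : ρ.1 = ∅ := Finset.card_eq_zero.1 ρ.2.2.2
  refine (relB_apply Δ 0 (fun F : Finset (Fin n) => if F = {v} then ext0 Δ 0 x ∅ else 0) ?_ ρ).trans ?_
  · intro F hF
    exact if_neg fun h : F = {v} => hF (h ▸ hv)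
  · rw [hρ, Finset.sum_eq_single v]
    · rw [if_pos (by simp)]
      change _ = x ρ
      rw [← congrFun (ext0_coe Δ 0 x) ρ, hρ]
      simp [eps]
    · intro w _ hw
      rw [if_neg, mul_zero]
      intro h
      apply hw
      simpa using h
    · intro h; simp at h

lemma neg_equiv (Δ : SC n) (h : ∀ F ∈ Δ.faces, F.card ≤ 0) : Nonempty (Δ.reducedHomologyNeg k ≃ₗ[k] k) := by
  let u : Unique (Δ.RFace ∅ 0) :=
    { default := ⟨∅, Δ.empty_mem, by simp, rfl⟩
      uniq := fun ρ => Subtype.ext (Finset.card_eq_zero.1 ρ.2.2.2) }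
  refine ⟨LinearEquiv.trans (Submodule.quotEquivOfEqBot _ ?_) (LinearEquiv.trans Submodule.topEquiv (LinearEquiv.funUnique (Δ.RFace ∅ 0) k k))⟩
  rw [range_bot Δ 0 h, eq_bot_iff]
  rintro ⟨x, hx⟩ h
  rw [Submodule.mem_comap] at h
  rw [Submodule.mem_bot]
  exact Subtype.ext ((Submodule.mem_bot k).1 h)

lemma oneDim_card {Γ : LowerSet (Finset (Fin n))} {d : ℕ} {σ : Finset (Fin n)} (hσ : σ ∈ Γ) (hc : σ.card = d) :
    OneDim k Γ d σ := by
  have key : ∀ x ∈ Cyc k Γ d σ, ∀ F, F ≠ σ → x F = 0 := by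
    intro x hx F hF
    refine hx.1 F fun h => hF ?_
    exact (Finset.eq_of_subset_of_card_le h.2.2 (by rw [hc, h.2.1])).symm
  refine ⟨⟨Pi.single σ 1, ⟨fun F hF => ?_, fun G hG hs => ?_⟩, ?_⟩, ?_⟩
  · rw [Pi.single_apply, if_neg]
    rintro rfl
    exact hF ⟨hσ, hc, Finset.Subset.refl _⟩
  · have := Finset.card_le_card hs
    omega
  · intro h
    have := congrFun h σ
    simp at this
  · intro x hx y hy hx0
    have h1 : x σ ≠ 0 := by
      intro h
      apply hx0
      funext F
      by_cases hF : F = σ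
      · rw [hF, h]; rfl
      · exact key x hx F hF
    refine ⟨y σ / x σ, ?_⟩
    funext F
    by_cases hF : F = σ
    · rw [hF, Pi.smul_apply, smul_eq_mul, div_mul_cancel₀ _ h1]
    · rw [Pi.smul_apply, key x hx F hF, key y hy F hF, smul_zero]

lemma sphere_iff (Δ : SC n) (e : ℕ) (he : Δ.faces.sup Finset.card = e) (hR : Reis0 k Δ.low e) :
    SC.HomologySphereCond k Δ ↔ OneDim k Δ.low e ∅ := by
  have hle : ∀ F ∈ Δ.faces, F.card ≤ e := fun F hF => by
    rw [← he]; exact Finset.le_sup (f := Finset.card) hF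
  have hdim : Δ.dim = (e : ℤ) - 1 := by rw [SC.dim, he]
  have hvert : e ≠ 0 → ∃ v : Fin n, {v} ∈ Δ.faces := by
    intro h0
    obtain ⟨F, hF, hFc⟩ := Finset.exists_mem_eq_sup Δ.faces ⟨∅, Δ.empty_mem⟩ Finset.card
    have : F.Nonempty := by
      rw [← Finset.card_pos]; omega
    obtain ⟨v, hv⟩ := this
    exact ⟨v, Δ.down_closed hF (by simpa using hv)⟩
  rw [oneDim_iff]
  constructor
  · rintro ⟨h1, _⟩
    rcases Nat.eq_zero_or_pos e with h0 | h0
    · subst h0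
      exact oneDim_iff.1 (oneDim_card ((SC.mem_low).2 Δ.empty_mem) rfl)
    · obtain ⟨i, rfl⟩ : ∃ i, e = i + 1 := ⟨e - 1, by omega⟩
      obtain ⟨g⟩ := (h1 i).1 (by rw [hdim]; push_cast; ring)
      obtain ⟨g'⟩ := red_equiv (k := k) Δ i hle
      exact ⟨g'.symm.trans g⟩
  · rintro ⟨g⟩
    refine ⟨fun i => ⟨fun hi => ?_, fun hi => ?_⟩, fun h => ?_, fun h => ?_⟩
    · obtain rfl : e = i + 1 := by omega
      obtain ⟨g'⟩ := red_equiv (k := k) Δ i hle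
      exact ⟨g'.trans g⟩
    · rcases lt_or_ge (i+1) e with h | h
      · exact red_sub_of_reis Δ e i hR h
      · refine red_sub_of_large Δ i fun F hF => ?_
        have := hle F hF
        omega
    · exact neg_equiv Δ fun F hF => by have := hle F hF; omega
    · obtain ⟨v, hv⟩ := hvert (by omega)
      exact redneg_sub Δ v hv

lemma eps_union {v : Fin n} {τ σ : Finset (Fin n)} (h : Disjoint τ σ) :
    eps k v (τ ∪ σ) = eps k v τ * eps k v σ := by
  rw [eps, eps, eps, Finset.filter_union, Finset.card_union_of_disjoint, pow_add]
  exact Finset.disjoint_filter_filter h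

variable (k) in
/-- sign -/
def sg (σ τ : Finset (Fin n)) : k := ∏ v ∈ τ, eps k v σ

lemma sg_sq (σ τ : Finset (Fin n)) : sg k σ τ * sg k σ τ = 1 := by
  rw [sg, ← Finset.prod_mul_distrib]
  exact Finset.prod_eq_one fun v _ => eps_sq k v σ

lemma sg_insert {σ τ : Finset (Fin n)} {v : Fin n} (hv : v ∉ τ) :
    sg k σ (insert v τ) = eps k v σ * sg k σ τ := Finset.prod_insert hv

lemma sg_erase {σ τ : Finset (Fin n)} {v : Fin n} (hv : v ∈ τ) :
    sg k σ τ = eps k v σ * sg k σ (τ.erase v) := by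
  rw [← sg_insert (Finset.notMem_erase v τ), Finset.insert_erase hv]

lemma mem_link {Δ : SC n} {σ : Finset (Fin n)} {hσ : σ ∈ Δ.faces} {τ : Finset (Fin n)} :
    τ ∈ (Δ.link σ hσ).low ↔ Disjoint τ σ ∧ τ ∪ σ ∈ Δ.low := by
  rw [SC.mem_low, SC.mem_low, SC.link, Finset.mem_filter, Finset.disjoint_iff_inter_eq_empty]
  exact ⟨fun h => h.2, fun h => ⟨Δ.down_closed h.2 Finset.subset_union_left, h⟩⟩

lemma link_reis {Δ : SC n} {d : ℕ} (hR : Reis k Δ.low d) {σ : Finset (Fin n)} (hσ : σ ∈ Δ.faces) :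
    Reis0 k (Δ.link σ hσ).low (d - σ.card) := by
  intro p hp f hf
  have e1 : ∀ τ : Finset (Fin n), Disjoint τ σ → (τ ∪ σ) \ σ = τ := fun τ h => by
    rw [Finset.union_sdiff_right, Finset.sdiff_eq_self_of_disjoint h]
  have e2 : ∀ (τ : Finset (Fin n)) (v : Fin n), Disjoint τ σ → v ∈ τ → (τ ∪ σ).erase v = τ.erase v ∪ σ := by
    intro τ v h hv
    rw [Finset.erase_union_distrib, Finset.erase_eq_of_notMem (Finset.disjoint_left.1 h hv)]
  have e3 : ∀ (τ : Finset (Fin n)) (v : Fin n), Disjoint τ σ → Disjoint (τ.erase v) σ :=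
    fun τ v h => Finset.disjoint_of_subset_left (Finset.erase_subset _ _) h
  obtain ⟨G, hG⟩ := hR σ (p + σ.card) (by omega) (fun ρ => sg k σ (ρ \ σ) * f (ρ \ σ)) (by
    intro ρ hρ hc hs
    have hd : Disjoint (ρ \ σ) σ := Finset.sdiff_disjoint
    have hu : ρ \ σ ∪ σ = ρ := Finset.sdiff_union_of_subset hs
    have h1 := hf (ρ \ σ) (mem_link.2 ⟨hd, by rwa [hu]⟩) (by
      rw [Finset.card_sdiff_of_subset hs]; omega)
    rw [← mul_zero (sg k σ (ρ \ σ)), ← h1, Finset.mul_sum]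
    refine Finset.sum_congr rfl fun v hv => ?_
    have h2 : ρ.erase v \ σ = (ρ \ σ).erase v := by
      rw [Finset.erase_sdiff_comm]
    rw [h2, sg_erase hv]
    conv_lhs => rw [← hu, eps_union hd]
    rw [hu]
    ring)
  refine ⟨fun τ => sg k σ τ * G (τ ∪ σ), fun τ hτ hc => ?_⟩
  obtain ⟨hd, hf'⟩ := mem_link.1 hτ
  have h1 := hG (τ ∪ σ) hf' (by rw [Finset.card_union_of_disjoint hd, hc]) Finset.subset_union_right
  simp only [e1 τ hd] at h1
  have h2 : f τ = sg k σ τ * (sg k σ τ * f τ) := by rw [← mul_assoc, sg_sq, one_mul]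
  rw [h2, h1, Finset.mul_sum]
  refine Finset.sum_congr rfl fun v hv => ?_
  rw [e2 τ v hd hv, eps_union hd, sg_erase hv]
  linear_combination (eps k v τ * sg k σ (τ.erase v) * G (τ.erase v ∪ σ)) * eps_sq k v σ

/-- to the link -/
def toLk (σ : Finset (Fin n)) (z : Finset (Fin n) → k) (τ : Finset (Fin n)) : k :=
  if Disjoint τ σ then sg k σ τ * z (τ ∪ σ) else 0

lemma toLk_pos {σ : Finset (Fin n)} {z : Finset (Fin n) → k} {τ : Finset (Fin n)} (h : Disjoint τ σ) :
    toLk σ z τ = sg k σ τ * z (τ ∪ σ) := if_pos h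

lemma toLk_neg {σ : Finset (Fin n)} {z : Finset (Fin n) → k} {τ : Finset (Fin n)} (h : ¬ Disjoint τ σ) :
    toLk σ z τ = 0 := if_neg h

/-- from the link -/
def frLk (σ : Finset (Fin n)) (y : Finset (Fin n) → k) (F : Finset (Fin n)) : k :=
  if σ ⊆ F then sg k σ (F \ σ) * y (F \ σ) else 0

lemma frLk_pos {σ : Finset (Fin n)} {y : Finset (Fin n) → k} {F : Finset (Fin n)} (h : σ ⊆ F) :
    frLk σ y F = sg k σ (F \ σ) * y (F \ σ) := if_pos h

lemma frLk_neg {σ : Finset (Fin n)} {y : Finset (Fin n) → k} {F : Finset (Fin n)} (h : ¬ σ ⊆ F) :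
    frLk σ y F = 0 := if_neg h

/-- link top cycles -/
noncomputable def linkCyc (Δ : SC n) {d e : ℕ} {σ : Finset (Fin n)} (hσ : σ ∈ Δ.faces) (hde : d = e + σ.card) :
    Cyc k Δ.low d σ ≃ₗ[k] Cyc k (Δ.link σ hσ).low e ∅ where
  toFun z := ⟨toLk σ z.1, by
    refine ⟨fun τ hτ => ?_, fun G hG _ => ?_⟩
    · by_cases hd : Disjoint τ σ
      · rw [toLk_pos hd, z.2.1, mul_zero]
        rintro ⟨h1, h2, _⟩
        rw [Finset.card_union_of_disjoint hd] at h2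
        exact hτ ⟨mem_link.2 ⟨hd, h1⟩, by omega, by simp⟩
      · rw [toLk_neg hd]
    · by_cases hd : Disjoint G σ
      · have h1 := z.2.2 (G ∪ σ) (by rw [Finset.card_union_of_disjoint hd]; omega) Finset.subset_union_right
        rw [← mul_zero (sg k σ G), ← h1, Finset.mul_sum]
        symm
        refine Finset.sum_subset_zero_on_sdiff ?_ ?_ ?_
        · exact Finset.compl_subset_compl.2 Finset.subset_union_left
        · intro v hv
          rw [Finset.mem_sdiff, Finset.mem_compl, Finset.mem_compl, Finset.mem_union, not_not] at hv
          rw [toLk_neg, mul_zero]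
          intro h
          rcases hv.2 with h' | h'
          · exact hv.1 h'
          · exact Finset.disjoint_left.1 h (Finset.mem_insert_self _ _) h'
        · intro v hv
          rw [Finset.mem_compl, Finset.mem_union, not_or] at hv
          rw [toLk_pos (Finset.disjoint_insert_left.2 ⟨hv.2, hd⟩), sg_insert hv.1, eps_union hd,
            Finset.insert_union]
          ring
      · refine Finset.sum_eq_zero fun v _ => ?_
        rw [toLk_neg, mul_zero]
        intro h
        exact hd (Finset.disjoint_of_subset_left (Finset.subset_insert _ _) h)⟩
  invFun y := ⟨frLk σ y.1, by
    refine ⟨fun F hF => ?_, fun G hG hs => ?_⟩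
    · by_cases hs : σ ⊆ F
      · rw [frLk_pos hs, y.2.1, mul_zero]
        rintro ⟨h1, h2, _⟩
        rw [Finset.card_sdiff_of_subset hs] at h2
        have := Finset.card_le_card hs
        have h3 := (mem_link.1 h1).2
        rw [Finset.sdiff_union_of_subset hs] at h3
        exact hF ⟨h3, by omega, hs⟩
      · rw [frLk_neg hs]
    · have hu : G \ σ ∪ σ = G := Finset.sdiff_union_of_subset hs
      have hd : Disjoint (G \ σ) σ := Finset.sdiff_disjoint
      have hcc := Finset.card_le_card hs
      have h1 := y.2.2 (G \ σ) (by rw [Finset.card_sdiff_of_subset hs]; omega) (by simp)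
      rw [← mul_zero (sg k σ (G \ σ)), ← h1, Finset.mul_sum]
      refine Finset.sum_subset_zero_on_sdiff ?_ ?_ ?_
      · exact Finset.compl_subset_compl.2 Finset.sdiff_subset
      · intro v hv
        rw [Finset.mem_sdiff, Finset.mem_compl, Finset.mem_compl, not_not, Finset.mem_sdiff] at hv
        rw [y.2.1, mul_zero, mul_zero]
        rintro ⟨h, _⟩
        by_cases hvs : v ∈ σ
        · exact Finset.disjoint_left.1 (mem_link.1 h).1 (Finset.mem_insert_self _ _) hvs
        · exact hv.1 ⟨hv.2, hvs⟩
      · intro v hv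
        rw [Finset.mem_compl] at hv
        have hvs : v ∉ σ := fun h => hv (hs h)
        rw [frLk_pos (hs.trans (Finset.subset_insert _ _)), Finset.insert_sdiff_of_notMem _ hvs,
          sg_insert (fun h => hv (Finset.mem_sdiff.1 h).1)]
        conv_lhs => rw [← hu, eps_union hd, hu]
        linear_combination (eps k v (G \ σ) * sg k σ (G \ σ) * y.1 (insert v (G \ σ))) * eps_sq k v σ⟩
  left_inv z := by
    apply Subtype.ext
    funext F
    change frLk σ (toLk σ z.1) F = _
    by_cases hs : σ ⊆ F
    · rw [frLk_pos hs]
      rw [toLk_pos Finset.sdiff_disjoint, ← mul_assoc, sg_sq, one_mul, Finset.sdiff_union_of_subset hs]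
    · rw [frLk_neg hs, z.2.1]
      exact fun h => hs h.2.2
  right_inv y := by
    apply Subtype.ext
    funext τ
    change toLk σ (frLk σ y.1) τ = _
    by_cases hd : Disjoint τ σ
    · rw [toLk_pos hd]
      rw [frLk_pos Finset.subset_union_right, Finset.union_sdiff_right, Finset.sdiff_eq_self_of_disjoint hd,
        ← mul_assoc, sg_sq, one_mul]
    · rw [toLk_neg hd, y.2.1]
      exact fun h => hd (mem_link.1 h.1).1
  map_add' x y := by
    apply Subtype.ext
    funext τ
    change toLk σ (x.1 + y.1) τ = toLk σ x.1 τ + toLk σ y.1 τ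
    unfold toLk
    split_ifs
    · exact mul_add _ _ _
    · simp
  map_smul' c x := by
    apply Subtype.ext
    funext τ
    change toLk σ (c • x.1) τ = c * toLk σ x.1 τ
    unfold toLk
    split_ifs
    · exact mul_left_comm _ _ _
    · simp

lemma link_sphere {Δ : SC n} {d : ℕ} (hR : Reis k Δ.low d) (hle : ∀ F ∈ Δ.low, F.card ≤ d)
    {σ : Finset (Fin n)} (hσ : σ ∈ Δ.faces) :
    SC.HomologySphereCond k (Δ.link σ hσ) ↔ OneDim k Δ.low d σ := by
  have hc := hle σ ((SC.mem_low).2 hσ)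
  have hsup : (Δ.link σ hσ).faces.sup Finset.card = d - σ.card := by
    apply le_antisymm
    · refine Finset.sup_le fun τ hτ => ?_
      obtain ⟨h1, h2⟩ := mem_link.1 ((SC.mem_low).2 hτ)
      have := hle _ h2
      rw [Finset.card_union_of_disjoint h1] at this
      omega
    · obtain ⟨F, h1, h2, h3⟩ := purity_facet hR hle ((SC.mem_low).2 hσ)
      have h4 : F \ σ ∈ (Δ.link σ hσ).faces := (SC.mem_low).1 (mem_link.2
        ⟨Finset.sdiff_disjoint, by rwa [Finset.sdiff_union_of_subset h3]⟩)
      have h5 := Finset.le_sup (f := Finset.card) h4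
      rwa [Finset.card_sdiff_of_subset h3, h2] at h5
  rw [sphere_iff _ _ hsup (link_reis hR hσ), oneDim_iff, oneDim_iff]
  have E := linkCyc (k := k) Δ (d := d) (e := d - σ.card) hσ (by omega)
  exact ⟨fun ⟨g⟩ => ⟨E.trans g⟩, fun ⟨g⟩ => ⟨E.symm.trans g⟩⟩

end TP7b

end PieceP7b

section PieceP7c

section TP7c

variable {k : Type} [Field k] {n : ℕ}

lemma unred_iff (Δ : SC n) (i : ℕ) (hi : ∀ F ∈ Δ.faces, F.card ≤ i+1) :
    Nontrivial (Δ.homologyUnred k i) ↔ Δ.cyclesUnred k i ≠ ⊥ := by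
  have h : Submodule.comap (Δ.cyclesUnred k i).subtype (LinearMap.range (Δ.relBoundary k ∅ (i + 1))) = ⊥ := by
    rw [range_bot Δ (i+1) hi, eq_bot_iff]
    rintro ⟨x, hx⟩ h
    rw [Submodule.mem_comap] at h
    rw [Submodule.mem_bot]
    exact Subtype.ext ((Submodule.mem_bot k).1 h)
  have E : Δ.homologyUnred k i ≃ₗ[k] Δ.cyclesUnred k i := Submodule.quotEquivOfEqBot _ h
  rw [← Submodule.nontrivial_iff_ne_bot]
  exact E.toEquiv.nontrivial_congr

lemma manifold_iff (Δ : SC n) (d : ℕ) (hd : Δ.faces.sup Finset.card = d) (hR : Reis k Δ.low d) :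
    (Δ.IsHomologyManifold k ∧ ¬ Δ.Orientable k) ↔
      (2 ≤ d ∧ (∀ z ∈ Cyc k Δ.low d ∅, z = 0) ∧ ∀ σ ∈ Δ.low, σ ≠ ∅ → OneDim k Δ.low d σ) := by
  have hle : ∀ F ∈ Δ.faces, F.card ≤ d := fun F hF => by
    rw [← hd]; exact Finset.le_sup (f := Finset.card) hF
  have hle' : ∀ F ∈ Δ.low, F.card ≤ d := fun F hF => hle F ((SC.mem_low).1 hF)
  have hdim : Δ.dim = (d : ℤ) - 1 := by rw [SC.dim, hd]
  have hor : 2 ≤ d → (¬ Δ.Orientable k ↔ ∀ z ∈ Cyc k Δ.low d ∅, z = 0) := by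
    intro h2
    obtain ⟨i, rfl⟩ : ∃ i, d = i + 1 := ⟨d - 1, by omega⟩
    have hcyc : Δ.cyclesUnred k i = LinearMap.ker (Δ.relBoundary k ∅ i) := if_neg (by omega)
    have h1 : Δ.Orientable k ↔ Nontrivial (Δ.homologyUnred k i) := by
      constructor
      · rintro ⟨j, hj, h⟩
        obtain rfl : j = i := by omega
        exact h
      · intro h
        exact ⟨i, by rw [hdim]; push_cast; ring, h⟩
    rw [h1, unred_iff Δ i hle, not_not, hcyc, ← Submodule.subsingleton_iff_eq_bot,
      (kerCyc (k := k) Δ i).toEquiv.subsingleton_congr, Submodule.subsingleton_iff_eq_bot, Submodule.eq_bot_iff]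
  constructor
  · rintro ⟨⟨⟨⟨v, hv⟩, _⟩, hs⟩, ho⟩
    have h1 : 1 ≤ d := hle _ hv
    have h2 : 2 ≤ d := by
      by_contra h
      obtain rfl : d = 1 := by omega
      apply ho
      refine ⟨0, by rw [hdim]; simp, ?_⟩
      rw [unred_iff Δ 0 hle, SC.cyclesUnred, if_pos rfl]
      intro h
      have h3 : (fun _ => 1 : Δ.relChain k ∅ 1) ∈ (⊤ : Submodule k (Δ.relChain k ∅ 1)) := Submodule.mem_top
      have h4 := (Submodule.eq_bot_iff _).1 h _ h3
      exact one_ne_zero (congrFun h4 ⟨{v}, hv, by simp, by simp⟩)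
    refine ⟨h2, (hor h2).1 ho, fun σ hσ h0 => ?_⟩
    exact (link_sphere hR hle' ((SC.mem_low).1 hσ)).1 (hs σ _ h0)
  · rintro ⟨h2, h0, h1⟩
    refine ⟨⟨⟨?_, ?_⟩, fun σ hσ hne => (link_sphere hR hle' hσ).2 (h1 σ ((SC.mem_low).2 hσ) hne)⟩, (hor h2).2 h0⟩
    · obtain ⟨v, _, hv⟩ := purity hR ((SC.mem_low).2 Δ.empty_mem) (by simp; omega)
      exact ⟨v, (SC.mem_low).1 (by simpa using hv)⟩
    · intro u v hu hv
      refine link_conn (σ := ∅) hR (by simpa using h2)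
        {w | Relation.ReflTransGen (fun a b => ({a, b} : Finset (Fin n)) ∈ Δ.faces) u w} u
        Relation.ReflTransGen.refl ⟨by simp, (SC.mem_low).2 hu⟩ ?_ v (by simp) ((SC.mem_low).2 hv)
      intro a b ha _ _ hab hf
      refine Relation.ReflTransGen.tail ha ?_
      have := (SC.mem_low).1 hf
      rw [Finset.insert_comm] at this
      exact this

end TP7c

end PieceP7c

section TP10

set_option maxHeartbeats 1000000 in
set_option synthInstance.maxHeartbeats 1000000 in
lemma main_aux (k : Type) [Field k] {n : ℕ} (Δ : SC n) (I : Ideal (MvPolynomial (Fin n) k))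
    (hI : I = mI k Δ.low)
    (hCM : IsCohenMacaulayAt (MvPolynomial (Fin n) k ⧸ I) (quotMax k I))
    (ω : Type) [AddCommGroup ω] [Module (MvPolynomial (Fin n) k ⧸ I) ω]
    (hω : IsCanonicalModuleQ k I ω) :
    traceIdeal (MvPolynomial (Fin n) k ⧸ I) ω = quotMax k I ^ 2 ↔
      (Δ.IsHomologyManifold k ∧ ¬ Δ.Orientable k) := by
  subst hI
  obtain ⟨d, hd⟩ : ∃ d, Δ.faces.sup Finset.card = d := ⟨_, rfl⟩
  have hΓ : ∀ F ∈ Δ.low, F.card ≤ d := fun F hF => by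
    rw [← hd]; exact Finset.le_sup (f := Finset.card) ((SC.mem_low).1 hF)
  have hF : ∃ F ∈ Δ.low, F.card = d := by
    obtain ⟨F, hF, hFc⟩ := Finset.exists_mem_eq_sup Δ.faces ⟨∅, Δ.empty_mem⟩ Finset.card
    exact ⟨F, (SC.mem_low).2 hF, by rw [← hFc, hd]⟩
  have hR : Reis k Δ.low d := by
    refine reisner Δ.low d fun j hj => ?_
    have h1 := hCM.2 j (by
      rw [krull_dim Δ.low d hΓ hF]
      exact_mod_cast hj)
    exact (extModEquiv _ _ j).symm.toEquiv.subsingleton_congr.2 h1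
  rw [trace_transfer hΓ hF ω hω, manifold_iff Δ d hd hR]
  exact ⟨fun h => forward hR hΓ ((SC.mem_low).2 Δ.empty_mem) h,
    fun h => backward hR hΓ h.1 h.2.1 h.2.2⟩

end TP10

set_option maxHeartbeats 1000000 in
set_option synthInstance.maxHeartbeats 1000000 in
/-- Let `R = k[Δ]` be a Cohen--Macaulay Stanley--Reisner ring.  Then
`tr(ω_R) = 𝔐_R^2` (i.e. `R` is Gorenstein on the punctured spectrum but not nearly
Gorenstein) if and only if `Δ` is a non-`k`-orientable `k`-homology manifold. -/
theorem trace_eq_maxIdeal_sq_iff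
    (k : Type) [Field k] {n : ℕ} (Δ : SC n)
    (hCM : IsCohenMacaulayAt (SRRing k Δ) (srMax k Δ))
    (ω : Type) [AddCommGroup ω] [Module (SRRing k Δ) ω]
    (hω : IsCanonicalModuleQ k (srIdeal k Δ) ω) :
    traceIdeal (SRRing k Δ) ω = srMax k Δ ^ 2 ↔
      (Δ.IsHomologyManifold k ∧ ¬ Δ.Orientable k) := by
  exact main_aux k Δ (srIdeal k Δ) (srIdeal_eq k Δ) hCM ω hω
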